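/- arXiv:1902.05133 — 2 statements merged into one kernel-verified Lean document; each statement's English description precedes it below -/
import Mathlib

section
/- Let X ⊂ P³(K) be a smooth surface of degree d ≥ 3 over an algebraically closed field K of characteristic 0 or of characteristic p > d. Let ℓ₁ be the number of lines of the first kind contained in X and ℓ₂ the number of lines of the second kind contained in X. Then ℓ₁ + 2ℓ₂ ≤ d(11d − 24). -/
open MvPolynomial

/-- The restriction of the polynomial `g` to the line through `[u]` spanned by `u` and `v`,
under the linear parametrization `t ↦ u + t • v`. -/
noncomputable def restrictLine {K : Type*} [CommSemiring K] {n : ℕ}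
    (g : MvPolynomial (Fin n) K) (u v : Fin n → K) : Polynomial K :=
  MvPolynomial.aeval (fun i => Polynomial.C (u i) + Polynomial.X * Polynomial.C (v i)) g

/-- `ordGE g u v k` means: the order of vanishing at the point `P = [u]` of the restriction
of `g` to the line spanned by `u` and `v` is at least `k` (this includes the case of the
identically vanishing restriction, i.e. order `∞`). -/
def ordGE {K : Type*} [CommSemiring K] {n : ℕ}
    (g : MvPolynomial (Fin n) K) (u v : Fin n → K) (k : ℕ) : Prop :=
  ∀ j < k, (restrictLine g u v).coeff j = 0

/-- `f` defines a smooth surface of degree `d` in `ℙ³(K)`: `f` is homogeneous of degree `d`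
and its four partial derivatives have no common zero in `ℙ³(K)`. -/
def IsSmoothSurfaceOfDegree {K : Type*} [CommSemiring K]
    (f : MvPolynomial (Fin 4) K) (d : ℕ) : Prop :=
  f.IsHomogeneous d ∧
    ∀ w : Fin 4 → K, w ≠ 0 → ∃ i : Fin 4, MvPolynomial.eval w (MvPolynomial.pderiv i f) ≠ 0

/-- A line in `ℙ³(K)` (the projectivization of a 2-dimensional linear subspace `W` of `K⁴`)
that is contained in the surface `{f = 0}`. -/
def IsLineInSurface {K : Type*} [Field K]
    (f : MvPolynomial (Fin 4) K) (W : Submodule K (Fin 4 → K)) : Prop :=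
  Module.finrank K W = 2 ∧ ∀ v ∈ W, MvPolynomial.eval v f = 0

/-- `q` is an inflection point of the plane curve `{g = 0} ⊆ ℙ²(K)`: some line `L'` through `q`
meets the curve with multiplicity at least `3` at `q`, or is contained in the curve. -/
def IsInflectionPointAt {K : Type*} [Field K]
    (g : MvPolynomial (Fin 3) K) (q : Fin 3 → K) : Prop :=
  ∃ w : Fin 3 → K, LinearIndependent K ![q, w] ∧
    (ordGE g q w 3 ∨ ∀ s t : K, MvPolynomial.eval (s • q + t • w) g = 0)

/-- The defining condition for a line `L` (given by the subspace `W`) to be of the second kind: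
for every plane `Π = span{a,b,c} ⊇ L = span{a,b}` with residual curve `Γ_Π = {g = 0}`
(where `f|_Π = z · g` in the coordinates `(x,y,z)` on `Π`), every point of `L ∩ Γ_Π`
is an inflection point of `Γ_Π`. -/
def SecondKindCond {K : Type*} [Field K]
    (f : MvPolynomial (Fin 4) K) (d : ℕ) (W : Submodule K (Fin 4 → K)) : Prop :=
  ∀ a b c : Fin 4 → K, a ∈ W → b ∈ W → LinearIndependent K ![a, b, c] →
    ∀ g : MvPolynomial (Fin 3) K, g.IsHomogeneous (d - 1) →
      (∀ x y z : K,
          MvPolynomial.eval (x • a + y • b + z • c) f = z * MvPolynomial.eval ![x, y, z] g) →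
      ∀ s t : K, (s ≠ 0 ∨ t ≠ 0) → MvPolynomial.eval ![s, t, 0] g = 0 →
        IsInflectionPointAt g ![s, t, 0]

/-- A line of the second kind on the surface `{f = 0}`. -/
def IsLineOfSecondKind {K : Type*} [Field K]
    (f : MvPolynomial (Fin 4) K) (d : ℕ) (W : Submodule K (Fin 4 → K)) : Prop :=
  IsLineInSurface f W ∧ SecondKindCond f d W

/-- A line of the first kind on the surface `{f = 0}`. -/
def IsLineOfFirstKind {K : Type*} [Field K]
    (f : MvPolynomial (Fin 4) K) (d : ℕ) (W : Submodule K (Fin 4 → K)) : Prop :=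
  IsLineInSurface f W ∧ ¬ SecondKindCond f d W

namespace FlecnodalBound

/-! ### The resultant of a binary quadratic form and a binary cubic form -/

/-- The resultant of `A s² + B s t + C t²` and `a s³ + b s² t + c s t² + d t³`. -/
def res23 {R : Type*} [CommRing R] (A B C a b c d : R) : R :=
  A ^ 3 * d ^ 2 - A ^ 2 * B * c * d - 2 * A ^ 2 * C * b * d + A ^ 2 * C * c ^ 2
    + A * B ^ 2 * b * d + 3 * A * B * C * a * d - A * B * C * b * c - 2 * A * C ^ 2 * a * c
    + A * C ^ 2 * b ^ 2 - B ^ 3 * a * d + B ^ 2 * C * a * c - B * C ^ 2 * a * b + C ^ 3 * a ^ 2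

theorem res23_gl2 {R : Type*} [CommRing R] (A B C a b c d x y z w : R) :
    res23 (A * x ^ 2 + B * x * y + C * y ^ 2) (2 * A * x * z + B * (x * w + y * z) + 2 * C * y * w)
      (A * z ^ 2 + B * z * w + C * w ^ 2)
      (a * x ^ 3 + b * x ^ 2 * y + c * x * y ^ 2 + d * y ^ 3)
      (3 * a * x ^ 2 * z + b * (x ^ 2 * w + 2 * x * y * z) + c * (2 * x * y * w + y ^ 2 * z)
        + 3 * d * y ^ 2 * w)
      (3 * a * x * z ^ 2 + b * (2 * x * z * w + y * z ^ 2) + c * (x * w ^ 2 + 2 * y * z * w)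
        + 3 * d * y * w ^ 2)
      (a * z ^ 3 + b * z ^ 2 * w + c * z * w ^ 2 + d * w ^ 3) =
      (x * w - y * z) ^ 6 * res23 A B C a b c d := by
  unfold res23; ring

/-! ### Polarized derivatives of a form -/

section Polar

variable {K A : Type*} [CommRing K] [CommRing A] [Algebra K A]

theorem pderiv_comm {σ : Type*} (i j : σ) (f : MvPolynomial σ K) :
    pderiv i (pderiv j f) = pderiv j (pderiv i f) := by
  classical
  have h : ⁅pderiv (R := K) i, pderiv j⁆ =
      (0 : Derivation K (MvPolynomial σ K) (MvPolynomial σ K)) := by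
    apply MvPolynomial.derivation_ext
    intro k
    simp [Derivation.commutator_apply, pderiv_X, Pi.single_apply, apply_ite]
  have := congrArg (fun D => D f) h
  simpa [Derivation.commutator_apply, sub_eq_zero] using this

/-- The directional derivative of `f` at `P` along `u`. -/
noncomputable def D1 (f : MvPolynomial (Fin 4) K) (P u : Fin 4 → A) : A :=
  ∑ i, aeval P (pderiv i f) * u i

/-- The polarized second derivative of `f` at `P`. -/
noncomputable def D2 (f : MvPolynomial (Fin 4) K) (P u v : Fin 4 → A) : A :=
  ∑ i, D1 (pderiv i f) P v * u i

/-- The polarized third derivative of `f` at `P`. -/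
noncomputable def D3 (f : MvPolynomial (Fin 4) K) (P u v w : Fin 4 → A) : A :=
  ∑ i, D2 (pderiv i f) P v w * u i

variable (f : MvPolynomial (Fin 4) K) (P u v w u' v' w' : Fin 4 → A) (c : A)

theorem D1_add : D1 f P (u + u') = D1 f P u + D1 f P u' := by
  simp [D1, mul_add, Finset.sum_add_distrib]

theorem D1_smul : D1 f P (c • u) = c * D1 f P u := by
  simp only [D1, Finset.mul_sum, Pi.smul_apply, smul_eq_mul]
  exact Finset.sum_congr rfl fun i _ => by ring

theorem D1_sub : D1 f P (u - u') = D1 f P u - D1 f P u' := by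
  simp [D1, mul_sub, Finset.sum_sub_distrib]

theorem D1_single (i : Fin 4) : D1 f P (Pi.single i 1) = aeval P (pderiv i f) := by
  simp [D1, Pi.single_apply]

theorem D2_add_left : D2 f P (u + u') v = D2 f P u v + D2 f P u' v := by
  simp [D2, mul_add, Finset.sum_add_distrib]

theorem D2_smul_left : D2 f P (c • u) v = c * D2 f P u v := by
  simp only [D2, Finset.mul_sum, Pi.smul_apply, smul_eq_mul]
  exact Finset.sum_congr rfl fun i _ => by ring

theorem D2_add_right : D2 f P u (v + v') = D2 f P u v + D2 f P u v' := by
  simp [D2, D1_add, add_mul, Finset.sum_add_distrib]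

theorem D2_smul_right : D2 f P u (c • v) = c * D2 f P u v := by
  simp only [D2, Finset.mul_sum, D1_smul, mul_assoc]

theorem D2_symm : D2 f P u v = D2 f P v u := by
  simp only [D2, D1, Finset.sum_mul]
  rw [Finset.sum_comm]
  refine Finset.sum_congr rfl fun i _ => Finset.sum_congr rfl fun j _ => ?_
  rw [pderiv_comm]; ring

theorem D2_single_left (i : Fin 4) : D2 f P (Pi.single i 1) v = D1 (pderiv i f) P v := by
  simp [D2, Pi.single_apply]

theorem D3_add_left : D3 f P (u + u') v w = D3 f P u v w + D3 f P u' v w := by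
  simp [D3, mul_add, Finset.sum_add_distrib]

theorem D3_smul_left : D3 f P (c • u) v w = c * D3 f P u v w := by
  simp only [D3, Finset.mul_sum, Pi.smul_apply, smul_eq_mul]
  exact Finset.sum_congr rfl fun i _ => by ring

theorem D3_swap_right : D3 f P u v w = D3 f P u w v := by
  simp only [D3]
  exact Finset.sum_congr rfl fun i _ => by rw [D2_symm]

theorem D3_swap_left : D3 f P u v w = D3 f P v u w := by
  simp only [D3, D2, Finset.sum_mul]
  rw [Finset.sum_comm]
  refine Finset.sum_congr rfl fun i _ => Finset.sum_congr rfl fun j _ => ?_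
  rw [pderiv_comm]; ring

theorem D3_add_mid : D3 f P u (v + v') w = D3 f P u v w + D3 f P u v' w := by
  rw [D3_swap_left, D3_add_left, D3_swap_left f P v, D3_swap_left f P v']

theorem D3_smul_mid : D3 f P u (c • v) w = c * D3 f P u v w := by
  rw [D3_swap_left, D3_smul_left, D3_swap_left f P v]

theorem D3_add_right : D3 f P u v (w + w') = D3 f P u v w + D3 f P u v w' := by
  rw [D3_swap_right, D3_add_mid, D3_swap_right f P u w, D3_swap_right f P u w']

theorem D3_smul_right : D3 f P u v (c • w) = c * D3 f P u v w := by
  rw [D3_swap_right, D3_smul_mid, D3_swap_right f P u w]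

variable {f}

theorem aeval_mul_euler {n : ℕ} (hf : f.IsHomogeneous n) : D1 f P P = n * aeval P f := by
  have := congrArg (aeval P) hf.sum_X_mul_pderiv
  rw [map_sum, map_nsmul] at this
  simp only [map_mul, aeval_X] at this
  rw [D1, ← nsmul_eq_mul, ← this]
  exact Finset.sum_congr rfl fun i _ => mul_comm _ _

theorem D2_self_left {n : ℕ} (hf : f.IsHomogeneous n) :
    D2 f P P v = (n - 1 : ℕ) * D1 f P v := by
  rw [D2_symm, D2, D1, Finset.mul_sum]
  refine Finset.sum_congr rfl fun i _ => ?_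
  rw [aeval_mul_euler P hf.pderiv]; ring

theorem D3_self_left {n : ℕ} (hf : f.IsHomogeneous n) :
    D3 f P P v w = (n - 1 - 1 : ℕ) * D2 f P v w := by
  rw [D3_swap_left, D3, D2, Finset.mul_sum]
  refine Finset.sum_congr rfl fun i _ => ?_
  rw [D2_self_left P _ hf.pderiv]; ring

end Polar

/-! ### The flecnodal expression -/

section Flec

variable {K A : Type*} [CommRing K] [CommRing A] [Algebra K A]

/-- The resultant of the second and third order terms of `f` at `P` restricted to the span of
`v₁` and `v₂`. -/
noncomputable def flec (f : MvPolynomial (Fin 4) K) (P v₁ v₂ : Fin 4 → A) : A :=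
  res23 (D2 f P v₁ v₁) (2 * D2 f P v₁ v₂) (D2 f P v₂ v₂)
    (D3 f P v₁ v₁ v₁) (3 * D3 f P v₁ v₁ v₂) (3 * D3 f P v₁ v₂ v₂) (D3 f P v₂ v₂ v₂)

variable (f : MvPolynomial (Fin 4) K) (P v₁ v₂ : Fin 4 → A)

theorem D2_comb (x y z w : A) : D2 f P (x • v₁ + y • v₂) (z • v₁ + w • v₂) =
    x * z * D2 f P v₁ v₁ + (x * w + y * z) * D2 f P v₁ v₂ + y * w * D2 f P v₂ v₂ := by
  simp only [D2_add_left, D2_add_right, D2_smul_left, D2_smul_right, D2_symm f P v₂ v₁]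
  ring

theorem D3_comb (x y z w r s : A) :
    D3 f P (x • v₁ + y • v₂) (z • v₁ + w • v₂) (r • v₁ + s • v₂) =
    x * z * r * D3 f P v₁ v₁ v₁ + (x * z * s + x * w * r + y * z * r) * D3 f P v₁ v₁ v₂
     + (x * w * s + y * z * s + y * w * r) * D3 f P v₁ v₂ v₂ + y * w * s * D3 f P v₂ v₂ v₂ := by
  simp only [D3_add_left, D3_add_right, D3_add_mid, D3_smul_left, D3_smul_right, D3_smul_mid,
    D3_swap_left f P v₂ v₁, D3_swap_right f P v₁ v₂ v₁,
    D3_swap_right f P v₂ v₂ v₁]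
  ring

theorem flec_comb (x y z w : A) : flec f P (x • v₁ + y • v₂) (z • v₁ + w • v₂) =
    (x * w - y * z) ^ 6 * flec f P v₁ v₂ := by
  unfold flec
  rw [← res23_gl2]
  simp only [D2_comb, D3_comb]
  congr 1 <;> ring

theorem flec_add_self {n : ℕ} {f : MvPolynomial (Fin 4) K} (hf : f.IsHomogeneous n)
    (hP : aeval P f = 0) (h₁ : D1 f P v₁ = 0) (h₂ : D1 f P v₂ = 0) (a b : A) :
    flec f P (v₁ + a • P) (v₂ + b • P) = flec f P v₁ v₂ := by
  have e0 : D1 f P P = 0 := by rw [aeval_mul_euler P hf, hP, mul_zero]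
  have e2 : ∀ v, D1 f P v = 0 → D2 f P P v = 0 := fun v hv => by
    rw [D2_self_left P _ hf, hv, mul_zero]
  have q : ∀ u v (x y : A), D1 f P u = 0 → D1 f P v = 0 →
      D2 f P (u + x • P) (v + y • P) = D2 f P u v := fun u v x y hu hv => by
    rw [D2_add_left, D2_add_right, D2_add_right]
    simp only [D2_smul_left, D2_smul_right, D2_symm f P u P, e2 _ hv, e2 _ hu, e2 _ e0]
    ring
  have k : ∀ u v w (x y z : A), D1 f P u = 0 → D1 f P v = 0 → D1 f P w = 0 →
      D3 f P (u + x • P) (v + y • P) (w + z • P) =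
        D3 f P u v w + (n - 1 - 1 : ℕ) * (x * D2 f P v w + y * D2 f P u w + z * D2 f P u v) :=
    fun u v w x y z hu hv hw => by
    have h1 : ∀ s t, D3 f P s P t = (n - 1 - 1 : ℕ) * D2 f P s t := fun s t => by
      rw [D3_swap_left, D3_self_left P _ _ hf]
    have h2 : ∀ s t, D3 f P s t P = (n - 1 - 1 : ℕ) * D2 f P s t := fun s t => by
      rw [D3_swap_right, h1]
    have e3 : ∀ s, D1 f P s = 0 → D2 f P s P = 0 := fun s hs => by rw [D2_symm, e2 s hs]
    simp only [D3_add_left, D3_add_mid, D3_add_right, D3_smul_left, D3_smul_mid, D3_smul_right,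
      h1, h2, D3_self_left P _ _ hf, D2_add_left, D2_smul_left, D2_add_right, D2_smul_right,
      e2 _ hv, e2 _ hw, e2 _ e0,
      e3 _ hu]
    ring
  unfold flec
  simp only [q _ _ _ _ h₁ h₁, q _ _ _ _ h₁ h₂, q _ _ _ _ h₂ h₂, k _ _ _ _ _ _ h₁ h₁ h₁,
    k _ _ _ _ _ _ h₁ h₁ h₂, k _ _ _ _ _ _ h₁ h₂ h₂, k _ _ _ _ _ _ h₂ h₂ h₂]
  unfold res23
  ring

theorem flec_eq_zero_of_root [IsDomain A] {x y : A} (hxy : x ≠ 0 ∨ y ≠ 0)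
    (h2 : D2 f P (x • v₁ + y • v₂) (x • v₁ + y • v₂) = 0)
    (h3 : D3 f P (x • v₁ + y • v₂) (x • v₁ + y • v₂) (x • v₁ + y • v₂) = 0) :
    flec f P v₁ v₂ = 0 := by
  have key : ∀ z w : A, (x * w - y * z) ^ 6 * flec f P v₁ v₂ = 0 := fun z w => by
    rw [← flec_comb]
    unfold flec
    rw [h2, h3]
    unfold res23
    ring
  rcases hxy with h | h
  · simpa [h] using key 0 1
  · simpa [h] using key 1 0

section Map

variable {B : Type*} [CommRing B] [Algebra K B] (φ : A →ₐ[K] B)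

theorem aeval_comp (g : MvPolynomial (Fin 4) K) : aeval (φ ∘ P) g = φ (aeval P g) := by
  exact (MvPolynomial.comp_aeval_apply P φ g).symm

theorem map_D1 (u : Fin 4 → A) : φ (D1 f P u) = D1 f (φ ∘ P) (φ ∘ u) := by
  simp [D1, aeval_comp]

theorem map_D2 (u v : Fin 4 → A) : φ (D2 f P u v) = D2 f (φ ∘ P) (φ ∘ u) (φ ∘ v) := by
  simp [D2, map_D1]

theorem map_D3 (u v w : Fin 4 → A) :
    φ (D3 f P u v w) = D3 f (φ ∘ P) (φ ∘ u) (φ ∘ v) (φ ∘ w) := by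
  simp [D3, map_D2]

theorem map_flec : φ (flec f P v₁ v₂) = flec f (φ ∘ P) (φ ∘ v₁) (φ ∘ v₂) := by
  simp [flec, res23, map_D2, map_D3, map_ofNat]

end Map

/-! ### Tangent vectors -/

/-- The tangent vector `f_j e_k - f_k e_j` at `P`. -/
noncomputable def tv (f : MvPolynomial (Fin 4) K) (P : Fin 4 → A) (j k : Fin 4) : Fin 4 → A :=
  aeval P (pderiv j f) • Pi.single k 1 - aeval P (pderiv k f) • Pi.single j 1

theorem D1_tv (j k : Fin 4) : D1 f P (tv f P j k) = 0 := by
  rw [tv, D1_sub, D1_smul, D1_smul, D1_single, D1_single]; ring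

theorem comp_tv {B : Type*} [CommRing B] [Algebra K B] (φ : A →ₐ[K] B) (j k : Fin 4) :
    φ ∘ tv f P j k = tv f (φ ∘ P) j k := by
  ext m
  simp [tv, aeval_comp, Pi.single_apply, apply_ite φ]

/-- Every function on `Fin 4` sums over an enumeration by four distinct indices. -/
theorem sum_four {M : Type*} [AddCommMonoid M] {i j k l : Fin 4} (h : [i, j, k, l].Nodup)
    (g : Fin 4 → M) : ∑ m, g m = g i + g j + g k + g l := by
  have hu : (Finset.univ : Finset (Fin 4)) = {i, j, k, l} := by revert i j k l; decide
  rw [hu]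
  simp only [List.nodup_cons, List.mem_cons, List.not_mem_nil, or_false, not_or] at h
  obtain ⟨⟨h1, h2, h3⟩, ⟨h4, h5⟩, h6, -⟩ := h
  rw [Finset.sum_insert (by simp [*]), Finset.sum_insert (by simp [*]),
    Finset.sum_insert (by simp [*]), Finset.sum_singleton]
  simp only [add_assoc]

theorem exists_four {i j : Fin 4} (h : i ≠ j) : ∃ k l, [i, j, k, l].Nodup := by
  revert i j; decide

end Flec

/-! ### Common zeros and factors of forms -/

section Factor

variable {K : Type*} [Field K]

/-- Two polynomials in four variables vanishing at the origin have another common zero. -/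
theorem exists_common_zero [IsAlgClosed K] (g h : MvPolynomial (Fin 4) K)
    (hg : eval 0 g = 0) (hh : eval 0 h = 0) :
    ∃ w : Fin 4 → K, w ≠ 0 ∧ eval w g = 0 ∧ eval w h = 0 := by
  classical
  by_contra! hcon
  set I : Ideal (MvPolynomial (Fin 4) K) := Ideal.span (({g, h} : Finset _) : Set _) with hI
  let θ : ℕ → MvPolynomial (Fin 4) K →ₐ[K] MvPolynomial (Fin 4) K := fun k =>
    aeval fun i => if i.val < k then 0 else X i
  let p : ℕ → Ideal (MvPolynomial (Fin 4) K) := fun k => RingHom.ker (θ k)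
  have hprime : ∀ k, (p k).IsPrime := fun k => RingHom.ker_isPrime _
  have hlt : ∀ k < 4, p k < p (k + 1) := fun k hk => by
    refine lt_of_le_of_ne (fun x hx => ?_) fun heq => ?_
    · have : (θ (k + 1)).comp (θ k) = θ (k + 1) := by
        ext i
        by_cases h : i.val < k
        · simp [θ, h, h.le]
        · simp [θ, h]
      have hx' : θ k x = 0 := hx
      change θ (k + 1) x = 0
      rw [← this, AlgHom.comp_apply, hx', map_zero]
    · have h1 : (X ⟨k, hk⟩ : MvPolynomial (Fin 4) K) ∈ p (k + 1) := by
        change θ (k + 1) (X ⟨k, hk⟩) = 0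
        simp [θ]
      rw [← heq] at h1
      have h2 : θ k (X ⟨k, hk⟩) = 0 := h1
      simp [θ] at h2
  have hXrad : ∀ i, (X i : MvPolynomial (Fin 4) K) ∈ I.radical := fun i => by
    rw [← vanishingIdeal_zeroLocus_eq_radical (K := K), mem_vanishingIdeal_iff]
    intro x hx
    rw [mem_zeroLocus_iff] at hx
    have h1 := hx g (Ideal.subset_span (by simp))
    have h2 := hx h (Ideal.subset_span (by simp))
    have : x = 0 := by
      by_contra hne
      exact hcon x hne (by simpa [aeval_eq_eval] using h1) (by simpa [aeval_eq_eval] using h2)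
    simp [this]
  have h4 : ∀ q : Ideal (MvPolynomial (Fin 4) K), (∀ i, X i ∈ q) → p 4 ≤ q := fun q hq x hx => by
    have hx' : θ 4 x = 0 := hx
    have hθ : (Ideal.Quotient.mkₐ K q).comp (θ 4) = Ideal.Quotient.mkₐ K q := by
      ext i
      simp [θ, (Ideal.Quotient.eq_zero_iff_mem.2 (hq i))]
    have := congrArg (fun φ => φ x) hθ
    simp only [AlgHom.comp_apply, hx', map_zero] at this
    exact Ideal.Quotient.eq_zero_iff_mem.1 this.symm
  have hθ4 : ∀ x, θ 4 x = C (eval 0 x) := fun x => by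
    have : θ 4 = (Algebra.ofId K _).comp (aeval (0 : Fin 4 → K)) := by
      ext i; simp [θ]
    rw [this]; simp [Algebra.ofId_apply, aeval_eq_eval]
  have hmin : p 4 ∈ I.minimalPrimes := by
    refine ⟨⟨hprime 4, ?_⟩, fun q hq _ => h4 q fun i => ?_⟩
    · rw [hI, Ideal.span_le]
      intro x hx
      simp only [Finset.coe_insert, Finset.coe_singleton, Set.mem_insert_iff,
        Set.mem_singleton_iff] at hx
      change θ 4 x = 0
      rcases hx with rfl | rfl
      · rw [hθ4, hg, map_zero]
      · rw [hθ4, hh, map_zero]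
    · have := hXrad i
      exact hq.1.radical_le_iff.2 hq.2 this
  have hle := Ideal.height_le_card_of_mem_minimalPrimes_span_finset hmin
  have hcard : (({g, h} : Finset (MvPolynomial (Fin 4) K)).card : ℕ∞) ≤ 2 := by
    exact_mod_cast Finset.card_le_two
  have hge : ∀ k : ℕ, k ≤ 4 → (k : ℕ∞) ≤ (p k).height := by
    intro k
    induction k with
    | zero => simp
    | succ k ih =>
      intro hk
      have := hprime k
      have := hprime (k + 1)
      have h1 := Ideal.height_strict_mono_of_isPrime_of_isPrime (hlt k (by omega))
      push_cast
      exact (add_le_add_left (ih (by omega)) 1).trans (Order.add_one_le_of_lt h1)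
  have := (hge 4 le_rfl).trans (hle.trans hcard)
  exact absurd this (by norm_num)

theorem aeval_smul_form {R A σ : Type*} [CommRing R] [CommRing A] [Algebra R A]
    {f : MvPolynomial σ R} {n : ℕ} (hf : f.IsHomogeneous n) (t : A) (u : σ → A) :
    aeval (t • u) f = t ^ n * aeval u f := by
  rw [aeval_def, aeval_def, eval₂_eq, eval₂_eq, Finset.mul_sum]
  refine Finset.sum_congr rfl fun m hm => ?_
  have hm' : ∑ i ∈ m.support, m i = n := by
    have := hf (mem_support_iff.1 hm)
    simpa [Finsupp.weight_apply, Finsupp.sum] using this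
  simp only [Pi.smul_apply, smul_eq_mul, mul_pow, Finset.prod_mul_distrib,
    Finset.prod_pow_eq_pow_sum,
    hm']
  ring

/-- A divisor of a nonzero form which does not vanish at the origin is a unit. -/
theorem isUnit_of_dvd_form {σ : Type*} {f g : MvPolynomial σ K} {n : ℕ} (hf : f.IsHomogeneous n)
    (hf0 : f ≠ 0) (hgf : g ∣ f) (hg : eval 0 g ≠ 0) : IsUnit g := by
  obtain ⟨h, rfl⟩ := hgf
  let Φ : MvPolynomial σ K →ₐ[K] Polynomial (MvPolynomial σ K) :=
    aeval fun i => Polynomial.C (X i) * Polynomial.X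
  have hΦ : Φ (g * h) = Polynomial.C (g * h) * Polynomial.X ^ n := by
    have h1 : (fun i => Polynomial.C (X i : MvPolynomial σ K) * Polynomial.X) =
        (Polynomial.X : Polynomial (MvPolynomial σ K)) • fun i => Polynomial.C (X i) := by
      ext i : 1
      simp only [Pi.smul_apply, smul_eq_mul, mul_comm]
    have h2 : ∀ x, aeval (fun i => Polynomial.C (X i : MvPolynomial σ K)) x =
        Polynomial.C x := fun x => by
      have : ((aeval (fun i => Polynomial.C (X i : MvPolynomial σ K)) :
          MvPolynomial σ K →ₐ[K] _) : MvPolynomial σ K →+* Polynomial (MvPolynomial σ K)) =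
          Polynomial.C := by
        apply MvPolynomial.ringHom_ext <;> simp
      exact congrArg (fun φ => φ x) this
    change aeval _ _ = _
    rw [h1, aeval_smul_form hf, h2, mul_comm]
  have hΦ0 : (Φ g).coeff 0 = C (eval 0 g) := by
    have : (Polynomial.constantCoeff.comp (Φ : MvPolynomial σ K →+* Polynomial (MvPolynomial σ K)))
        = (C : K →+* MvPolynomial σ K).comp (eval 0) := by
      apply MvPolynomial.ringHom_ext <;> simp [Φ]
    exact congrArg (fun φ => φ g) this
  have hΦ1 : ∀ x, (Φ x).eval 1 = x := fun x => by
    have : ((Polynomial.evalRingHom 1).comp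
        (Φ : MvPolynomial σ K →+* Polynomial (MvPolynomial σ K))) = RingHom.id _ := by
      apply MvPolynomial.ringHom_ext <;> simp [Φ]
    exact congrArg (fun φ => φ x) this
  have hne : ∀ x, x ≠ 0 → Φ x ≠ 0 := fun x hx h0 => hx (by rw [← hΦ1 x, h0]; simp)
  have hg0 : g ≠ 0 := left_ne_zero_of_mul hf0
  have hh0 : h ≠ 0 := right_ne_zero_of_mul hf0
  have hdeg := congrArg Polynomial.natDegree hΦ
  have htr := congrArg Polynomial.natTrailingDegree hΦ
  rw [map_mul, Polynomial.natDegree_mul (hne g hg0) (hne h hh0),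
    Polynomial.natDegree_C_mul_X_pow _ _ hf0] at hdeg
  rw [map_mul, Polynomial.natTrailingDegree_mul (hne g hg0) (hne h hh0),
    Polynomial.natTrailingDegree_mul_X_pow (by simpa using hf0),
    Polynomial.natTrailingDegree_C, Polynomial.natTrailingDegree_eq_zero.2
      (Or.inr (by rw [hΦ0]; simpa using hg))] at htr
  have := Polynomial.natTrailingDegree_le_natDegree (Φ h)
  have hg1 : Φ g = Polynomial.C ((Φ g).coeff 0) :=
    Polynomial.eq_C_of_natDegree_eq_zero (by omega)
  rw [← hΦ1 g, hg1, hΦ0, Polynomial.eval_C]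
  exact (isUnit_iff_ne_zero.2 hg).map C

end Factor

/-! ### Smooth surfaces -/

theorem dvd_of_dvd_mul_of_no_prime_factors {R : Type*} [CommRing R] [IsDomain R]
    [UniqueFactorizationMonoid R] {a b c x : R} (n m : ℕ) (ha : a ≠ 0)
    (h : ∀ q, Prime q → q ∣ a → q ∣ b → ¬ q ∣ c)
    (hb : a ^ n ∣ b ^ m * x) (hc : a ^ n ∣ c ^ m * x) : a ^ n ∣ x := by
  classical
  let _ : GCDMonoid R := UniqueFactorizationMonoid.toGCDMonoid R
  have h1 : a ^ n ∣ gcd (b ^ m) (c ^ m) * x :=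
    (dvd_gcd hb hc).trans (gcd_mul_right' x (b ^ m) (c ^ m)).dvd
  refine IsRelPrime.dvd_of_dvd_mul_left ?_ h1
  rw [UniqueFactorizationMonoid.isRelPrime_iff_no_prime_factors (pow_ne_zero _ ha)]
  intro q hqa hqg hq
  exact h q hq (hq.dvd_of_dvd_pow hqa) (hq.dvd_of_dvd_pow (hqg.trans (gcd_dvd_left _ _)))
    (hq.dvd_of_dvd_pow (hqg.trans (gcd_dvd_right _ _)))

section Smooth

variable {K : Type*} [Field K] {d : ℕ} {f : MvPolynomial (Fin 4) K}

theorem natCast_ne_zero_of_char (hchar : ringChar K = 0 ∨ d < ringChar K) {n : ℕ} (h0 : n ≠ 0)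
    (hn : n ≤ d) : (n : K) ≠ 0 := fun h => by
  have h1 := ringChar.dvd h
  rcases hchar with h2 | h2
  · rw [h2] at h1; exact h0 (Nat.eq_zero_of_zero_dvd h1)
  · exact absurd (Nat.le_of_dvd (Nat.pos_of_ne_zero h0) h1) (by omega)

theorem eval_zero_form {σ : Type*} {g : MvPolynomial σ K} {n : ℕ} (hg : g.IsHomogeneous n)
    (hn : n ≠ 0) : eval 0 g = 0 := by
  have := aeval_smul_form hg (0 : K) 0
  simpa [aeval_eq_eval, hn] using this

variable (hf : IsSmoothSurfaceOfDegree f d)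
include hf

theorem smooth_ne_zero : f ≠ 0 := by
  rintro rfl
  obtain ⟨i, hi⟩ := hf.2 (fun _ => 1) (fun h => one_ne_zero (congrFun h 0))
  simp at hi

variable [IsAlgClosed K]

theorem smooth_prime (hd : 3 ≤ d) : Prime f := by
  have h0 := smooth_ne_zero hf
  refine Irreducible.prime ⟨fun hu => ?_, fun a b hab => ?_⟩
  · have := hu.map (eval 0)
    rw [eval_zero_form hf.1 (by omega)] at this
    exact not_isUnit_zero this
  · by_contra! hcon
    have ha : eval 0 a = 0 := by
      by_contra h
      exact hcon.1 (isUnit_of_dvd_form hf.1 h0 ⟨b, hab⟩ h)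
    have hb : eval 0 b = 0 := by
      by_contra h
      exact hcon.2 (isUnit_of_dvd_form hf.1 h0 ⟨a, by rw [hab, mul_comm]⟩ h)
    obtain ⟨w, hw, h1, h2⟩ := exists_common_zero a b ha hb
    obtain ⟨i, hi⟩ := hf.2 w hw
    apply hi
    rw [hab, pderiv_mul]
    simp [h1, h2]

theorem smooth_not_dvd_partials (hd : 3 ≤ d) (i : Fin 4) {q : MvPolynomial (Fin 4) K}
    (hq : Prime q) : ∃ j, j ≠ i ∧ ¬ q ∣ pderiv j f := by
  by_contra! hcon
  have hi := eval_zero_form (hf.1.pderiv (i := i)) (by omega)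
  by_cases hall : ∀ j, j ≠ i → pderiv j f = 0
  · obtain ⟨w, hw, h1, -⟩ := exists_common_zero _ _ hi hi
    obtain ⟨j, hj⟩ := hf.2 w hw
    by_cases hji : j = i
    · exact hj (hji ▸ h1)
    · simp [hall j hji] at hj
  · push Not at hall
    obtain ⟨k, hk, hk0⟩ := hall
    have hq0 : eval 0 q = 0 := by
      by_contra h
      exact hq.not_isUnit (isUnit_of_dvd_form hf.1.pderiv hk0 (hcon k hk) h)
    obtain ⟨w, hw, h1, h2⟩ := exists_common_zero _ _ hi hq0
    obtain ⟨j, hj⟩ := hf.2 w hw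
    by_cases hji : j = i
    · exact hj (hji ▸ h1)
    · obtain ⟨c, hc⟩ := hcon j hji
      simp [hc, h2] at hj

end Smooth

/-! ### Relations between the tangential resultants -/

section Relations

variable {K A : Type*} [CommRing K] [CommRing A] [Algebra K A]
variable (f : MvPolynomial (Fin 4) K) (P : Fin 4 → A)

theorem flec_smul_right (v₁ v₂ : Fin 4 → A) (c : A) :
    flec f P v₁ (c • v₂) = c ^ 6 * flec f P v₁ v₂ := by
  have := flec_comb f P v₁ v₂ 1 0 0 c
  simpa using this

theorem flec_tv_swap (j k l : Fin 4) :
    aeval P (pderiv k f) ^ 6 * flec f P (tv f P j k) (tv f P j l) =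
      aeval P (pderiv j f) ^ 6 * flec f P (tv f P k j) (tv f P k l) := by
  have h1 : tv f P k j = (-1 : A) • tv f P j k + (0 : A) • tv f P j l := by
    simp only [tv]; module
  have h2 : aeval P (pderiv j f) • tv f P k l =
      (-aeval P (pderiv l f)) • tv f P j k + aeval P (pderiv k f) • tv f P j l := by
    simp only [tv]; module
  rw [← flec_smul_right f P _ (tv f P k l), h1, h2, flec_comb]
  ring

theorem flec_swap (v₁ v₂ : Fin 4 → A) : flec f P v₂ v₁ = flec f P v₁ v₂ := by
  have := flec_comb f P v₁ v₂ 0 1 1 0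
  simpa [Even.neg_pow (by decide : Even 6)] using this

theorem flec_tv_point {n : ℕ} {f : MvPolynomial (Fin 4) K} (hf : f.IsHomogeneous n)
    (hP : aeval P f = 0) {i j k l : Fin 4} (h : [i, j, k, l].Nodup) :
    P k ^ 6 * flec f P (tv f P j k) (tv f P j l) =
      P i ^ 6 * flec f P (tv f P j i) (tv f P j l) := by
  have e0 : D1 f P P = 0 := by rw [aeval_mul_euler P hf, hP, mul_zero]
  have hv : P i • tv f P j i + P k • tv f P j k + P l • tv f P j l = aeval P (pderiv j f) • P := by
    have e1 : aeval P (pderiv i f) * P i + aeval P (pderiv j f) * P j + aeval P (pderiv k f) * P k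
        + aeval P (pderiv l f) * P l = 0 := by rw [← e0, D1, sum_four h]
    have hP' : P = P i • Pi.single i 1 + P j • Pi.single j 1 + P k • Pi.single k 1 +
        P l • Pi.single l (1 : A) := by
      rw [← sum_four h fun m => P m • Pi.single m (1 : A)]
      ext m
      simp [Pi.single_apply]
    have hP'' : aeval P (pderiv j f) • P = aeval P (pderiv j f) • (P i • Pi.single i 1 +
      P j • Pi.single j 1 + P k • Pi.single k 1 + P l • Pi.single l (1 : A)) := by rw [← hP']
    rw [hP'']
    have e2 : aeval P (pderiv j f) * P j = -(aeval P (pderiv i f) * P i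
      + aeval P (pderiv k f) * P k + aeval P (pderiv l f) * P l) := by linear_combination e1
    simp only [tv, smul_add, smul_smul, e2]
    module
  have hv' : P k • tv f P j k = ((-P i) • tv f P j i + (-P l) • tv f P j l) +
      aeval P (pderiv j f) • P := by rw [← hv]; module
  have h1 := flec_add_self P ((-P i) • tv f P j i + (-P l) • tv f P j l) (tv f P j l) hf hP
    (by rw [D1_add, D1_smul, D1_smul, D1_tv, D1_tv]; ring) (D1_tv f P j l) (aeval P (pderiv j f)) 0
  rw [← hv', zero_smul, add_zero] at h1
  rw [flec_swap, ← flec_smul_right, flec_swap, h1]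
  have := flec_comb f P (tv f P j i) (tv f P j l) (-P i) (-P l) 0 1
  rw [zero_smul, one_smul, zero_add] at this
  rw [this]
  ring

end Relations

/-! ### The flecnodal form -/

section

variable {K : Type*} [Field K]

theorem not_dvd_of_lt {σ : Type*} {f g : MvPolynomial σ K} {m n : ℕ} (hf : f.IsHomogeneous n)
    (hg : g.IsHomogeneous m) (hg0 : g ≠ 0) (h : m < n) : ¬ f ∣ g := by
  rintro ⟨c, rfl⟩
  have h1 := hg.totalDegree hg0
  rw [totalDegree_mul_of_isDomain (left_ne_zero_of_mul hg0) (right_ne_zero_of_mul hg0),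
    hf.totalDegree (left_ne_zero_of_mul hg0)] at h1
  omega

theorem homogeneousComponent_mul_of_isHomogeneous {σ R : Type*} [CommRing R] {g : MvPolynomial σ R}
    {m : ℕ} (hg : g.IsHomogeneous m) (p : MvPolynomial σ R) (n : ℕ) :
    homogeneousComponent (m + n) (g * p) = g * homogeneousComponent n p := by
  conv_lhs => rw [← sum_homogeneousComponent p, Finset.mul_sum, map_sum]
  have h : ∀ i, homogeneousComponent (m + n) (g * homogeneousComponent i p) =
      if i = n then g * homogeneousComponent n p else 0 := fun i => by
    rw [homogeneousComponent_of_mem (hg.mul (homogeneousComponent_isHomogeneous i p))]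
    by_cases hi : i = n
    · simp [hi]
    · rw [if_neg hi, if_neg (by omega)]
  rw [Finset.sum_congr rfl fun i _ => h i, Finset.sum_ite_eq']
  split_ifs with hn
  · rfl
  · rw [homogeneousComponent_eq_zero, mul_zero]
    simpa using hn

theorem X_dvd_sub_aeval {σ : Type*} [DecidableEq σ] (i : σ) (x : MvPolynomial σ K) :
    X i ∣ x - aeval (fun m => if m = i then (0 : MvPolynomial σ K) else X m) x := by
  rw [← Ideal.mem_span_singleton, ← Ideal.Quotient.eq_zero_iff_mem, map_sub, sub_eq_zero]
  have : (Ideal.Quotient.mkₐ K (Ideal.span {(X i : MvPolynomial σ K)})).comp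
      (aeval (fun m => if m = i then (0 : MvPolynomial σ K) else X m)) =
      Ideal.Quotient.mkₐ K _ := by
    ext m
    by_cases hm : m = i
    · subst hm
      simp [eq_comm]
    · simp [hm]
  exact (congrArg (fun φ => φ x) this).symm

theorem mem_span_X_pow {f : MvPolynomial (Fin 4) K} {d : ℕ} (hfh : f.IsHomogeneous d) (hd : 3 ≤ d)
    (hp : Prime f) {i k l : Fin 4} (hik : i ≠ k) (hil : i ≠ l) (hkl : k ≠ l) (N : ℕ)
    {R R' R'' : MvPolynomial (Fin 4) K} (h1 : f ∣ X k ^ N * R - X i ^ N * R')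
    (h2 : f ∣ X l ^ N * R - X i ^ N * R'') :
    ∃ F h, R = X i ^ N * F + f * h := by
  have hfX : ¬ f ∣ X i := not_dvd_of_lt hfh (isHomogeneous_X K i) (X_ne_zero i) (by omega)
  have hX : ∀ m : Fin 4, Prime (X m : MvPolynomial (Fin 4) K) := fun m => X_prime
  let θ : MvPolynomial (Fin 4) K →ₐ[K] MvPolynomial (Fin 4) K :=
    aeval fun m => if m = i then (0 : MvPolynomial (Fin 4) K) else X m
  have hθθ : ∀ x, θ (θ x) = θ x := fun x => by
    have : θ.comp θ = θ := by
      ext m; by_cases hm : m = i <;> simp [θ, hm]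
    exact congrArg (fun φ => φ x) this
  have hθi : θ (X i) = 0 := by simp [θ]
  have hθf : θ f ≠ 0 := fun h0 => by
    have := X_dvd_sub_aeval i f
    change X i ∣ f - θ f at this
    rw [h0, sub_zero] at this
    exact hfX ((((hX i).irreducible.associated_of_dvd hp.irreducible this)).symm.dvd)
  have key : ∀ n ≤ N, ∃ F h, R = X i ^ n * F + f * h := by
    intro n
    induction n with
    | zero => exact fun _ => ⟨R, 0, by simp⟩
    | succ n ih =>
      intro hn
      obtain ⟨F, h, hR⟩ := ih (by omega)
      obtain ⟨e, rfl⟩ : ∃ e, N = n + (e + 1) := ⟨N - n - 1, by omega⟩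
      have aux : ∀ (m : Fin 4) (S : MvPolynomial (Fin 4) K), m ≠ i →
          f ∣ X m ^ (n + (e + 1)) * R - X i ^ (n + (e + 1)) * S →
          θ f ^ 1 ∣ X m ^ (n + (e + 1)) * θ F := fun m S hm hS => by
        have h3 : f ∣ X i ^ n * (X m ^ (n + (e + 1)) * F - X i ^ (e + 1) * S) := by
          rw [hR] at hS
          have := dvd_sub hS (dvd_mul_right f (X m ^ (n + (e + 1)) * h))
          convert this using 1
          ring
        have h4 := (hp.dvd_or_dvd h3).resolve_left fun h => hfX (hp.dvd_of_dvd_pow h)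
        have h5 := map_dvd θ h4
        rw [map_sub, map_mul, map_mul, map_pow, map_pow, hθi] at h5
        simpa [θ, hm] using h5
      have h6 : θ f ^ 1 ∣ θ F := by
        refine dvd_of_dvd_mul_of_no_prime_factors 1 (n + (e + 1)) hθf (fun q hq _ hqk hql => ?_)
          (aux k _ hik.symm h1) (aux l _ hil.symm h2)
        have := (hq.irreducible.associated_of_dvd (hX k).irreducible hqk).symm.dvd.trans hql
        exact hkl (X_dvd_X.1 this)
      rw [pow_one] at h6
      obtain ⟨c, hc⟩ := h6
      have h7 : θ (F - f * c) = 0 := by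
        rw [map_sub, map_mul, sub_eq_zero, ← hθθ F, hc, map_mul, hθθ]
      obtain ⟨F', hF'⟩ := X_dvd_sub_aeval i (F - f * c)
      change _ - θ _ = _ at hF'
      rw [h7, sub_zero, sub_eq_iff_eq_add] at hF'
      exact ⟨F', h + X i ^ n * c, by rw [hR, hF']; ring⟩
  exact key N le_rfl

end

section

variable {K : Type*} [Field K]

section Homogeneous

variable {f : MvPolynomial (Fin 4) K} {d a b c m : ℕ}
  {u v w : Fin 4 → MvPolynomial (Fin 4) K}

theorem D1_isHomogeneous (hf : f.IsHomogeneous (d + 1)) (hu : ∀ i, (u i).IsHomogeneous a) :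
    (D1 f X u).IsHomogeneous (d + a) :=
  IsHomogeneous.sum _ _ _ fun i _ => by
    rw [aeval_X_left, AlgHom.id_apply]
    exact IsHomogeneous.mul (hf.pderiv) (hu i)

theorem D2_isHomogeneous (hf : f.IsHomogeneous (d + 2)) (hu : ∀ i, (u i).IsHomogeneous a)
    (hv : ∀ i, (v i).IsHomogeneous b) : (D2 f X u v).IsHomogeneous (d + b + a) :=
  IsHomogeneous.sum _ _ _ fun i _ => (D1_isHomogeneous hf.pderiv hv).mul (hu i)

theorem D3_isHomogeneous (hf : f.IsHomogeneous (d + 3)) (hu : ∀ i, (u i).IsHomogeneous a)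
    (hv : ∀ i, (v i).IsHomogeneous b) (hw : ∀ i, (w i).IsHomogeneous c) :
    (D3 f X u v w).IsHomogeneous (d + c + b + a) :=
  IsHomogeneous.sum _ _ _ fun i _ => (D2_isHomogeneous hf.pderiv hv hw).mul (hu i)

theorem tv_isHomogeneous (hf : f.IsHomogeneous (d + 1)) (j k i : Fin 4) :
    (tv f (X : _ → MvPolynomial (Fin 4) K) j k i).IsHomogeneous d := by
  have h : ∀ j : Fin 4, (pderiv j f).IsHomogeneous d := fun j => hf.pderiv (i := j)
  simp only [tv, Pi.sub_apply, Pi.smul_apply, Pi.single_apply, smul_eq_mul, aeval_X_left,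
    AlgHom.id_apply, mul_ite, mul_one, mul_zero]
  refine IsHomogeneous.sub (R := K) ?_ ?_ <;> split_ifs
  exacts [h _, isHomogeneous_zero _ _ _, h _, isHomogeneous_zero _ _ _]

theorem res23_isHomogeneous {A B C α β γ δ : MvPolynomial (Fin 4) K}
    (hA : A.IsHomogeneous a) (hB : B.IsHomogeneous a) (hC : C.IsHomogeneous a)
    (hα : α.IsHomogeneous b) (hβ : β.IsHomogeneous b) (hγ : γ.IsHomogeneous b)
    (hδ : δ.IsHomogeneous b) : (res23 A B C α β γ δ).IsHomogeneous (3 * a + 2 * b) := by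
  have key : ∀ {x y z s t : MvPolynomial (Fin 4) K}, x.IsHomogeneous a → y.IsHomogeneous a →
      z.IsHomogeneous a → s.IsHomogeneous b → t.IsHomogeneous b → ∀ n : ℕ,
      ((n : MvPolynomial (Fin 4) K) * (x * y * z * s * t)).IsHomogeneous (3 * a + 2 * b) := by
    intro x y z s t hx hy hz hs ht n
    have hn : ((n : MvPolynomial (Fin 4) K)).IsHomogeneous 0 := by
      rw [← map_natCast (MvPolynomial.C (R := K))]; exact MvPolynomial.isHomogeneous_C _ _
    convert hn.mul ((((hx.mul hy).mul hz).mul hs).mul ht) using 1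
    ring
  have : res23 A B C α β γ δ = (1 : ℕ) * (A * A * A * δ * δ) - (1 : ℕ) * (A * A * B * γ * δ)
      - (2 : ℕ) * (A * A * C * β * δ) + (1 : ℕ) * (A * A * C * γ * γ)
      + (1 : ℕ) * (A * B * B * β * δ) + (3 : ℕ) * (A * B * C * α * δ)
      - (1 : ℕ) * (A * B * C * β * γ) - (2 : ℕ) * (A * C * C * α * γ)
      + (1 : ℕ) * (A * C * C * β * β) - (1 : ℕ) * (B * B * B * α * δ)
      + (1 : ℕ) * (B * B * C * α * γ) - (1 : ℕ) * (B * C * C * α * β)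
      + (1 : ℕ) * (C * C * C * α * α) := by
    unfold res23; push_cast; ring
  rw [this]
  refine IsHomogeneous.add (.sub (.add (.sub (.add (.sub (.sub (.add (.add (.add (.sub (.sub
    ?_ ?_) ?_) ?_) ?_) ?_) ?_) ?_) ?_) ?_) ?_) ?_) ?_ <;> exact key ‹_› ‹_› ‹_› ‹_› ‹_› _

theorem flec_tv_isHomogeneous (hf : f.IsHomogeneous (m + 3)) (j k l : Fin 4) :
    (flec f (X : _ → MvPolynomial (Fin 4) K) (tv f X j k) (tv f X j l)).IsHomogeneous
      (17 * m + 27) := by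
  have h := tv_isHomogeneous (K := K) (d := m + 2) hf
  have two : ((2 : MvPolynomial (Fin 4) K)).IsHomogeneous 0 := by
    rw [← map_ofNat (MvPolynomial.C (R := K))]; exact MvPolynomial.isHomogeneous_C _ _
  have three : ((3 : MvPolynomial (Fin 4) K)).IsHomogeneous 0 := by
    rw [← map_ofNat (MvPolynomial.C (R := K))]; exact MvPolynomial.isHomogeneous_C _ _
  have h2 : ∀ k l : Fin 4, (D2 f X (tv f X j k) (tv f X j l)).IsHomogeneous (3 * m + 5) :=
      fun k l => by
    convert D2_isHomogeneous (d := m + 1) hf (h j k) (h j l) using 1; ring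
  have h3 : ∀ k l r : Fin 4, (D3 f X (tv f X j k) (tv f X j l) (tv f X j r)).IsHomogeneous
      (4 * m + 6) :=
    fun k l r => by
      convert D3_isHomogeneous (d := m) hf (h j k) (h j l) (h j r) using 1; ring
  have h4 := two.mul (h2 k l)
  have h5 := three.mul (h3 k k l)
  have h6 := three.mul (h3 k l l)
  rw [zero_add] at h4 h5 h6
  rw [show 17 * m + 27 = 3 * (3 * m + 5) + 2 * (4 * m + 6) by ring]
  exact res23_isHomogeneous (h2 k k) h4 (h2 l l) (h3 k k k) h5 h6 (h3 l l l)

end Homogeneous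

theorem eq_of_nodup {i j k l : Fin 4} (h : [i, j, k, l].Nodup) (r : Fin 4) :
    r = i ∨ r = j ∨ r = k ∨ r = l := by
  revert i j k l r; decide

theorem nodup_rotate {i j k l : Fin 4} (h : [i, j, k, l].Nodup) :
    [k, j, i, l].Nodup ∧ [l, j, i, k].Nodup ∧ [i, j, l, k].Nodup := by
  revert i j k l; decide

theorem eq_or_swap_of_nodup {i j k l k' l' : Fin 4} (h : [i, j, k, l].Nodup)
    (h' : [i, j, k', l'].Nodup) : (k' = k ∧ l' = l) ∨ (k' = l ∧ l' = k) := by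
  revert i j k l k' l'; decide

theorem exists_ne_ne (a b : Fin 4) : ∃ r, r ≠ a ∧ r ≠ b := by
  revert a b; decide

theorem nodup_replace_fst {i i' j k l : Fin 4} (hij : i ≠ j) (hi : i' ≠ i)
    (h : [i', j, k, l].Nodup) :
    (k = i ∧ [i, j, i', l].Nodup) ∨ (l = i ∧ [i, j, i', k].Nodup) := by
  revert i i' j k l; decide

theorem nodup_replace_snd {i j j' k l : Fin 4} (hij : i ≠ j) (hj : j' ≠ j)
    (h : [i, j', k, l].Nodup) :
    (k = j ∧ [i, j, j', l].Nodup) ∨ (l = j ∧ [i, j, j', k].Nodup) := by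
  revert i j j' k l; decide

/-- The surface `F = 0`, of degree `11 d - 24`, cutting out the flecnodal points of `f = 0`. -/
theorem exists_flecnodal_form [IsAlgClosed K] {m : ℕ} {f : MvPolynomial (Fin 4) K}
    (hf : IsSmoothSurfaceOfDegree f (m + 3)) :
    ∃ F : MvPolynomial (Fin 4) K, F.IsHomogeneous (11 * m + 9) ∧
      ∀ i j k l : Fin 4, [i, j, k, l].Nodup →
        f ∣ flec f X (tv f X j k) (tv f X j l) - (X i * pderiv j f) ^ 6 * F := by
  have hp := smooth_prime hf (by omega)
  have hfh := hf.1
  have hfX : ∀ i : Fin 4, ¬ f ∣ X i := fun i =>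
    not_dvd_of_lt hfh (isHomogeneous_X K i) (X_ne_zero i) (by omega)
  have hfp : ∀ j : Fin 4, pderiv j f ≠ 0 → ¬ f ∣ pderiv j f := fun j hj =>
    not_dvd_of_lt hfh hfh.pderiv hj (by omega)
  set Φ : Fin 4 → Fin 4 → Fin 4 → MvPolynomial (Fin 4) K :=
    fun j k l => flec f X (tv f X j k) (tv f X j l) with hΦ
  have hsymm : ∀ j k l, Φ j k l = Φ j l k := fun j k l => flec_swap _ _ _ _
  have hswap : ∀ j k l, pderiv k f ^ 6 * Φ j k l = pderiv j f ^ 6 * Φ k j l := fun j k l => by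
    have := flec_tv_swap f (X : Fin 4 → MvPolynomial (Fin 4) K) j k l
    simpa only [aeval_X_left, AlgHom.id_apply] using this
  have hpoint : ∀ i j k l, [i, j, k, l].Nodup →
      f ∣ X k ^ 6 * Φ j k l - X i ^ 6 * Φ j i l := fun i j k l h => by
    rw [← Ideal.mem_span_singleton, ← Ideal.Quotient.eq_zero_iff_mem, map_sub, sub_eq_zero]
    let φ := Ideal.Quotient.mkₐ K (Ideal.span {f})
    have h0 : aeval (φ ∘ X) f = 0 := by
      rw [aeval_comp, aeval_X_left, AlgHom.id_apply]
      exact Ideal.Quotient.eq_zero_iff_mem.2 (Ideal.mem_span_singleton_self f)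
    have h1 := flec_tv_point (φ ∘ X) hfh h0 h
    simp only [← comp_tv, ← map_flec] at h1
    change φ _ = φ _
    rw [map_mul, map_mul, map_pow, map_pow]
    exact h1
  obtain ⟨j₀, -, hj₀⟩ := smooth_not_dvd_partials hf (by omega) 0 (X_prime (i := (0 : Fin 4)))
  have hj₀ : pderiv j₀ f ≠ 0 := fun h => hj₀ (h ▸ dvd_zero _)
  obtain ⟨i₀, hij₀⟩ : ∃ i₀ : Fin 4, i₀ ≠ j₀ := exists_ne j₀
  obtain ⟨k₀, l₀, hn⟩ := exists_four hij₀
  have hdiv : ∀ i k l, [i, j₀, k, l].Nodup → pderiv j₀ f ^ 6 ∣ Φ j₀ k l := fun i k l h => by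
    refine dvd_of_dvd_mul_of_no_prime_factors 6 6 hj₀ (b := pderiv k f) (c := pderiv l f) ?_
      ⟨_, hswap _ _ _⟩ ⟨Φ l j₀ k, by rw [hsymm, hswap]⟩
    intro q hq h1 h2 h3
    obtain ⟨r, hr, hqr⟩ := smooth_not_dvd_partials hf (by omega) i hq
    rcases eq_of_nodup h r with rfl | rfl | rfl | rfl
    exacts [hr rfl, hqr h1, hqr h2, hqr h3]
  obtain ⟨R, hR⟩ := hdiv i₀ k₀ l₀ hn
  obtain ⟨R', hR'⟩ := hdiv k₀ i₀ l₀ (nodup_rotate hn).1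
  obtain ⟨R'', hR''⟩ := hdiv l₀ i₀ k₀ (nodup_rotate hn).2.1
  have hcancel : ∀ x, f ∣ pderiv j₀ f ^ 6 * x → f ∣ x := fun x hx =>
    (hp.dvd_or_dvd hx).resolve_left fun h => hfp _ hj₀ (hp.dvd_of_dvd_pow h)
  have hn' := hn
  simp only [List.nodup_cons, List.mem_cons, List.not_mem_nil, or_false, not_or] at hn'
  obtain ⟨F₀, h, hF₀⟩ := mem_span_X_pow hfh (by omega) hp (i := i₀) (k := k₀) (l := l₀)
    (R := R) (R' := R') (R'' := R'') hn'.1.2.1 hn'.1.2.2 hn'.2.2.1 6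
    (hcancel _ (by
      have := hpoint i₀ j₀ k₀ l₀ hn
      rw [hR, hR'] at this
      convert this using 1; ring))
    (hcancel _ (by
      have := hpoint i₀ j₀ l₀ k₀ (nodup_rotate hn).2.2
      rw [hsymm _ l₀, hR, hR''] at this
      convert this using 1; ring))
  let A : MvPolynomial (Fin 4) K → Fin 4 → Fin 4 → Prop := fun F i j =>
    ∀ k l, [i, j, k, l].Nodup → f ∣ Φ j k l - (X i * pderiv j f) ^ 6 * F
  refine ⟨homogeneousComponent (11 * m + 9) F₀, homogeneousComponent_isHomogeneous _ _, ?_⟩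
  set F := homogeneousComponent (11 * m + 9) F₀
  have start : A F i₀ j₀ := by
    have h1 : f ∣ Φ j₀ k₀ l₀ - (X i₀ * pderiv j₀ f) ^ 6 * F := by
      have e : Φ j₀ k₀ l₀ = (X i₀ * pderiv j₀ f) ^ 6 * F₀ + f * (pderiv j₀ f ^ 6 * h) := by
        rw [hR, hF₀]; ring
      have e1 : ((X i₀ * pderiv j₀ f) ^ 6).IsHomogeneous (6 * m + 18) := by
        convert ((isHomogeneous_X K i₀).mul (hfh.pderiv (i := j₀))).pow 6 using 1
        simp; ring
      have e2 := congrArg (homogeneousComponent (17 * m + 27)) e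
      rw [homogeneousComponent_eq_self (flec_tv_isHomogeneous hfh _ _ _), map_add,
        show 17 * m + 27 = 6 * m + 18 + (11 * m + 9) by ring,
        homogeneousComponent_mul_of_isHomogeneous e1,
        show 6 * m + 18 + (11 * m + 9) = (m + 3) + (16 * m + 24) by ring,
        homogeneousComponent_mul_of_isHomogeneous hfh] at e2
      rw [show Φ j₀ k₀ l₀ = _ from e2, add_sub_cancel_left]
      exact dvd_mul_right _ _
    intro k l hkl
    rcases eq_or_swap_of_nodup hn hkl with ⟨rfl, rfl⟩ | ⟨rfl, rfl⟩
    · exact h1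
    · rwa [hsymm]
  have move_i : ∀ i i' j, i ≠ j → A F i j → A F i' j := by
    intro i i' j hij hA
    by_cases hi : i' = i
    · rwa [hi]
    have main : ∀ l, [i, j, i', l].Nodup → f ∣ Φ j i l - (X i' * pderiv j f) ^ 6 * F := by
      intro l hl
      have h1 := hA i' l hl
      have h2 := hpoint i j i' l hl
      have h3 : f ∣ X i ^ 6 * (Φ j i l - (X i' * pderiv j f) ^ 6 * F) := by
        convert dvd_sub (h1.mul_left (X i' ^ 6)) h2 using 1
        ring
      exact (hp.dvd_or_dvd h3).resolve_left fun h => hfX i (hp.dvd_of_dvd_pow h)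
    intro k l hkl
    rcases nodup_replace_fst hij hi hkl with ⟨rfl, h⟩ | ⟨rfl, h⟩
    · exact main l h
    · rw [hsymm]; exact main k h
  have move_j : ∀ i j j', i ≠ j → pderiv j f ≠ 0 → A F i j → A F i j' := by
    intro i j j' hij hj hA
    by_cases hjj : j' = j
    · rwa [hjj]
    have main : ∀ l, [i, j, j', l].Nodup → f ∣ Φ j' j l - (X i * pderiv j' f) ^ 6 * F := by
      intro l hl
      have h1 := hA j' l hl
      have h3 : f ∣ pderiv j f ^ 6 * (Φ j' j l - (X i * pderiv j' f) ^ 6 * F) := by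
        convert h1.mul_left (pderiv j' f ^ 6) using 1
        rw [mul_sub, mul_sub, hswap j j' l]
        ring
      exact (hp.dvd_or_dvd h3).resolve_left fun h => hfp j hj (hp.dvd_of_dvd_pow h)
    intro k l hkl
    rcases nodup_replace_snd hij hjj hkl with ⟨rfl, h⟩ | ⟨rfl, h⟩
    · exact main l h
    · rw [hsymm]; exact main k h
  intro i j k l hn
  obtain ⟨r, hr, hr'⟩ : ∃ r : Fin 4, r ≠ j₀ ∧ r ≠ j := exists_ne_ne j₀ j
  exact move_i r i j hr' (move_j r j₀ j hr hj₀ (move_i i₀ r j₀ hij₀ start)) k l hn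

end

/-! ### Restriction to lines -/

section Restrict

variable {K A σ : Type*} [CommRing K] [CommRing A] [Algebra K A]

/-- The restriction of `g` to the line `P + t v`, as a polynomial in `t`. -/
noncomputable def lineRes (g : MvPolynomial σ K) (P v : σ → A) : Polynomial A :=
  aeval (fun i => Polynomial.C (P i) + Polynomial.X * Polynomial.C (v i)) g

theorem eval_lineRes (g : MvPolynomial σ K) (P v : σ → A) (t : A) :
    (lineRes g P v).eval t = aeval (P + t • v) g := by
  have := MvPolynomial.comp_aeval_apply
    (fun i => Polynomial.C (P i) + Polynomial.X * Polynomial.C (v i))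
    ((Polynomial.aeval t).restrictScalars K : Polynomial A →ₐ[K] A) g
  simp only [AlgHom.restrictScalars_apply, Polynomial.coe_aeval_eq_eval] at this
  have h : (fun i => Polynomial.eval t (Polynomial.C (P i) + Polynomial.X * Polynomial.C (v i))) =
      P + t • v := by
    ext i
    simp only [Polynomial.eval_add, Polynomial.eval_C, Polynomial.eval_mul, Polynomial.eval_X,
      Pi.add_apply, Pi.smul_apply, smul_eq_mul]
  rw [lineRes, this, h]

theorem derivative_lineRes (g : MvPolynomial (Fin 4) K) (P v : Fin 4 → A) :
    Polynomial.derivative (lineRes g P v) =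
      ∑ i, Polynomial.C (v i) * lineRes (pderiv i g) P v := by
  induction g using MvPolynomial.induction_on with
  | C a => simp [lineRes, Polynomial.algebraMap_apply]
  | add p q hp hq => simp_all [lineRes, mul_add, Finset.sum_add_distrib]
  | mul_X p n hp =>
    have h1 : ∀ q : MvPolynomial (Fin 4) K, lineRes (q * X n) P v =
      lineRes q P v * (Polynomial.C (P n) + Polynomial.X * Polynomial.C (v n)) := fun q => by
      simp [lineRes]
    rw [h1, Polynomial.derivative_mul, hp]
    have h2 : ∀ i, lineRes (pderiv i (p * X n)) P v = lineRes (pderiv i p) P v *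
        (Polynomial.C (P n) + Polynomial.X * Polynomial.C (v n))
        + if i = n then lineRes p P v else 0 := fun i => by
      rw [← h1, Derivation.leibniz]
      by_cases h : i = n
      · subst h; simp [lineRes]; ring
      · simp [lineRes, pderiv_X_of_ne (Ne.symm h), h]; ring
    simp only [h2, mul_add (Polynomial.C (v _)), Finset.sum_add_distrib, ← mul_assoc,
      ← Finset.sum_mul]
    simp
    ring

theorem coeff_zero_lineRes (g : MvPolynomial σ K) (P v : σ → A) :
    (lineRes g P v).coeff 0 = aeval P g := by
  rw [Polynomial.coeff_zero_eq_eval_zero, eval_lineRes]; simp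

theorem coeff_succ_lineRes (g : MvPolynomial (Fin 4) K) (P v : Fin 4 → A) (n : ℕ) :
    (lineRes g P v).coeff (n + 1) * (n + 1) =
      ∑ i, v i * (lineRes (pderiv i g) P v).coeff n := by
  rw [← Polynomial.coeff_derivative, derivative_lineRes]
  simp [Polynomial.finsetSum_coeff]

theorem coeff_one_lineRes (g : MvPolynomial (Fin 4) K) (P v : Fin 4 → A) :
    (lineRes g P v).coeff 1 = D1 g P v := by
  have := coeff_succ_lineRes g P v 0
  simp only [coeff_zero_lineRes] at this
  simp only [zero_add, Nat.cast_zero, mul_one] at this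
  rw [this, D1]
  exact Finset.sum_congr rfl fun i _ => mul_comm _ _

theorem coeff_two_lineRes (g : MvPolynomial (Fin 4) K) (P v : Fin 4 → A) :
    (lineRes g P v).coeff 2 * 2 = D2 g P v v := by
  have := coeff_succ_lineRes g P v 1
  simp only [coeff_one_lineRes] at this
  rw [D2, show ((2 : A)) = (1 : ℕ) + 1 by norm_num, this]
  exact Finset.sum_congr rfl fun i _ => mul_comm _ _

theorem coeff_three_lineRes (g : MvPolynomial (Fin 4) K) (P v : Fin 4 → A) :
    (lineRes g P v).coeff 3 * 6 = D3 g P v v v := by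
  have := coeff_succ_lineRes g P v 2
  rw [show ((6 : A)) = ((2 : ℕ) + 1) * 2 by norm_num, ← mul_assoc, this, Finset.sum_mul, D3]
  refine Finset.sum_congr rfl fun i _ => ?_
  rw [← coeff_two_lineRes]
  ring

theorem natDegree_coeff_lineRes [Finite σ] {g : MvPolynomial σ K} {n : ℕ} (hg : g.IsHomogeneous n)
    (P v : σ → A) :
    (lineRes g P v).natDegree ≤ n ∧ (lineRes g P v).coeff n = aeval v g := by
  classical
  have key : ∀ (m : σ →₀ ℕ) (s : Finset σ),
      (∏ i ∈ s, (Polynomial.C (P i) + Polynomial.X * Polynomial.C (v i)) ^ m i).natDegree ≤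
        ∑ i ∈ s, m i ∧
      (∏ i ∈ s, (Polynomial.C (P i) + Polynomial.X * Polynomial.C (v i)) ^ m i).coeff
        (∑ i ∈ s, m i) =
        ∏ i ∈ s, v i ^ m i := fun m s => by
    induction s using Finset.induction_on with
    | empty => simp
    | insert i s hi ih =>
      have h1 : (Polynomial.C (P i) + Polynomial.X * Polynomial.C (v i)).natDegree ≤ 1 := by
        compute_degree
      have h2 := Polynomial.natDegree_pow_le_of_le (m i) h1
      rw [mul_one] at h2
      have h3 := Polynomial.coeff_pow_of_natDegree_le (m := m i) h1
      simp only [mul_one] at h3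
      rw [Finset.prod_insert hi, Finset.sum_insert hi, Finset.prod_insert hi]
      refine ⟨Polynomial.natDegree_mul_le_of_le h2 ih.1, ?_⟩
      rw [Polynomial.coeff_mul_add_eq_of_natDegree_le h2 ih.1, ih.2, h3]
      simp
  have hm' : ∀ m ∈ g.support, ∑ i ∈ m.support, m i = n := fun m hm => by
    have := hg (mem_support_iff.1 hm)
    simpa [Finsupp.weight_apply, Finsupp.sum] using this
  unfold lineRes
  rw [aeval_def, aeval_def, eval₂_eq, eval₂_eq]
  constructor
  · refine Polynomial.natDegree_sum_le_of_forall_le _ _ fun m hm => ?_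
    have := (key m m.support).1
    rw [hm' m hm] at this
    rw [Polynomial.algebraMap_apply]
    exact (Polynomial.natDegree_C_mul_le _ _).trans this
  · rw [Polynomial.finsetSum_coeff]
    refine Finset.sum_congr rfl fun m hm => ?_
    have := (key m m.support).2
    rw [hm' m hm] at this
    rw [Polynomial.algebraMap_apply, Polynomial.coeff_C_mul]
    exact congrArg _ this

/-- A tangent vector with vanishing `i`-th coordinate is a combination of `tv j k` and `tv j l`. -/
theorem smul_eq_tv (f : MvPolynomial (Fin 4) K) (P v : Fin 4 → A) {i j k l : Fin 4}
    (h : [i, j, k, l].Nodup) (hi : v i = 0) (hv : D1 f P v = 0) :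
    aeval P (pderiv j f) • v = v k • tv f P j k + v l • tv f P j l := by
  have hv' : v = v i • Pi.single i 1 + v j • Pi.single j 1 + v k • Pi.single k 1 +
      v l • Pi.single l (1 : A) := by
    rw [← sum_four h fun m => v m • Pi.single m (1 : A)]
    ext m
    simp [Pi.single_apply]
  rw [D1, sum_four h, hi] at hv
  have e2 : aeval P (pderiv j f) * v j = -(v k * aeval P (pderiv k f)
    + v l * aeval P (pderiv l f)) := by linear_combination hv
  conv_lhs => rw [hv']
  rw [hi]
  simp only [tv, smul_add, smul_smul, e2]
  module

end Restrict

section Null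

variable {K : Type*} [Field K] [IsAlgClosed K] {d : ℕ} {f : MvPolynomial (Fin 4) K}
  (hf : IsSmoothSurfaceOfDegree f d)
include hf

theorem exists_X_pow_mem :
    ∃ r, ∀ m : Fin 4, X m ^ r ∈ Ideal.span (Set.range fun i => pderiv i f) := by
  have h1 : ∀ m : Fin 4, ∃ r, X m ^ r ∈ Ideal.span (Set.range fun i => pderiv i f) := fun m => by
    rw [← Ideal.mem_radical_iff, ← MvPolynomial.vanishingIdeal_zeroLocus_eq_radical (K := K),
      MvPolynomial.mem_vanishingIdeal_iff]
    intro x hx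
    rw [MvPolynomial.mem_zeroLocus_iff] at hx
    by_contra h
    obtain ⟨i, hi⟩ := hf.2 x (by rintro rfl; simp at h)
    exact hi (by simpa [aeval_eq_eval] using hx _ (Ideal.subset_span ⟨i, rfl⟩))
  choose r hr using h1
  refine ⟨∑ m, r m, fun m => Ideal.pow_mem_of_pow_mem _ (hr m)
    (Finset.single_le_sum (fun _ _ => Nat.zero_le _) (Finset.mem_univ m))⟩

theorem X_pow_mem_map {A : Type*} [CommRing A] [Algebra K A] : ∃ r, ∀ (P : Fin 4 → A) (m : Fin 4),
    P m ^ r ∈ Ideal.span (Set.range fun i => aeval P (pderiv i f)) := by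
  obtain ⟨r, hr⟩ := exists_X_pow_mem hf
  refine ⟨r, fun P m => ?_⟩
  have := Ideal.mem_map_of_mem (aeval P) (hr m)
  rw [Ideal.map_span, ← Set.range_comp, map_pow, aeval_X] at this
  exact this

theorem exists_aeval_pderiv_ne_zero {A : Type*} [CommRing A] [IsDomain A] [Algebra K A]
    {P : Fin 4 → A} (hP : P ≠ 0) : ∃ i, aeval P (pderiv i f) ≠ 0 := by
  by_contra! h
  obtain ⟨r, hr⟩ := X_pow_mem_map hf (A := A)
  refine hP (funext fun m => eq_zero_of_pow_eq_zero (n := r + 1) ?_)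
  have h1 : Ideal.span (Set.range fun i => aeval P (pderiv i f)) = ⊥ := by
    rw [Ideal.span_eq_bot]; rintro _ ⟨i, rfl⟩; exact h i
  have := hr P m
  rw [h1, Ideal.mem_bot] at this
  rw [pow_succ, this, zero_mul]

/-- The partial derivatives of `f` restricted to a line have no common factor. -/
theorem span_lineRes_eq_top {L : Type*} [Field L] [Algebra K L] {P v : Fin 4 → L} {i j : Fin 4}
    (h : P i * v j - P j * v i ≠ 0) :
    Ideal.span (Set.range fun m => lineRes (pderiv m f) P v) = ⊤ := by
  obtain ⟨r, hr⟩ := X_pow_mem_map hf (A := Polynomial L)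
  have h1 := hr (fun i => Polynomial.C (P i) + Polynomial.X * Polynomial.C (v i))
  refine (Ideal.eq_top_iff_one _).2 ?_
  have hcop : IsCoprime (Polynomial.C (P i) + Polynomial.X * Polynomial.C (v i))
      (Polynomial.C (P j) + Polynomial.X * Polynomial.C (v j)) := by
    refine ⟨Polynomial.C (v j / (P i * v j - P j * v i)),
      Polynomial.C (- v i / (P i * v j - P j * v i)), ?_⟩
    have : Polynomial.C ((P i * v j - P j * v i) / (P i * v j - P j * v i)) = 1 := by
      rw [div_self h, Polynomial.C_1]
    rw [← this]
    simp only [div_eq_mul_inv, map_mul, map_neg, map_sub]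
    ring
  obtain ⟨a, b, hab⟩ := hcop.pow (m := r) (n := r)
  rw [← hab]
  exact Ideal.add_mem _ (Ideal.mul_mem_left _ _ (h1 i)) (Ideal.mul_mem_left _ _ (h1 j))

end Null

/-! ### Asymptotic directions and the flecnodal form -/

section Dual

variable {K L : Type*} [Field K] [Field L] [Algebra K L]

theorem aeval_dual (g : MvPolynomial (Fin 4) K) (P y : Fin 4 → L) :
    aeval (fun i => TrivSqZeroExt.inl (P i) + TrivSqZeroExt.inr (y i) : Fin 4 → TrivSqZeroExt L L) g
      = TrivSqZeroExt.inl (aeval P g) + TrivSqZeroExt.inr (D1 g P y) := by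
  induction g using MvPolynomial.induction_on with
  | C a =>
    simp [D1]
    rfl
  | add p q hp hq =>
    have : D1 (p + q) P y = D1 p P y + D1 q P y := by
      simp [D1, add_mul, Finset.sum_add_distrib]
    rw [map_add, hp, hq, map_add, this]
    ext <;> simp
  | mul_X p n hp =>
    have : D1 (p * X n) P y = aeval P p * y n + D1 p P y * P n := by
      simp only [D1, Derivation.leibniz, smul_eq_mul, map_add, map_mul, aeval_X, pderiv_X,
        Pi.single_apply, apply_ite, map_zero, add_mul, Finset.sum_add_distrib,
        ite_mul, mul_one, mul_zero, zero_mul, Finset.sum_mul]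
      simp
      exact Finset.sum_congr rfl fun i _ => by ring
    rw [map_mul, hp, map_mul, aeval_X, aeval_X, this]
    ext
    · simp
    · simp only [TrivSqZeroExt.snd_mul, TrivSqZeroExt.snd_add, TrivSqZeroExt.fst_add,
        TrivSqZeroExt.fst_inl, TrivSqZeroExt.snd_inl, TrivSqZeroExt.fst_inr, TrivSqZeroExt.snd_inr,
        smul_eq_mul, MulOpposite.smul_eq_mul_unop, MulOpposite.unop_op]
      ring

theorem res23_eq_zero_of_fst {A B C a b c d : TrivSqZeroExt L L} (hA : A.fst = 0) (hC : C.fst = 0)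
    (ha : a.fst = 0) (hd : d.fst = 0) : res23 A B C a b c d = 0 := by
  have key : ∀ {x y : TrivSqZeroExt L L}, x.fst = 0 → y.fst = 0 → x * y = 0 := fun hx hy => by
    ext <;> simp [hx, hy]
  unfold res23
  linear_combination (A ^ 2 * d - A * B * c - 2 * A * C * b + B ^ 2 * b + 3 * B * C * a) * key hA hd
    + (A * c ^ 2 - B * b * c - 2 * C * a * c + C * b ^ 2) * key hA hC - B ^ 3 * key ha hd
    + (B ^ 2 * c - B * C * b + C ^ 2 * a) * key hC ha

end Dual

theorem aeval_flec_X {K : Type*} [Field K] (f : MvPolynomial (Fin 4) K) {A : Type*} [CommRing A]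
    [Algebra K A] (P : Fin 4 → A)
    (j k l : Fin 4) : aeval P (flec f (X : _ → MvPolynomial (Fin 4) K) (tv f X j k) (tv f X j l)) =
      flec f P (tv f P j k) (tv f P j l) := by
  have hX : ⇑(aeval P : MvPolynomial (Fin 4) K →ₐ[K] A) ∘
      (X : Fin 4 → MvPolynomial (Fin 4) K) = P := by
    ext m; exact aeval_X P m
  rw [map_flec, comp_tv, comp_tv, hX]

section Asymptotic

variable {K : Type*} [Field K] [IsAlgClosed K] {d n : ℕ} {f F : MvPolynomial (Fin 4) K}
  (hf : IsSmoothSurfaceOfDegree f d)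
  (hF : ∀ i j k l : Fin 4, [i, j, k, l].Nodup →
        f ∣ flec f X (tv f X j k) (tv f X j l) - (X i * pderiv j f) ^ 6 * F)

section

omit [IsAlgClosed K] in
include hF in
theorem flec_eq_aeval {A : Type*} [CommRing A] [Algebra K A] {P : Fin 4 → A} (hP : aeval P f = 0)
    {i j k l : Fin 4} (h : [i, j, k, l].Nodup) :
    flec f P (tv f P j k) (tv f P j l) = (P i * aeval P (pderiv j f)) ^ 6 * aeval P F := by
  obtain ⟨c, hc⟩ := hF i j k l h
  have h2 := congrArg (aeval P) hc
  rw [map_sub, aeval_flec_X, map_mul, map_mul, map_pow, map_mul, aeval_X, hP, zero_mul] at h2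
  exact sub_eq_zero.1 h2

include hf in
theorem exists_point_indices {A : Type*} [CommRing A] [IsDomain A] [Algebra K A] {P : Fin 4 → A}
    (hP : aeval P f = 0) (hP0 : P ≠ 0) :
    ∃ i j k l, [i, j, k, l].Nodup ∧ P i ≠ 0 ∧ aeval P (pderiv j f) ≠ 0 := by
  obtain ⟨j, hj⟩ := exists_aeval_pderiv_ne_zero hf hP0
  suffices ∃ i, i ≠ j ∧ P i ≠ 0 by
    obtain ⟨i, hij, hi⟩ := this
    obtain ⟨k, l, h⟩ := exists_four hij
    exact ⟨i, j, k, l, h, hi, hj⟩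
  by_contra! hcon
  have h1 := aeval_mul_euler P hf.1
  rw [hP, mul_zero, D1, Finset.sum_eq_single j (fun m _ hm => by rw [hcon m hm, mul_zero])
    (by simp)] at h1
  have h2 := (mul_eq_zero.1 h1).resolve_left hj
  exact hP0 (funext fun m => if hm : m = j then hm ▸ h2 else hcon m hm)

end

variable {L : Type*} [Field L] [Algebra K L] {P : Fin 4 → L}

omit [IsAlgClosed K] in
/-- Translating an asymptotic vector to one with a vanishing coordinate. -/
theorem asymptotic_normalize {f : MvPolynomial (Fin 4) K} (hf : f.IsHomogeneous d)
    (hP : aeval P f = 0) {v : Fin 4 → L}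
    (h1 : D1 f P v = 0) (h2 : D2 f P v v = 0) (h3 : D3 f P v v v = 0) (x c : L) :
    D1 f P (x • v + c • P) = 0 ∧ D2 f P (x • v + c • P) (x • v + c • P) = 0 ∧
      D3 f P (x • v + c • P) (x • v + c • P) (x • v + c • P) = 0 := by
  have e1 : D1 f P P = 0 := by rw [aeval_mul_euler P hf, hP, mul_zero]
  have e2 : ∀ w, D1 f P w = 0 → D2 f P P w = 0 := fun w hw => by
    rw [D2_self_left P _ hf, hw, mul_zero]
  refine ⟨?_, ?_, ?_⟩
  · rw [D1_add, D1_smul, D1_smul, h1, e1]; ring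
  · rw [D2_comb, h2, e2 P e1, D2_symm, e2 v h1]; ring
  · rw [D3_comb, h3, D3_swap_left f P v P P, D3_self_left P _ _ hf, D3_swap_right f P v v P,
      D3_swap_left f P v P v, D3_self_left P _ _ hf, D3_self_left P _ _ hf, h2, e2 P e1, D2_symm,
      e2 v h1]
    ring

include hf hF in
theorem flecnodal_eq_zero_of_asymptotic (hP : aeval P f = 0) {v : Fin 4 → L}
    (hv : ∀ x y : L, x • P + y • v = 0 → x = 0 ∧ y = 0)
    (h1 : D1 f P v = 0) (h2 : D2 f P v v = 0) (h3 : D3 f P v v v = 0) : aeval P F = 0 := by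
  have hP0 : P ≠ 0 := fun h => one_ne_zero (hv 1 0 (by simp [h])).1
  obtain ⟨i, j, k, l, hn, hi, hj⟩ := exists_point_indices hf hP hP0
  obtain ⟨e1, e2, e3⟩ := asymptotic_normalize hf.1 hP h1 h2 h3 (P i) (-(v i))
  set u := P i • v + (-(v i)) • P with hu
  have hui : u i = 0 := by simp [hu]; ring
  have huv := smul_eq_tv f P u hn hui e1
  have key : flec f P (tv f P j k) (tv f P j l) = 0 := by
    refine flec_eq_zero_of_root f P _ _ (x := u k) (y := u l) ?_ ?_ ?_
    · by_contra! hcon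
      rw [hcon.1, hcon.2, zero_smul, zero_smul, add_zero, smul_eq_zero] at huv
      have h0 := huv.resolve_left hj
      exact hi (hv _ _ (by rw [← h0, hu, add_comm])).2
    · rw [← huv, D2_smul_left, D2_smul_right, e2]; ring
    · rw [← huv, D3_smul_left, D3_smul_mid, D3_smul_right, e3]; ring
  rw [flec_eq_aeval hF hP hn] at key
  exact (mul_eq_zero.1 key).resolve_left (pow_ne_zero _ (mul_ne_zero hi hj))

include hf hF in
/-- At a point with two asymptotic lines, the flecnodal form vanishes to second order on the
surface. -/
theorem D1_flecnodal_eq_zero (hP : aeval P f = 0) {b v : Fin 4 → L}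
    (hbv : ∀ x y z : L, x • P + y • b + z • v = 0 → x = 0 ∧ y = 0 ∧ z = 0)
    (h1 : D1 f P b = 0) (h2 : D2 f P b b = 0) (h3 : D3 f P b b b = 0)
    (h1' : D1 f P v = 0) (h2' : D2 f P v v = 0) (h3' : D3 f P v v v = 0)
    {y : Fin 4 → L} (hy : D1 f P y = 0) : D1 F P y = 0 := by
  have hP0 : P ≠ 0 := fun h => one_ne_zero (hbv 1 0 0 (by simp [h])).1
  obtain ⟨i, j, k, l, hn, hi, hj⟩ := exists_point_indices hf hP hP0
  obtain ⟨e1, e2, e3⟩ := asymptotic_normalize hf.1 hP h1 h2 h3 (P i) (-(b i))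
  obtain ⟨e1', e2', e3'⟩ := asymptotic_normalize hf.1 hP h1' h2' h3' (P i) (-(v i))
  set b' := P i • b + (-(b i)) • P with hb'
  set v' := P i • v + (-(v i)) • P with hv'
  have hbi : b' i = 0 := by simp [hb']; ring
  have hvi : v' i = 0 := by simp [hv']; ring
  have hb := smul_eq_tv f P b' hn hbi e1
  have hv := smul_eq_tv f P v' hn hvi e1'
  have hind : ∀ x y : L, x • b' + y • v' = 0 → x = 0 ∧ y = 0 := fun x y hxy => by
    have := hbv (-(x * b i) - y * v i) (x * P i) (y * P i) (by rw [← hxy, hb', hv']; module)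
    simpa [hi] using this.2
  have hdet : b' k * v' l - b' l * v' k ≠ 0 := fun hdet => by
    have c1 : aeval P (pderiv j f) • (v' k • b' + (-(b' k)) • v') = 0 := by
      rw [smul_add, smul_comm, hb, smul_comm _ (-(b' k)), hv]
      rw [show (0 : Fin 4 → L) = (-0 : L) • tv f P j l by simp, ← hdet]; module
    have c2 : aeval P (pderiv j f) • (v' l • b' + (-(b' l)) • v') = 0 := by
      rw [smul_add, smul_comm, hb, smul_comm _ (-(b' l)), hv]
      rw [show (0 : Fin 4 → L) = (0 : L) • tv f P j k by simp, ← hdet]; module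
    have c1' := hind _ _ ((smul_eq_zero.1 c1).resolve_left hj)
    have c2' := hind _ _ ((smul_eq_zero.1 c2).resolve_left hj)
    rw [c1'.1, c2'.1, zero_smul, zero_smul, add_zero] at hv
    exact one_ne_zero (hind 0 1 (by rw [(smul_eq_zero.1 hv).resolve_left hj]; simp)).2
  set Q : Fin 4 → TrivSqZeroExt L L :=
    fun i => TrivSqZeroExt.inl (P i) + TrivSqZeroExt.inr (y i) with hQ
  have hQf : aeval Q f = 0 := by rw [hQ, aeval_dual, hP, hy]; simp
  let φ := TrivSqZeroExt.fstHom K L L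
  have hφQ : φ ∘ Q = P := by ext; simp [φ, hQ]
  have unit : ∀ x : TrivSqZeroExt L L, x.fst ≠ 0 → IsUnit x := fun x hx =>
    TrivSqZeroExt.isUnit_iff_isUnit_fst.2 (isUnit_iff_ne_zero.2 hx)
  have hφ : ∀ x z : L, φ ∘ ((TrivSqZeroExt.inl x : TrivSqZeroExt L L) • tv f Q j k
      + (TrivSqZeroExt.inl z : TrivSqZeroExt L L) • tv f Q j l) =
      x • tv f P j k + z • tv f P j l := fun x z => by
    rw [← hφQ, ← comp_tv, ← comp_tv]
    ext m
    simp [φ]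
  have c2 : ∀ u : Fin 4 → L, aeval P (pderiv j f) • u = u k • tv f P j k + u l • tv f P j l →
      D2 f P u u = 0 → φ (D2 f Q ((TrivSqZeroExt.inl (u k) : TrivSqZeroExt L L) • tv f Q j k
      + (TrivSqZeroExt.inl (u l) : TrivSqZeroExt L L) • tv f Q j l)
      ((TrivSqZeroExt.inl (u k) : TrivSqZeroExt L L) • tv f Q j k
      + (TrivSqZeroExt.inl (u l) : TrivSqZeroExt L L) • tv f Q j l)) = 0 := fun u hu h => by
    rw [map_D2, hφQ, hφ, ← hu, D2_smul_left, D2_smul_right, h]; ring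
  have c3 : ∀ u : Fin 4 → L, aeval P (pderiv j f) • u = u k • tv f P j k + u l • tv f P j l →
      D3 f P u u u = 0 → φ (D3 f Q ((TrivSqZeroExt.inl (u k) : TrivSqZeroExt L L) • tv f Q j k
      + (TrivSqZeroExt.inl (u l) : TrivSqZeroExt L L) • tv f Q j l)
      ((TrivSqZeroExt.inl (u k) : TrivSqZeroExt L L) • tv f Q j k
      + (TrivSqZeroExt.inl (u l) : TrivSqZeroExt L L) • tv f Q j l)
      ((TrivSqZeroExt.inl (u k) : TrivSqZeroExt L L) • tv f Q j k
      + (TrivSqZeroExt.inl (u l) : TrivSqZeroExt L L) • tv f Q j l)) = 0 := fun u hu h => by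
    rw [map_D3, hφQ, hφ, ← hu, D3_smul_left, D3_smul_mid, D3_smul_right, h]; ring
  have hflec : flec f Q (tv f Q j k) (tv f Q j l) = 0 := by
    have := flec_comb f Q (tv f Q j k) (tv f Q j l) (TrivSqZeroExt.inl (b' k))
      (TrivSqZeroExt.inl (b' l)) (TrivSqZeroExt.inl (v' k)) (TrivSqZeroExt.inl (v' l))
    rw [flec, res23_eq_zero_of_fst (c2 b' hb e2) (c2 v' hv e2') (c3 b' hb e3)
      (c3 v' hv e3')] at this
    refine (IsUnit.mul_right_eq_zero (IsUnit.pow 6 (unit _ ?_))).1 this.symm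
    simpa using hdet
  rw [flec_eq_aeval hF hQf hn] at hflec
  have h0 := (IsUnit.mul_right_eq_zero (IsUnit.pow 6 (unit _ ?_))).1 hflec
  · rw [hQ, aeval_dual] at h0
    simpa using congrArg TrivSqZeroExt.snd h0
  · have : φ (Q i * aeval Q (pderiv j f)) ≠ 0 := by
      rw [map_mul, ← aeval_comp, hφQ, show φ (Q i) = P i from congrFun hφQ i]
      exact mul_ne_zero hi hj
    exact this

end Asymptotic

/-! ### Points on lines -/

section Lines

variable {K : Type*} [Field K] [IsAlgClosed K] {d : ℕ} {f F : MvPolynomial (Fin 4) K}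
  {W : Submodule K (Fin 4 → K)} {a b c P : Fin 4 → K}

theorem exists_residual (hf : f.IsHomogeneous d) (hd : 0 < d)
    (h : ∀ x y : K, eval (x • a + y • b) f = 0) (c : Fin 4 → K) :
    ∃ g : MvPolynomial (Fin 3) K, g.IsHomogeneous (d - 1) ∧
      ∀ x y z : K, eval (x • a + y • b + z • c) f = z * eval ![x, y, z] g := by
  classical
  set h₀ : MvPolynomial (Fin 3) K :=
    aeval (fun m => X 0 * C (a m) + X 1 * C (b m) + X 2 * C (c m)) f with hh₀
  have ev : ∀ p : Fin 3 → K, eval p h₀ = eval (p 0 • a + p 1 • b + p 2 • c) f := fun p => by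
    have h1 := MvPolynomial.comp_aeval_apply
      (fun m => (X 0 * C (a m) + X 1 * C (b m) + X 2 * C (c m) : MvPolynomial (Fin 3) K))
      (aeval p : MvPolynomial (Fin 3) K →ₐ[K] K) f
    have h2 : (fun m => aeval p (X 0 * C (a m) + X 1 * C (b m) + X 2 * C (c m) :
        MvPolynomial (Fin 3) K)) = p 0 • a + p 1 • b + p 2 • c := by
      ext m; simp
    rw [h2] at h1
    simpa only [aeval_eq_eval] using h1
  have hom : h₀.IsHomogeneous d := by
    have h1 : ∀ m : Fin 4, (X 0 * C (a m) + X 1 * C (b m) + X 2 * C (c m) :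
        MvPolynomial (Fin 3) K).IsHomogeneous 1 := fun m =>
      (((isHomogeneous_X K (0 : Fin 3)).mul (isHomogeneous_C _ (a m))).add
        ((isHomogeneous_X K (1 : Fin 3)).mul (isHomogeneous_C _ (b m)))).add
        ((isHomogeneous_X K (2 : Fin 3)).mul (isHomogeneous_C _ (c m)))
    have := hf.aeval _ h1
    rwa [one_mul] at this
  have hz : aeval (fun m => if m = 2 then (0 : MvPolynomial (Fin 3) K) else X m) h₀ = 0 := by
    refine MvPolynomial.funext fun p => ?_
    have h1 := MvPolynomial.comp_aeval_apply
      (fun m => if m = 2 then (0 : MvPolynomial (Fin 3) K) else X m)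
      (aeval p : MvPolynomial (Fin 3) K →ₐ[K] K) h₀
    have h2 : (fun m => aeval p (if m = 2 then (0 : MvPolynomial (Fin 3) K) else X m)) =
        ![p 0, p 1, 0] := by
      ext m; fin_cases m <;> simp
    rw [h2] at h1
    simp only [aeval_eq_eval] at h1
    rw [map_zero, h1, ev]
    simpa using h _ _
  have hdvd := X_dvd_sub_aeval 2 h₀
  rw [hz, sub_zero] at hdvd
  obtain ⟨g, hg⟩ := hdvd
  refine ⟨homogeneousComponent (d - 1) g, homogeneousComponent_isHomogeneous _ _, fun x y z => ?_⟩
  have e : h₀ = X 2 * homogeneousComponent (d - 1) g := by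
    rw [← homogeneousComponent_mul_of_isHomogeneous (isHomogeneous_X K (2 : Fin 3)), ← hg,
      show 1 + (d - 1) = d by omega, homogeneousComponent_eq_self hom]
  have := ev ![x, y, z]
  rw [e, map_mul, eval_X] at this
  simpa using this.symm

theorem lineRes_eq_zero (h : ∀ x y : K, eval (x • a + y • b) f = 0) (x y z w : K) :
    lineRes f (x • a + y • b) (z • a + w • b) = 0 := by
  refine Polynomial.funext fun t => ?_
  rw [eval_lineRes, Polynomial.eval_zero, aeval_eq_eval, ← h (x + t * z) (y + t * w)]
  congr 2
  module

theorem line_asymptotic (h : ∀ x y : K, eval (x • a + y • b) f = 0) (τ : K) :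
    aeval (a + τ • b) f = 0 ∧ D1 f (a + τ • b) b = 0 ∧ D2 f (a + τ • b) b b = 0 ∧
      D3 f (a + τ • b) b b b = 0 := by
  have h1 := lineRes_eq_zero h 1 τ 0 1
  rw [one_smul, zero_smul, one_smul, zero_add] at h1
  refine ⟨?_, ?_, ?_, ?_⟩
  · rw [← coeff_zero_lineRes f _ b, h1, Polynomial.coeff_zero]
  · rw [← coeff_one_lineRes f _ b, h1, Polynomial.coeff_zero]
  · rw [← coeff_two_lineRes f _ b, h1, Polynomial.coeff_zero, zero_mul]
  · rw [← coeff_three_lineRes f _ b, h1, Polynomial.coeff_zero, zero_mul]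

theorem exists_asymptotic_of_inflection (hf : f.IsHomogeneous d) (hd : 0 < d)
    (hW : ∀ v ∈ W, eval v f = 0) (hsk : SecondKindCond f d W) (hP : P ∈ W) (hb : b ∈ W)
    (hind : LinearIndependent K ![P, b, c]) (hc : D1 f P c = 0) (hcb : D2 f P c b ≠ 0) :
    ∃ v : Fin 4 → K, (∀ x y z : K, x • P + y • b + z • v = 0 → x = 0 ∧ y = 0 ∧ z = 0) ∧
      D1 f P v = 0 ∧ D2 f P v v = 0 ∧ D3 f P v v v = 0 := by
  have hPb : ∀ x y : K, eval (x • P + y • b) f = 0 := fun x y =>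
    hW _ (W.add_mem (W.smul_mem _ hP) (W.smul_mem _ hb))
  obtain ⟨g, hg, hfg⟩ := exists_residual hf hd hPb c
  have hgz : ∀ x y : K, aeval ![x, y, 0] g = D1 f (x • P + y • b) c := fun x y => by
    have : lineRes f (x • P + y • b) c = Polynomial.X * lineRes g ![x, y, 0] ![0, 0, 1] := by
      refine Polynomial.funext fun t => ?_
      rw [Polynomial.eval_mul, Polynomial.eval_X, eval_lineRes, eval_lineRes, aeval_eq_eval,
        aeval_eq_eval, hfg]
      congr 3
      ext m; fin_cases m <;> simp
    rw [← coeff_one_lineRes, this, Polynomial.coeff_X_mul, coeff_zero_lineRes]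
  have hq : eval ![1, 0, 0] g = 0 := by
    have := hgz 1 0
    rw [one_smul, zero_smul, add_zero, hc] at this
    rwa [aeval_eq_eval] at this
  obtain ⟨w, hw, hord⟩ := hsk P b c hP hb hind g hg hfg 1 0 (Or.inl one_ne_zero) hq
  have hord : ∀ j < 3, (lineRes g ![1, 0, 0] w).coeff j = 0 := by
    rcases hord with h | h
    · exact h
    · have : lineRes g ![1, 0, 0] w = 0 := Polynomial.funext fun t => by
        have := h 1 t
        rw [one_smul] at this
        rw [eval_lineRes, aeval_eq_eval, this, Polynomial.eval_zero]
      intro j _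
      rw [this, Polynomial.coeff_zero]
  have e1 : D1 f P P = 0 := by
    have := hPb 1 0
    rw [aeval_mul_euler P hf, aeval_eq_eval]
    rw [one_smul, zero_smul, add_zero] at this
    rw [this, mul_zero]
  have hw2 : w 2 ≠ 0 := fun hw2 => by
    have h1 : lineRes g ![1, 0, 0] w =
        ∑ m, Polynomial.C (c m) * lineRes (pderiv m f) P (w 0 • P + w 1 • b) := by
      refine Polynomial.funext fun t => ?_
      have h2 : ![1, 0, 0] + t • w = ![1 + t * w 0, t * w 1, 0] := by
        ext m; fin_cases m <;> simp [hw2]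
      rw [eval_lineRes, h2, hgz, D1, Polynomial.eval_finsetSum]
      refine Finset.sum_congr rfl fun m _ => ?_
      rw [Polynomial.eval_mul, Polynomial.eval_C, eval_lineRes, mul_comm]
      congr 3
      module
    have h2 := hord 1 (by norm_num)
    rw [h1, Polynomial.finsetSum_coeff] at h2
    simp only [Polynomial.coeff_C_mul, coeff_one_lineRes] at h2
    have h3 : D2 f P c (w 0 • P + w 1 • b) = 0 := by
      rw [← h2, D2]
      exact Finset.sum_congr rfl fun m _ => mul_comm _ _
    rw [D2_add_right, D2_smul_right, D2_smul_right, D2_symm f P c P, D2_self_left P _ hf, hc,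
      mul_zero, mul_zero, zero_add] at h3
    have hw1 := (mul_eq_zero.1 h3).resolve_right hcb
    have := LinearIndependent.pair_iff.1 hw (w 0) (-1) (by
      ext m; fin_cases m <;> simp [hw1, hw2])
    simpa using this.2
  have h1 : lineRes f P (w 0 • P + w 1 • b + w 2 • c) =
      Polynomial.X * (Polynomial.C (w 2) * lineRes g ![1, 0, 0] w) := by
    refine Polynomial.funext fun t => ?_
    rw [Polynomial.eval_mul, Polynomial.eval_X, Polynomial.eval_mul, Polynomial.eval_C,
      eval_lineRes, eval_lineRes, aeval_eq_eval,
      aeval_eq_eval, ← mul_assoc]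
    have h2 : ![1, 0, 0] + t • w = ![1 + t * w 0, t * w 1, t * w 2] := by
      ext m; fin_cases m <;> simp
    rw [h2, ← hfg]
    congr 2
    module
  have h2 : ∀ j < 3, (lineRes f P (w 0 • P + w 1 • b + w 2 • c)).coeff (j + 1) = 0 := fun j hj => by
    rw [h1, Polynomial.coeff_X_mul, Polynomial.coeff_C_mul, hord j hj, mul_zero]
  refine ⟨w 0 • P + w 1 • b + w 2 • c, fun x y z h => ?_, ?_, ?_, ?_⟩
  · have h3 := Fintype.linearIndependent_iff.1 hind ![x + z * w 0, y + z * w 1, z * w 2] (by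
      rw [← h, Fin.sum_univ_three]; simp; module)
    have hz := h3 2
    have hy := h3 1
    have hx := h3 0
    simp [hw2] at hx hy hz
    subst hz
    simpa using And.intro hx hy
  · rw [← coeff_one_lineRes]; exact h2 0 (by norm_num)
  · rw [← coeff_two_lineRes, h2 1 (by norm_num), zero_mul]
  · rw [← coeff_three_lineRes, h2 2 (by norm_num), zero_mul]

end Lines

section Lines

variable {K : Type*} [Field K] [IsAlgClosed K] {d : ℕ} {f F : MvPolynomial (Fin 4) K}
  {W : Submodule K (Fin 4 → K)} {a b : Fin 4 → K}

omit [IsAlgClosed K] in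
theorem pair_shift (hab : LinearIndependent K ![a, b]) (τ : K) (x y : K)
    (h : x • (a + τ • b) + y • b = 0) : x = 0 ∧ y = 0 := by
  have := LinearIndependent.pair_iff.1 hab x (x * τ + y) (by rw [← h]; module)
  refine ⟨this.1, ?_⟩
  simpa [this.1] using this.2

omit [IsAlgClosed K] in
theorem exists_mul_sub_ne_zero (hab : LinearIndependent K ![a, b]) :
    ∃ i j, a i * b j - a j * b i ≠ 0 := by
  by_contra! h
  have h1 : ∀ i, b i = 0 ∧ a i = 0 := fun i => by
    have := LinearIndependent.pair_iff.1 hab (b i) (-(a i)) (by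
      ext j
      simp only [Pi.add_apply, Pi.smul_apply, smul_eq_mul, Pi.zero_apply]
      linear_combination -h i j)
    simpa using this
  exact one_ne_zero (LinearIndependent.pair_iff.1 hab 1 0 (by ext i; simp [(h1 i).2])).1

theorem exists_wronskian_ne_zero (hf : IsSmoothSurfaceOfDegree f d) (hd : 2 ≤ d)
    (hchar : ringChar K = 0 ∨ d < ringChar K) (hab : LinearIndependent K ![a, b])
    (h0 : ∀ x y : K, eval (x • a + y • b) f = 0) :
    ∃ m l, lineRes (pderiv m f) a b * Polynomial.derivative (lineRes (pderiv l f) a b) -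
      lineRes (pderiv l f) a b * Polynomial.derivative (lineRes (pderiv m f) a b) ≠ 0 := by
  by_contra! h
  obtain ⟨i, j, hij⟩ := exists_mul_sub_ne_zero hab
  have htop := span_lineRes_eq_top hf hij
  have hdvd : ∀ m, lineRes (pderiv m f) a b ∣ Polynomial.derivative (lineRes (pderiv m f) a b) := by
    intro m
    have h1 : (1 : Polynomial K) ∈ Ideal.span (Set.range fun m => lineRes (pderiv m f) a b) := by
      rw [htop]; trivial
    obtain ⟨c, hc⟩ := (Ideal.mem_span_range_iff_exists_fun).1 h1
    refine ⟨∑ l, c l * Polynomial.derivative (lineRes (pderiv l f) a b), ?_⟩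
    rw [Finset.mul_sum, ← one_mul (Polynomial.derivative _), ← hc, Finset.sum_mul]
    refine Finset.sum_congr rfl fun l _ => ?_
    linear_combination -c l * h m l
  have hbb : ∀ m, aeval b (pderiv m f) = 0 := fun m => by
    obtain ⟨hdeg, hcoeff⟩ := natDegree_coeff_lineRes (hf.1.pderiv (i := m)) a b
    have hder : Polynomial.derivative (lineRes (pderiv m f) a b) = 0 := by
      by_cases hn : (lineRes (pderiv m f) a b).natDegree = 0
      · exact Polynomial.derivative_of_natDegree_zero hn
      · exact Polynomial.eq_zero_of_dvd_of_natDegree_lt (hdvd m)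
          (Polynomial.natDegree_derivative_lt hn)
    have := Polynomial.coeff_derivative (lineRes (pderiv m f) a b) (d - 1 - 1)
    rw [hder, Polynomial.coeff_zero, show d - 1 - 1 + 1 = d - 1 by omega, hcoeff] at this
    refine (mul_eq_zero.1 this.symm).resolve_right ?_
    have := natCast_ne_zero_of_char hchar (n := d - 1) (by omega) (by omega)
    rwa [← Nat.cast_add_one, show d - 1 - 1 + 1 = d - 1 by omega]
  obtain ⟨m, hm⟩ := exists_aeval_pderiv_ne_zero hf (P := b) (by
    rintro rfl
    exact one_ne_zero (LinearIndependent.pair_iff.1 hab 0 1 (by simp)).2)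
  exact hm (hbb m)

variable (hf : IsSmoothSurfaceOfDegree f d)
  (hF : ∀ i j k l : Fin 4, [i, j, k, l].Nodup →
        f ∣ flec f X (tv f X j k) (tv f X j l) - (X i * pderiv j f) ^ 6 * F)
include hf hF

theorem flecnodal_eq_zero_of_line (hab : LinearIndependent K ![a, b])
    (h0 : ∀ x y : K, eval (x • a + y • b) f = 0) (τ : K) : aeval (a + τ • b) F = 0 := by
  obtain ⟨h1, h2, h3, h4⟩ := line_asymptotic h0 τ
  exact flecnodal_eq_zero_of_asymptotic hf hF h1 (pair_shift hab τ) h2 h3 h4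

/-- Along a line of the second kind, the flecnodal form vanishes to second order at a general
point, in the tangent plane. -/
theorem eventually_exists_transverse (hd : 3 ≤ d) (hchar : ringChar K = 0 ∨ d < ringChar K)
    (hab : LinearIndependent K ![a, b]) (haW : a ∈ W) (hbW : b ∈ W)
    (hW : ∀ v ∈ W, eval v f = 0) (hspan : ∀ v ∈ W, ∃ x y : K, v = x • a + y • b)
    (hsk : SecondKindCond f d W) :
    ∀ᶠ τ : K in Filter.cofinite, ∃ w ∉ W, D1 f (a + τ • b) w = 0 ∧ D1 F (a + τ • b) w = 0 := by
  have h0 : ∀ x y : K, eval (x • a + y • b) f = 0 := fun x y =>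
    hW _ (W.add_mem (W.smul_mem _ haW) (W.smul_mem _ hbW))
  obtain ⟨m, l, hml⟩ := exists_wronskian_ne_zero hf (by omega) hchar hab h0
  refine (Polynomial.finite_setOfPred_isRoot hml).subset fun τ hτ => ?_
  by_contra hroot
  refine hτ ?_
  obtain ⟨h1, h2, h3, h4⟩ := line_asymptotic h0 τ
  set P := a + τ • b with hP
  have hder : ∀ m, (Polynomial.derivative (lineRes (pderiv m f) a b)).eval τ =
      D1 (pderiv m f) P b := fun m => by
    rw [derivative_lineRes, Polynomial.eval_finsetSum, D1]
    refine Finset.sum_congr rfl fun i _ => ?_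
    rw [Polynomial.eval_mul, Polynomial.eval_C, eval_lineRes, mul_comm]
  have hcb : D2 f P (tv f P m l) b ≠ 0 := fun h => hroot (by
    change Polynomial.eval τ _ = 0
    simp only [Polynomial.eval_sub, Polynomial.eval_mul, hder, eval_lineRes, ← hP]
    rw [tv, sub_eq_add_neg, ← neg_smul, D2_add_left, D2_smul_left, D2_smul_left,
      D2_single_left, D2_single_left] at h
    linear_combination h)
  have hPW : P ∈ W := W.add_mem haW (W.smul_mem _ hbW)
  have hind : LinearIndependent K ![P, b, tv f P m l] := by
    rw [Fintype.linearIndependent_iff]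
    intro g hg
    rw [Fin.sum_univ_three] at hg
    simp only [Matrix.cons_val_zero, Matrix.cons_val_one, Matrix.cons_val] at hg
    have h5 := congrArg (fun v => D2 f P v b) hg
    have hz : D2 f P 0 b = 0 := by simpa using D2_smul_left f P 0 b 0
    simp only [D2_add_left, D2_smul_left, h3, D2_self_left P _ hf.1, h2, mul_zero, zero_add,
      hz] at h5
    have h6 := (mul_eq_zero.1 h5).resolve_right hcb
    rw [h6, zero_smul, add_zero] at hg
    have h7 := pair_shift hab τ _ _ hg
    intro i; fin_cases i
    exacts [h7.1, h7.2, h6]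
  obtain ⟨v, hv, e1, e2, e3⟩ := exists_asymptotic_of_inflection hf.1 (by omega) hW hsk hPW hbW hind
    (D1_tv f P m l) hcb
  refine ⟨v, fun hvW => ?_, e1, D1_flecnodal_eq_zero hf hF h1 hv h2 h3 h4 e1 e2 e3 e1⟩
  obtain ⟨x, y, hxy⟩ := hspan v hvW
  have := hv (-x) (x * τ - y) 1 (by rw [hxy, hP]; module)
  exact one_ne_zero this.2.2

end Lines

/-! ### The generic point of the surface -/

section GenericPoint

universe u

variable {K : Type u} [Field K] {f : MvPolynomial (Fin 4) K}

/-- Over a separable closure of the function field of the cone `{f = 0}`, every tangent vector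
at the generic point is the value of a derivation. -/
theorem exists_generic_point (hf : Prime f) :
    ∃ (L : Type u) (_ : Field L) (_ : Algebra K L) (P : Fin 4 → L), IsSepClosed L ∧
      (∀ g, aeval P g = 0 ↔ f ∣ g) ∧
      ∀ v, D1 f P v = 0 → ∃ δ : Derivation K L L, ∀ m, δ (P m) = v m := by
  let B := MvPolynomial (Fin 4) K ⧸ Ideal.span {f}
  have : (Ideal.span {f}).IsPrime := (Ideal.span_singleton_prime hf.ne_zero).2 hf
  obtain ⟨Q, _, _, _⟩ : ∃ (Q : Type u) (_ : Field Q) (_ : Algebra B Q), IsFractionRing B Q :=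
    ⟨FractionRing B, inferInstance, inferInstance, inferInstance⟩
  obtain ⟨L, _, _, _, _⟩ : ∃ (L : Type u) (_ : Field L) (_ : Algebra (Q) L),
      IsSepClosed L ∧ Algebra.IsSeparable (Q) L :=
    ⟨SeparableClosure (Q), inferInstance, inferInstance, inferInstance, inferInstance⟩
  let _ : Algebra B L := ((algebraMap (Q) L).comp (algebraMap B _)).toAlgebra
  let _ : Algebra K L := ((algebraMap B L).comp (algebraMap K B)).toAlgebra
  have : IsScalarTower B (Q) L := IsScalarTower.of_algebraMap_eq fun _ => rfl
  have : @IsScalarTower K B L Algebra.toSMul Algebra.toSMul Algebra.toSMul :=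
    IsScalarTower.of_algebraMap_eq fun _ => rfl
  have : Algebra.FormallyEtale B (Q) :=
    Algebra.FormallyEtale.of_isLocalization (nonZeroDivisors B)
  have : Algebra.FormallyEtale (Q) L := Algebra.FormallyEtale.of_isSeparable _ _
  have : Algebra.FormallyEtale B L := Algebra.FormallyEtale.comp B (Q) L
  have hinj : Function.Injective (algebraMap B L) := by
    rw [IsScalarTower.algebraMap_eq B (Q) L]
    exact (algebraMap (Q) L).injective.comp (IsFractionRing.injective B (Q))
  let P : Fin 4 → L := fun m => algebraMap B L (Ideal.Quotient.mk _ (X m))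
  have hP : ∀ g, aeval P g = algebraMap B L (Ideal.Quotient.mk _ g) := fun g => by
    have : (aeval P : MvPolynomial (Fin 4) K →ₐ[K] L) = (IsScalarTower.toAlgHom K B L).comp
        (Ideal.Quotient.mkₐ K (Ideal.span {f})) := by
      ext m
      simp [P]
      rfl
    rw [this]
    rfl
  have hP0 : ∀ g, aeval P g = 0 ↔ f ∣ g := fun g => by
    rw [hP, map_eq_zero_iff _ hinj, Ideal.Quotient.eq_zero_iff_mem, Ideal.mem_span_singleton]
  refine ⟨L, inferInstance, inferInstance, P, inferInstance, hP0, fun v hv => ?_⟩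
  let φ : B →ₐ[K] TrivSqZeroExt L L := Ideal.Quotient.liftₐ (Ideal.span {f})
    (aeval fun i => TrivSqZeroExt.inl (P i) + TrivSqZeroExt.inr (v i)) (fun g hg => by
      obtain ⟨c, rfl⟩ := Ideal.mem_span_singleton.1 hg
      rw [map_mul, aeval_dual, (hP0 f).2 dvd_rfl, hv]
      simp)
  have hφ : ∀ g, φ (Ideal.Quotient.mk _ g) =
      TrivSqZeroExt.inl (aeval P g) + TrivSqZeroExt.inr (D1 g P v) := fun g => by
    rw [← aeval_dual]; rfl
  have hfst : ∀ x, (φ x).fst = algebraMap B L x := fun x => by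
    obtain ⟨g, rfl⟩ := Ideal.Quotient.mk_surjective x
    rw [hφ, ← hP]
    simp
  let D : Derivation K B L := Derivation.mk'
    (((TrivSqZeroExt.sndHom L L).restrictScalars K).comp φ.toLinearMap) (fun x y => by
      change (φ (x * y)).snd = x • (φ y).snd + y • (φ x).snd
      rw [map_mul, TrivSqZeroExt.snd_mul, hfst, hfst]
      simp [Algebra.smul_def, mul_comm])
  let e := KaehlerDifferential.tensorKaehlerEquivOfFormallyEtale K B L
  let ψ : Ω[L⁄K] →ₗ[L] L := (LinearMap.liftBaseChange L D.liftKaehlerDifferential).comp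
    e.symm.toLinearMap
  refine ⟨ψ.compDer (KaehlerDifferential.D K L), fun m => ?_⟩
  change LinearMap.liftBaseChange L D.liftKaehlerDifferential
    (e.symm (KaehlerDifferential.D K L (algebraMap B L _))) = _
  rw [KaehlerDifferential.tensorKaehlerEquivOfFormallyEtale_symm_D_algebraMap,
    LinearMap.liftBaseChange_tmul, one_smul, Derivation.liftKaehlerDifferential_comp_D]
  change (φ _).snd = v m
  rw [hφ]
  simp [D1, pderiv_X, Pi.single_apply, apply_ite]

end GenericPoint

/-! ### Derivations of polarized derivatives -/

section Derive

variable {K A : Type*} [CommRing K] [CommRing A] [Algebra K A]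

theorem derivation_aeval (δ : Derivation K A A) (g : MvPolynomial (Fin 4) K) (P : Fin 4 → A) :
    δ (aeval P g) = D1 g P (δ ∘ P) := by
  induction g using MvPolynomial.induction_on with
  | C a => simp [D1]
  | add p q hp hq => simp [D1, hp, hq, add_mul, Finset.sum_add_distrib]
  | mul_X p n hp =>
    simp only [D1, Derivation.leibniz, smul_eq_mul, map_add, map_mul, aeval_X, pderiv_X,
      Pi.single_apply, apply_ite, map_zero, add_mul, Finset.sum_add_distrib, hp,
      ite_mul, mul_one, mul_zero, zero_mul, Finset.mul_sum]
    simp [mul_assoc]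

theorem derivation_D1 (δ : Derivation K A A) (g : MvPolynomial (Fin 4) K) (P u : Fin 4 → A) :
    δ (D1 g P u) = D2 g P u (δ ∘ P) + D1 g P (δ ∘ u) := by
  simp only [D1, map_sum, Derivation.leibniz, smul_eq_mul, derivation_aeval, D2,
    Finset.sum_add_distrib, Function.comp_apply]
  rw [add_comm]
  congr 1
  exact Finset.sum_congr rfl fun i _ => mul_comm _ _

theorem derivation_D2 (δ : Derivation K A A) (g : MvPolynomial (Fin 4) K) (P u v : Fin 4 → A) :
    δ (D2 g P u v) = D3 g P u v (δ ∘ P) + D2 g P (δ ∘ u) v + D2 g P u (δ ∘ v) := by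
  simp only [D2, map_sum, Derivation.leibniz, smul_eq_mul, derivation_D1, D3,
    Finset.sum_add_distrib, Function.comp_apply]
  simp only [← Finset.sum_add_distrib]
  exact Finset.sum_congr rfl fun i _ => by ring

/-- A derivation of `A` extended to polynomials coefficientwise. -/
noncomputable def polyDerivation (δ : Derivation K A A) :
    Derivation K (Polynomial A) (Polynomial A) :=
  PolynomialModule.equivPolynomialSelf.compDer δ.mapCoeffs

theorem coeff_polyDerivation (δ : Derivation K A A) (p : Polynomial A) (n : ℕ) :
    (polyDerivation δ p).coeff n = δ (p.coeff n) := rfl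

theorem polyDerivation_C (δ : Derivation K A A) (a : A) :
    polyDerivation δ (Polynomial.C a) = Polynomial.C (δ a) := by
  ext n
  rw [coeff_polyDerivation, Polynomial.coeff_C, Polynomial.coeff_C, apply_ite δ, map_zero]

theorem polyDerivation_X (δ : Derivation K A A) : polyDerivation δ Polynomial.X = 0 := by
  ext n
  rw [coeff_polyDerivation, Polynomial.coeff_X, apply_ite δ]
  simp

end Derive

section Ruled

variable {K L : Type*} [Field K] [IsAlgClosed K] [Field L] [Algebra K L] {d : ℕ}
  {f : MvPolynomial (Fin 4) K} {P v : Fin 4 → L} {i j k l : Fin 4}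

omit [IsAlgClosed K] in
/-- The derivation of `f` along the line `P + t v`. -/
theorem polyDerivation_lineRes (δ : Derivation K L L) (hδ : ∀ m, δ (P m) = v m) {w : Fin 4 → L}
    (hw : ∀ m, δ (v m) = w m) : polyDerivation δ (lineRes f P v) =
      ∑ m, lineRes (pderiv m f) P v * (Polynomial.C (v m) + Polynomial.X * Polynomial.C (w m)) := by
  rw [lineRes, derivation_aeval, D1]
  refine Finset.sum_congr rfl fun m _ => ?_
  rw [lineRes]
  congr 1
  rw [Function.comp_apply, map_add, Derivation.leibniz, polyDerivation_C, polyDerivation_C,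
    polyDerivation_X, hδ, hw]
  simp

omit [IsAlgClosed K] in
/-- If a direction field is parallel along itself, then the surface contains the
line through the generic point. -/
theorem lineRes_eq_zero_of_parallel (hf : f.IsHomogeneous d)
    (hchar : ringChar K = 0 ∨ d < ringChar K) (hP : aeval P f = 0)
    (δ : Derivation K L L) (hδ : ∀ m, δ (P m) = v m) {β : L} (hβ : ∀ m, δ (v m) = β * v m) :
    lineRes f P v = 0 := by
  have key : polyDerivation δ (lineRes f P v) =
      (1 + Polynomial.X * Polynomial.C β) * Polynomial.derivative (lineRes f P v) := by
    rw [polyDerivation_lineRes δ hδ hβ, derivative_lineRes, Finset.mul_sum]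
    refine Finset.sum_congr rfl fun m _ => ?_
    rw [Polynomial.C_mul]
    ring
  have hdvd : ∀ n ≤ d, (Polynomial.X : Polynomial L) ^ (n + 1) ∣ lineRes f P v := by
    intro n
    induction n with
    | zero =>
      intro _
      rw [zero_add, pow_one, Polynomial.X_dvd_iff, coeff_zero_lineRes, hP]
    | succ n ih =>
      intro hn
      have h1 := Polynomial.X_pow_dvd_iff.1 (ih (by omega))
      have h2 : (Polynomial.X : Polynomial L) ^ (n + 1) ∣ polyDerivation δ (lineRes f P v) :=
        Polynomial.X_pow_dvd_iff.2 fun m hm => by rw [coeff_polyDerivation, h1 m hm, map_zero]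
      have hco : IsCoprime ((Polynomial.X : Polynomial L) ^ (n + 1))
          (1 + Polynomial.X * Polynomial.C β) :=
        IsCoprime.pow_left ⟨-Polynomial.C β, 1, by ring⟩
      rw [key] at h2
      have h3 := Polynomial.X_pow_dvd_iff.1 (hco.dvd_of_dvd_mul_left h2) n (by omega)
      rw [Polynomial.coeff_derivative] at h3
      have h4 : ((n : L) + 1) ≠ 0 := by
        have := natCast_ne_zero_of_char hchar (n := n + 1) (by omega) hn
        have := (map_ne_zero (algebraMap K L)).2 this
        simpa using this
      have h5 := (mul_eq_zero.1 h3).resolve_right h4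
      refine Polynomial.X_pow_dvd_iff.2 fun m hm => ?_
      rcases Nat.lt_succ_iff_lt_or_eq.1 hm with h | rfl
      exacts [h1 m h, h5]
  ext m
  rw [Polynomial.coeff_zero]
  rcases le_or_gt m d with h | h
  · exact Polynomial.X_pow_dvd_iff.1 (hdvd d le_rfl) m (by omega)
  · exact Polynomial.coeff_eq_zero_of_natDegree_lt
      ((natDegree_coeff_lineRes hf P v).1.trans_lt h)

end Ruled

section Ruled

variable {K L : Type*} [Field K] [Field L] [Algebra K L] {d : ℕ}
  {f : MvPolynomial (Fin 4) K} {P v : Fin 4 → L} {i j k l : Fin 4}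

theorem exists_combination (h : [i, j, k, l].Nodup) (hPi : P i ≠ 0)
    (hj : aeval P (pderiv j f) ≠ 0) (hi : v i = 0) (hk : v k ≠ 0) (y : Fin 4 → L) :
    ∃ c₀ c₁ c₂ c₃ : L, y = c₀ • P + c₁ • v + c₂ • tv f P j l + c₃ • Pi.single j 1 := by
  simp only [List.nodup_cons, List.mem_cons, not_or, List.not_mem_nil, not_false_eq_true,
    List.nodup_nil, and_true] at h
  obtain ⟨⟨hij, hik, hil⟩, ⟨hjk, hjl⟩, hkl⟩ := h
  have hall : ∀ p : Fin 4 → Prop, p i → p j → p k → p l → ∀ m, p m := by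
    intro p h1 h2 h3 h4 m
    have : m = i ∨ m = j ∨ m = k ∨ m = l := by omega
    rcases this with rfl | rfl | rfl | rfl <;> assumption
  set n := aeval P (pderiv j f) with hn
  set e := aeval P (pderiv l f) with he
  set c₀ := y i / P i
  set c₁ := (y k - c₀ * P k) / v k
  set c₂ := (y l - c₀ * P l - c₁ * v l) / n
  refine ⟨c₀, c₁, c₂, y j - c₀ * P j - c₁ * v j + c₂ * e, ?_⟩
  have h0 : c₀ * P i = y i := div_mul_cancel₀ _ hPi
  have h1 : c₁ * v k = y k - c₀ * P k := div_mul_cancel₀ _ hk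
  have h2 : c₂ * n = y l - c₀ * P l - c₁ * v l := div_mul_cancel₀ _ hj
  funext m
  revert m
  refine hall _ ?_ ?_ ?_ ?_ <;>
    simp only [tv, ← hn, ← he, Pi.add_apply, Pi.smul_apply, Pi.sub_apply, smul_eq_mul,
      Pi.single_apply, hi, hij, hil, hjl, hkl, Ne.symm hjk, Ne.symm hjl, if_true, if_false]
  · linear_combination -h0
  · ring
  · linear_combination -h1
  · linear_combination -h2

variable [IsAlgClosed K]

/-- The generic point of a smooth surface has no asymptotic direction field that is
parallel along itself. -/
theorem false_of_parallel (hf : IsSmoothSurfaceOfDegree f d) (hd : 3 ≤ d)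
    (hchar : ringChar K = 0 ∨ d < ringChar K) (hP : aeval P f = 0)
    (hder : ∀ w, D1 f P w = 0 → ∃ δ : Derivation K L L, ∀ m, δ (P m) = w m)
    (h : [i, j, k, l].Nodup) (hPi : P i ≠ 0) (hj : aeval P (pderiv j f) ≠ 0) (hi : v i = 0)
    (hk : v k ≠ 0) (δ : Derivation K L L) (hδ : ∀ m, δ (P m) = v m) {β : L}
    (hβ : ∀ m, δ (v m) = β * v m) : False := by
  have hQ := lineRes_eq_zero_of_parallel hf.1 hchar hP δ hδ hβ
  let E : (Fin 4 → L) → Polynomial L := fun y => ∑ m, lineRes (pderiv m f) P v * Polynomial.C (y m)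
  have hEadd : ∀ y z, E (y + z) = E y + E z := fun y z => by
    simp only [E, Pi.add_apply, map_add, mul_add, Finset.sum_add_distrib]
  have hEsmul : ∀ (c : L) y, E (c • y) = Polynomial.C c * E y := fun c y => by
    simp only [E, Pi.smul_apply, smul_eq_mul, map_mul, Finset.mul_sum]
    exact Finset.sum_congr rfl fun m _ => by ring
  have hEv : E v = 0 := by
    have := derivative_lineRes f P v
    rw [hQ, Polynomial.derivative_zero] at this
    rw [this]
    exact Finset.sum_congr rfl fun m _ => mul_comm _ _
  have hEP : E P = 0 := by
    have h1 := aeval_mul_euler (fun m => Polynomial.C (P m) + Polynomial.X * Polynomial.C (v m))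
        hf.1
    rw [← lineRes, hQ, mul_zero] at h1
    have h2 : E P + Polynomial.X * E v = 0 := by
      rw [← h1]
      simp only [E, D1, Finset.mul_sum, ← Finset.sum_add_distrib]
      exact Finset.sum_congr rfl fun m _ => by rw [lineRes]; ring
    simpa [hEv] using h2
  set p := E (tv f P j l) with hp
  set q := E (Pi.single j 1) with hq
  have hE : ∀ y, ∃ a b : L, E y = Polynomial.C a * p + Polynomial.C b * q := fun y => by
    obtain ⟨c₀, c₁, c₂, c₃, hy⟩ := exists_combination h hPi hj hi hk y
    refine ⟨c₂, c₃, ?_⟩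
    rw [hy, hEadd, hEadd, hEadd, hEsmul, hEsmul, hEsmul, hEsmul, hEP, hEv]
    ring
  have hN : ∀ m, lineRes (pderiv m f) P v = E (Pi.single m 1) := fun m => by
    simp [E, Pi.single_apply, apply_ite]
  have hcop : IsCoprime p q := by
    have htop := span_lineRes_eq_top (L := L) hf (P := P) (v := v) (i := i) (j := k)
      (by rw [hi, mul_zero, sub_zero]; exact mul_ne_zero hPi hk)
    rw [IsCoprime, ← Ideal.mem_span_pair, ← Ideal.eq_top_iff_one, eq_top_iff, ← htop,
      Ideal.span_le]
    rintro _ ⟨m, rfl⟩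
    obtain ⟨a, b, hab⟩ := hE (Pi.single m 1)
    exact Ideal.mem_span_pair.2 ⟨Polynomial.C a, Polynomial.C b, by rw [← hab, ← hN]⟩
  have hdeg : d - 1 ≤ p.natDegree ∨ d - 1 ≤ q.natDegree := by
    by_contra! hlt
    obtain ⟨m, hm⟩ := exists_aeval_pderiv_ne_zero hf (P := v) (fun h0 => hk (by rw [h0]; rfl))
    refine hm ?_
    rw [← (natDegree_coeff_lineRes (hf.1.pderiv (i := m)) P v).2, hN]
    obtain ⟨a, b, hab⟩ := hE (Pi.single m 1)
    rw [hab, Polynomial.coeff_add, Polynomial.coeff_C_mul, Polynomial.coeff_C_mul,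
      Polynomial.coeff_eq_zero_of_natDegree_lt hlt.1,
      Polynomial.coeff_eq_zero_of_natDegree_lt hlt.2]
    ring
  obtain ⟨δ', hδ'⟩ := hder _ (D1_tv f P j l)
  obtain ⟨a, b, hab⟩ := hE fun m => δ' (v m)
  have hrel : (1 + Polynomial.C a * Polynomial.X) * p = -(Polynomial.C b * Polynomial.X) * q := by
    have : polyDerivation δ' (lineRes f P v) = p + Polynomial.X * E fun m => δ' (v m) := by
      rw [lineRes, derivation_aeval, D1, hp]
      simp only [E, Finset.mul_sum, ← Finset.sum_add_distrib]
      refine Finset.sum_congr rfl fun m _ => ?_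
      rw [Function.comp_apply, map_add, Derivation.leibniz, polyDerivation_C, polyDerivation_C,
        polyDerivation_X, hδ', smul_zero, add_zero, smul_eq_mul, lineRes]
      ring
    rw [hQ, map_zero, hab] at this
    linear_combination -this
  have hlin : (1 + Polynomial.C a * Polynomial.X) ≠ 0 := fun h0 => by
    have := congrArg (Polynomial.eval 0) h0
    simp at this
  have hq1 : q.natDegree ≤ 1 := by
    have : q ∣ 1 + Polynomial.C a * Polynomial.X :=
      hcop.symm.dvd_of_dvd_mul_right ⟨-(Polynomial.C b * Polynomial.X), by rw [hrel]; ring⟩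
    refine (Polynomial.natDegree_le_of_dvd this hlin).trans ?_
    compute_degree
  have hp2 : 2 ≤ p.natDegree := by omega
  have hp0 : p ≠ 0 := by rintro h0; rw [h0] at hp2; simp at hp2
  have hb : b ≠ 0 := by
    rintro rfl
    rw [map_zero, zero_mul, neg_zero, zero_mul] at hrel
    exact mul_ne_zero hlin hp0 hrel
  have : p ∣ Polynomial.C b * Polynomial.X := by
    refine hcop.dvd_of_dvd_mul_right ⟨-(1 + Polynomial.C a * Polynomial.X), ?_⟩
    linear_combination hrel
  have := Polynomial.natDegree_le_of_dvd this (mul_ne_zero (by simpa using hb) Polynomial.X_ne_zero)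
  have h3 : (Polynomial.C b * Polynomial.X).natDegree ≤ 1 := by compute_degree
  omega

end Ruled

section BinaryForms

variable {L : Type*} [Field L]

theorem exists_common_root (hsq : ∀ x : L, ∃ z, x = z * z) (h2 : (2 : L) ≠ 0)
    {A B C a b c d : L} (hres : res23 A B C a b c d = 0) (hdisc : B ^ 2 - 4 * A * C ≠ 0) :
    ∃ x y : L, (x ≠ 0 ∨ y ≠ 0) ∧ A * x ^ 2 + B * x * y + C * y ^ 2 = 0 ∧
      a * x ^ 3 + b * x ^ 2 * y + c * x * y ^ 2 + d * y ^ 3 = 0 := by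
  unfold res23 at hres
  by_cases hA : A = 0
  · subst hA
    have hB : B ≠ 0 := by rintro rfl; simp at hdisc
    have : a * (a * C ^ 3 + b * C ^ 2 * (-B) + c * C * (-B) ^ 2 + d * (-B) ^ 3) = 0 := by
      linear_combination hres
    rcases mul_eq_zero.1 this with h | h
    · exact ⟨1, 0, Or.inl one_ne_zero, by ring, by rw [h]; ring⟩
    · exact ⟨C, -B, Or.inr (neg_ne_zero.2 hB), by ring, h⟩
  · obtain ⟨e, he⟩ := hsq (B ^ 2 - 4 * A * C)
    have hA2 : 2 * A ≠ 0 := mul_ne_zero h2 hA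
    have : (a * (-B + e) ^ 3 + b * (-B + e) ^ 2 * (2 * A) + c * (-B + e) * (2 * A) ^ 2
        + d * (2 * A) ^ 3) * (a * (-B - e) ^ 3 + b * (-B - e) ^ 2 * (2 * A)
        + c * (-B - e) * (2 * A) ^ 2 + d * (2 * A) ^ 3) = 64 * A ^ 3 * (
          A ^ 3 * d ^ 2 - A ^ 2 * B * c * d - 2 * A ^ 2 * C * b * d + A ^ 2 * C * c ^ 2
          + A * B ^ 2 * b * d + 3 * A * B * C * a * d - A * B * C * b * c - 2 * A * C ^ 2 * a * c
          + A * C ^ 2 * b ^ 2 - B ^ 3 * a * d + B ^ 2 * C * a * c - B * C ^ 2 * a * b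
          + C ^ 3 * a ^ 2) := by
      have he2 : e ^ 2 = B ^ 2 - 4 * A * C := by rw [he]; ring
      have he4 : e ^ 4 = (B ^ 2 - 4 * A * C) ^ 2 := by rw [← he2]; ring
      have he6 : e ^ 6 = (B ^ 2 - 4 * A * C) ^ 3 := by rw [← he2]; ring
      ring_nf
      simp only [he2, he4, he6]
      ring
    rw [hres, mul_zero] at this
    rcases mul_eq_zero.1 this with h | h
    · exact ⟨-B + e, 2 * A, Or.inr hA2, by linear_combination -A * he, h⟩
    · exact ⟨-B - e, 2 * A, Or.inr hA2, by linear_combination -A * he, h⟩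

theorem exists_eq_mul_of_mul_add_mul_eq_zero {p q x y s t : L} (hpq : p ≠ 0 ∨ q ≠ 0)
    (hxy : x ≠ 0 ∨ y ≠ 0) (h1 : p * x + q * y = 0) (h2 : p * s + q * t = 0) :
    ∃ β, s = β * x ∧ t = β * y := by
  have h3 : s * y = t * x := by
    rcases hpq with hp | hq
    · exact mul_left_cancel₀ hp (by linear_combination y * h2 - t * h1)
    · exact mul_left_cancel₀ hq (by linear_combination s * h1 - x * h2)
  rcases hxy with hx | hy
  · exact ⟨s / x, (div_mul_cancel₀ _ hx).symm, by field_simp; linear_combination -h3⟩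
  · exact ⟨t / y, by field_simp; linear_combination h3, (div_mul_cancel₀ _ hy).symm⟩

end BinaryForms

section Tangent

variable {K L : Type*} [Field K] [Field L] [Algebra K L]
  {f : MvPolynomial (Fin 4) K} {P : Fin 4 → L} {i j k l : Fin 4}

/-- The tangent vectors of the cone `{f = 0}` at `P` with vanishing `i`-th coordinate. -/
def IsTangent (f : MvPolynomial (Fin 4) K) (P : Fin 4 → L) (i : Fin 4) (v : Fin 4 → L) : Prop :=
  v i = 0 ∧ D1 f P v = 0

theorem isTangent_tv_fst (h : [i, j, k, l].Nodup) : IsTangent f P i (tv f P j k) := by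
  refine ⟨?_, D1_tv f P j k⟩
  simp only [List.nodup_cons, List.mem_cons, not_or] at h
  simp [tv, h.1.1, h.1.2.1]

theorem isTangent_tv_snd (h : [i, j, k, l].Nodup) : IsTangent f P i (tv f P j l) := by
  refine ⟨?_, D1_tv f P j l⟩
  simp only [List.nodup_cons, List.mem_cons, not_or] at h
  simp [tv, h.1.1, h.1.2.2.1]

theorem IsTangent.combination {u v : Fin 4 → L} (hu : IsTangent f P i u) (hv : IsTangent f P i v)
    (x y : L) : IsTangent f P i (x • u + y • v) := by
  refine ⟨by simp [hu.1, hv.1], ?_⟩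
  rw [D1_add, D1_smul, D1_smul, hu.2, hv.2, mul_zero, mul_zero, add_zero]

theorem IsTangent.exists_eq {v : Fin 4 → L} (hv : IsTangent f P i v) (h : [i, j, k, l].Nodup)
    (hj : aeval P (pderiv j f) ≠ 0) : v = (v k / aeval P (pderiv j f)) • tv f P j k +
      (v l / aeval P (pderiv j f)) • tv f P j l := by
  have := smul_eq_tv f P v h hv.1 hv.2
  rw [div_eq_inv_mul, div_eq_inv_mul, mul_smul, mul_smul, ← smul_add, ← this, inv_smul_smul₀ hj]

/-- The derivative of a tangent field along a tangent field. -/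
theorem IsTangent.derivation {v : Fin 4 → L} (hv : IsTangent f P i v) (δ : Derivation K L L)
    {u : Fin 4 → L} (hδ : δ ∘ P = u) (h : D2 f P v u = 0) : IsTangent f P i (δ ∘ v) := by
  refine ⟨by rw [Function.comp_apply, hv.1, map_zero], ?_⟩
  have := derivation_D1 δ f P v
  rw [hv.2, map_zero, hδ, h, zero_add] at this
  exact this.symm

variable (h : [i, j, k, l].Nodup) (hj : aeval P (pderiv j f) ≠ 0)
  (hder : ∀ v, D1 f P v = 0 → ∃ δ : Derivation K L L, ∀ m, δ (P m) = v m)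
include h hj

theorem IsTangent.exists_mul {u v : Fin 4 → L} (hv : IsTangent f P i v) (hv0 : v ≠ 0)
    (hu : IsTangent f P i u) {φ : (Fin 4 → L) → L} (hadd : ∀ x y, φ (x + y) = φ x + φ y)
    (hsmul : ∀ (c : L) x, φ (c • x) = c * φ x) (hφ : ∃ w, IsTangent f P i w ∧ φ w ≠ 0)
    (h1 : φ v = 0) (h2 : φ u = 0) : ∃ β : L, u = β • v := by
  have hv' := hv.exists_eq h hj
  have hu' := hu.exists_eq h hj
  obtain ⟨w, hw, hw0⟩ := hφ
  have hpq : φ (tv f P j k) ≠ 0 ∨ φ (tv f P j l) ≠ 0 := by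
    by_contra! h0
    apply hw0
    rw [hw.exists_eq h hj, hadd, hsmul, hsmul, h0.1, h0.2]
    ring
  have hxy : v k / aeval P (pderiv j f) ≠ 0 ∨ v l / aeval P (pderiv j f) ≠ 0 := by
    by_contra! h0
    rw [h0.1, h0.2] at hv'
    exact hv0 (by rw [hv']; simp)
  rw [hv', hadd, hsmul, hsmul] at h1
  rw [hu', hadd, hsmul, hsmul] at h2
  obtain ⟨β, e1, e2⟩ := exists_eq_mul_of_mul_add_mul_eq_zero hpq hxy
    (s := u k / aeval P (pderiv j f)) (t := u l / aeval P (pderiv j f))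
    (by linear_combination h1) (by linear_combination h2)
  refine ⟨β, ?_⟩
  rw [hu', e1, e2, mul_smul, mul_smul, ← smul_add, ← hv']

include hder

theorem exists_parallel_of_simple (h2 : (2 : L) ≠ 0) {v : Fin 4 → L} (hv : IsTangent f P i v)
    (hv0 : v ≠ 0) (hvv : D2 f P v v = 0) (hvvv : D3 f P v v v = 0)
    (hw : ∃ w, IsTangent f P i w ∧ D2 f P v w ≠ 0) :
    ∃ (δ : Derivation K L L) (β : L), δ ∘ P = v ∧ δ ∘ v = β • v := by
  obtain ⟨δ, hδ⟩ := hder v hv.2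
  have hδ' : δ ∘ P = v := funext hδ
  refine ⟨δ, ?_⟩
  have h3 := derivation_D2 δ f P v v
  rw [hvv, map_zero, hδ', hvvv, D2_symm f P (δ ∘ v)] at h3
  have h4 : D2 f P v (δ ∘ v) = 0 :=
    (mul_eq_zero.1 (show 2 * D2 f P v (δ ∘ v) = 0 by linear_combination -h3)).resolve_left h2
  obtain ⟨β, hβ⟩ := IsTangent.exists_mul h hj hv hv0 (hv.derivation δ hδ' hvv)
    (φ := D2 f P v) (D2_add_right f P v) (fun c x => D2_smul_right f P v x c) hw hvv h4
  exact ⟨β, hδ', hβ⟩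

theorem exists_parallel_of_radical {v : Fin 4 → L} (hv : IsTangent f P i v)
    (hv0 : v ≠ 0) (hrad : ∀ w, IsTangent f P i w → D2 f P v w = 0)
    (hw : ∃ w u, IsTangent f P i w ∧ IsTangent f P i u ∧ D2 f P w u ≠ 0) :
    ∃ (δ : Derivation K L L) (β : L), δ ∘ P = v ∧ δ ∘ v = β • v := by
  have h3 : ∀ w, IsTangent f P i w → D3 f P v v w = 0 := fun w hw => by
    obtain ⟨δ, hδ⟩ := hder w hw.2
    have hδ' : δ ∘ P = w := funext hδ
    have h3 := derivation_D2 δ f P v v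
    have h4 := hrad _ (hv.derivation δ hδ' (hrad w hw))
    rw [hrad v hv, map_zero, hδ', D2_symm f P (δ ∘ v), h4] at h3
    linear_combination -h3
  obtain ⟨δ, hδ⟩ := hder v hv.2
  have hδ' : δ ∘ P = v := funext hδ
  have h4 : ∀ w, IsTangent f P i w → D2 f P w (δ ∘ v) = 0 := fun w hw => by
    have h5 := derivation_D2 δ f P v w
    have h6 := hrad _ (hw.derivation δ hδ' (by rw [D2_symm]; exact hrad w hw))
    rw [hrad w hw, map_zero, hδ', D3_swap_right, h3 w hw, h6, D2_symm f P (δ ∘ v)] at h5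
    linear_combination -h5
  obtain ⟨w, u, hw, hu, hwu⟩ := hw
  obtain ⟨β, hβ⟩ := IsTangent.exists_mul h hj hv hv0 (hv.derivation δ hδ' (hrad v hv))
    (φ := D2 f P w) (D2_add_right f P w) (fun c x => D2_smul_right f P w x c) ⟨u, hu, hwu⟩
    (by rw [D2_symm]; exact hrad w hw) (h4 w hw)
  exact ⟨δ, β, hδ', hβ⟩

theorem exists_parallel_of_zero
    (hzero : ∀ w u, IsTangent f P i w → IsTangent f P i u → D2 f P w u = 0) :
    ∃ (δ : Derivation K L L) (β : L), δ ∘ P = tv f P j k ∧ δ ∘ tv f P j k = β • tv f P j k := by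
  have hv := isTangent_tv_fst (f := f) (P := P) h
  obtain ⟨δ, hδ⟩ := hder _ hv.2
  have hδ' : δ ∘ P = tv f P j k := funext hδ
  refine ⟨δ, (δ ∘ tv f P j k) k / aeval P (pderiv j f), hδ',
    ((hv.derivation δ hδ' (hzero _ _ hv hv)).exists_eq h hj).trans ?_⟩
  have : tv f P j k l = 0 := by
    simp only [List.nodup_cons, List.mem_cons, not_or] at h
    simp [tv, Ne.symm h.2.2.1.1, Ne.symm h.2.1.2.1]
  rw [Function.comp_apply (x := l), this, map_zero, zero_div, zero_smul, add_zero]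

/-- Where the flecnodal form vanishes identically, there is an asymptotic direction field that is
parallel along itself. -/
theorem exists_parallel (hsq : ∀ x : L, ∃ z, x = z * z) (h2 : (2 : L) ≠ 0)
    (hflec : flec f P (tv f P j k) (tv f P j l) = 0) :
    ∃ v ≠ 0, IsTangent f P i v ∧
      ∃ (δ : Derivation K L L) (β : L), δ ∘ P = v ∧ δ ∘ v = β • v := by
  have t1 := isTangent_tv_fst (f := f) (P := P) h
  have t2 := isTangent_tv_snd (f := f) (P := P) h
  set v₁ := tv f P j k with hv₁
  set v₂ := tv f P j l with hv₂
  have hne : ∀ x y : L, x ≠ 0 ∨ y ≠ 0 → x • v₁ + y • v₂ ≠ 0 := by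
    intro x y hxy h0
    simp only [List.nodup_cons, List.mem_cons, not_or] at h
    have e1 := congrFun h0 k
    have e2 := congrFun h0 l
    simp [hv₁, hv₂, tv, Ne.symm h.2.1.1, Ne.symm h.2.1.2.1, h.2.2.1.1, Ne.symm h.2.2.1.1,
      hj] at e1 e2
    tauto
  by_cases hzero : ∀ w u, IsTangent f P i w → IsTangent f P i u → D2 f P w u = 0
  · exact ⟨v₁, by simpa using hne 1 0 (by simp), t1, exists_parallel_of_zero h hj hder hzero⟩
  push Not at hzero
  by_cases hrad : ∃ v ≠ 0, IsTangent f P i v ∧ ∀ w, IsTangent f P i w → D2 f P v w = 0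
  · obtain ⟨v, hv0, hv, hrad⟩ := hrad
    exact ⟨v, hv0, hv, exists_parallel_of_radical h hj hder hv hv0 hrad hzero⟩
  push Not at hrad
  have hdisc : (2 * D2 f P v₁ v₂) ^ 2 - 4 * D2 f P v₁ v₁ * D2 f P v₂ v₂ ≠ 0 := by
    intro h0
    have h0 : D2 f P v₁ v₂ ^ 2 - D2 f P v₁ v₁ * D2 f P v₂ v₂ = 0 :=
      (mul_eq_zero.1 (show (2 * 2) * (D2 f P v₁ v₂ ^ 2 - D2 f P v₁ v₁ * D2 f P v₂ v₂) = 0 by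
        linear_combination h0)).resolve_left (mul_ne_zero h2 h2)
    have key : ∀ x y : L, x ≠ 0 ∨ y ≠ 0 → x * D2 f P v₁ v₁ + y * D2 f P v₁ v₂ = 0 →
        x * D2 f P v₁ v₂ + y * D2 f P v₂ v₂ = 0 → False := by
      intro x y hxy e1 e2
      obtain ⟨w, hw, hw0⟩ := hrad _ (hne x y hxy) (t1.combination t2 x y)
      apply hw0
      rw [hw.exists_eq h hj, D2_comb]
      linear_combination (w k / aeval P (pderiv j f)) * e1 + (w l / aeval P (pderiv j f)) * e2
    by_cases hA : D2 f P v₁ v₁ = 0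
    · have hB : D2 f P v₁ v₂ = 0 := by
        rw [hA, zero_mul, sub_zero] at h0
        exact eq_zero_of_pow_eq_zero h0
      exact key 1 0 (by simp) (by rw [hA]; ring) (by rw [hB]; ring)
    · exact key (D2 f P v₁ v₂) (-D2 f P v₁ v₁) (Or.inr (neg_ne_zero.2 hA)) (by ring)
        (by linear_combination h0)
  obtain ⟨x, y, hxy, e1, e2⟩ := exists_common_root hsq h2 hflec hdisc
  have hv := t1.combination t2 x y
  obtain hw := hrad _ (hne x y hxy) hv
  refine ⟨_, hne x y hxy, hv, exists_parallel_of_simple h hj hder h2 hv (hne x y hxy) ?_ ?_ hw⟩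
  · rw [D2_comb]; linear_combination e1
  · rw [D3_comb]; linear_combination e2

end Tangent

section NotDvd

variable {K : Type*} [Field K] [IsAlgClosed K] {d n : ℕ} {f F : MvPolynomial (Fin 4) K}

/-- The flecnodal form does not vanish identically on a smooth surface. -/
theorem not_dvd_flecnodal (hf : IsSmoothSurfaceOfDegree f d) (hd : 3 ≤ d)
    (hchar : ringChar K = 0 ∨ d < ringChar K)
    (hF : ∀ i j k l : Fin 4, [i, j, k, l].Nodup →
        f ∣ flec f X (tv f X j k) (tv f X j l) - (X i * pderiv j f) ^ 6 * F) : ¬ f ∣ F := by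
  intro hfF
  have hprime := smooth_prime hf hd
  obtain ⟨L, _, _, P, _, hP, hder⟩ := exists_generic_point hprime
  have hfP : aeval P f = 0 := (hP f).2 dvd_rfl
  have hP0 : P ≠ 0 := by
    rintro rfl
    have h1 := (hP (X 0)).1 (by simp)
    exact not_dvd_of_lt hf.1 (isHomogeneous_X K 0) (X_ne_zero 0) (by omega) h1
  obtain ⟨i, j, k, l, h, hi, hj⟩ := exists_point_indices hf hfP hP0
  have h2 : (2 : L) ≠ 0 := by
    have := (map_ne_zero (algebraMap K L)).2
      (natCast_ne_zero_of_char hchar (n := 2) (by omega) (by omega))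
    rwa [map_natCast, Nat.cast_ofNat] at this
  have : NeZero (2 : L) := ⟨h2⟩
  have hflec : flec f P (tv f P j k) (tv f P j l) = 0 := by
    rw [flec_eq_aeval hF hfP h, (hP F).2 hfF, mul_zero]
  obtain ⟨v, hv0, hv, δ, β, h3, h4⟩ :=
    exists_parallel h hj hder (fun x => IsSepClosed.exists_eq_mul_self x) h2 hflec
  have h3 : ∀ m, δ (P m) = v m := congrFun h3
  have h4 : ∀ m, δ (v m) = β * v m := congrFun h4
  by_cases hk : v k = 0
  · have hl : v l ≠ 0 := fun hl => hv0 (by rw [hv.exists_eq h hj, hk, hl]; simp)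
    have h' : [i, j, l, k].Nodup := by
      revert h; clear * -; revert i j k l; decide
    exact false_of_parallel hf hd hchar hfP hder h' hi hj hv.1 hl δ h3 h4
  · exact false_of_parallel hf hd hchar hfP hder h hi hj hv.1 hk δ h3 h4

end NotDvd

/-! ### Dimension counts for spaces of forms -/

section Dimension

variable {K : Type*} [Field K]

instance {σ : Type*} [Finite σ] (n : ℕ) : FiniteDimensional K (homogeneousSubmodule σ K n) :=
  Module.Finite.iff_fg.mpr (homogeneousSubmodule_fg _ _ n)

theorem finrank_homogeneousSubmodule (n : ℕ) :
    Module.finrank K (homogeneousSubmodule (Fin 4) K n) = (n + 3).choose 3 := by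
  have h : {s : Fin 4 →₀ ℕ | s.degree = n} =
      ((Finset.univ : Finset (Fin 4)).finsuppAntidiag n : Finset (Fin 4 →₀ ℕ)) := by
    ext s
    simp [Finsupp.degree_eq_sum]
  have h' : homogeneousSubmodule (Fin 4) K n = restrictSupport K {s | s.degree = n} :=
    homogeneousSubmodule_eq_finsupp_supported _ _ _
  rw [h', Module.finrank_eq_nat_card_basis (basisRestrictSupport K _), h, Nat.card_coe_set_eq,
    Set.ncard_coe_finset, Finset.card_finsuppAntidiag_nat_eq_choose]
  simpa [add_comm 3 n] using Nat.choose_symm_add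

/-- The multiples `g * p` of `g`, with `p` a form of degree `n`. -/
noncomputable def multiples (g : MvPolynomial (Fin 4) K) (n : ℕ) :
    Submodule K (MvPolynomial (Fin 4) K) :=
  (homogeneousSubmodule (Fin 4) K n).map (LinearMap.mulLeft K g)

instance (g : MvPolynomial (Fin 4) K) (n : ℕ) : FiniteDimensional K (multiples g n) := by
  unfold multiples; infer_instance

theorem finrank_multiples {g : MvPolynomial (Fin 4) K} (hg : g ≠ 0) (n : ℕ) :
    Module.finrank K (multiples g n) = (n + 3).choose 3 := by
  rw [multiples, ← (Submodule.equivMapOfInjective _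
    (fun p q h => mul_left_cancel₀ hg h) _).finrank_eq, finrank_homogeneousSubmodule]

theorem multiples_inf_le {f F : MvPolynomial (Fin 4) K} {d e n : ℕ} (hf : Prime f)
    (hfh : f.IsHomogeneous d) (hF : ¬ f ∣ F) :
    multiples f (n + e) ⊓ multiples F (n + d) ≤ multiples (f * F) n := by
  rintro g ⟨⟨p, -, rfl⟩, ⟨q, hq, hpq⟩⟩
  simp only [LinearMap.mulLeft_apply] at hpq ⊢
  obtain ⟨r, rfl⟩ := (hf.dvd_or_dvd ⟨p, hpq⟩).resolve_left hF
  refine ⟨homogeneousComponent n r, homogeneousComponent_isHomogeneous n r, ?_⟩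
  rw [LinearMap.mulLeft_apply, ← hpq, mul_comm f F, mul_assoc,
    ← homogeneousComponent_mul_of_isHomogeneous hfh, homogeneousComponent_of_mem hq]
  simp [add_comm]

theorem le_finrank_sup {f F : MvPolynomial (Fin 4) K} {d e n : ℕ} (hf : Prime f)
    (hfh : f.IsHomogeneous d) (hF : ¬ f ∣ F) :
    (n + e + 3).choose 3 + (n + d + 3).choose 3 ≤
      Module.finrank K ↥(multiples f (n + e) ⊔ multiples F (n + d)) + (n + 3).choose 3 := by
  have hF0 : F ≠ 0 := fun h => hF (h ▸ dvd_zero f)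
  have h := Submodule.finrank_sup_add_finrank_inf_eq (multiples f (n + e)) (multiples F (n + d))
  rw [finrank_multiples hf.ne_zero, finrank_multiples hF0] at h
  have := Submodule.finrank_mono (multiples_inf_le (e := e) (n := n) hf hfh hF)
  rw [finrank_multiples (mul_ne_zero hf.ne_zero hF0)] at this
  omega

/-- Functionals vanishing on `U ≤ W` and linearly independent on `W` number at most
`dim W - dim U`. -/
theorem card_add_finrank_le {V ι : Type*} [AddCommGroup V] [Module K V] [Fintype ι]
    {U W : Submodule K V} [FiniteDimensional K W] (hUW : U ≤ W) (Λ : ι → Module.Dual K V)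
    (hU : ∀ i, ∀ g ∈ U, Λ i g = 0)
    (hΛ : ∀ c : ι → K, (∀ g ∈ W, ∑ i, c i * Λ i g = 0) → c = 0) :
    Fintype.card ι + Module.finrank K U ≤ Module.finrank K W := by
  let U' := U.comap W.subtype
  let φ : (ι → K) →ₗ[K] U'.dualAnnihilator :=
    LinearMap.codRestrict _ (Fintype.linearCombination K fun i => (Λ i).comp W.subtype) fun c => by
      rw [Submodule.mem_dualAnnihilator]
      intro w hw
      have hw' : ∀ i, Λ i w = 0 := fun i => hU i _ hw
      simp [Fintype.linearCombination_apply, hw']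
  have hφ : Function.Injective φ := by
    rw [injective_iff_map_eq_zero]
    intro c hc
    refine hΛ c fun g hg => ?_
    have := congrArg (fun x : U'.dualAnnihilator => x.1 ⟨g, hg⟩) hc
    simpa [φ, Fintype.linearCombination_apply] using this
  have h := LinearMap.finrank_le_finrank_of_injective hφ
  rw [Module.finrank_fintype_fun_eq_card] at h
  have h' := Subspace.finrank_add_finrank_dualAnnihilator_eq U'
  have : Module.finrank K U' = Module.finrank K U :=
    (Submodule.comapSubtypeEquivOfLe hUW).finrank_eq
  omega

end Dimension

/-! ### Independent conditions imposed by points on lines -/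

section Conditions

variable {K : Type*} [Field K]

/-- The linear form attached to a functional. -/
noncomputable def linearForm (φ : Module.Dual K (Fin 4 → K)) : MvPolynomial (Fin 4) K :=
  ∑ i, C (φ (Pi.single i 1)) * X i

theorem linearForm_isHomogeneous (φ : Module.Dual K (Fin 4 → K)) :
    (linearForm φ).IsHomogeneous 1 :=
  IsHomogeneous.sum _ _ _ fun i _ => by
    simpa using (isHomogeneous_C _ (φ (Pi.single i 1))).mul (isHomogeneous_X K i)

theorem dual_apply_eq_sum (φ : Module.Dual K (Fin 4 → K)) (v : Fin 4 → K) :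
    φ v = ∑ i, φ (Pi.single i 1) * v i := by
  conv_lhs => rw [pi_eq_sum_univ' v, map_sum]
  refine Finset.sum_congr rfl fun i _ => ?_
  rw [map_smul, smul_eq_mul, mul_comm]

theorem eval_linearForm (φ : Module.Dual K (Fin 4 → K)) (v : Fin 4 → K) :
    eval v (linearForm φ) = φ v := by
  rw [dual_apply_eq_sum]
  simp [linearForm]

theorem D1_linearForm (φ : Module.Dual K (Fin 4 → K)) (P v : Fin 4 → K) :
    D1 (linearForm φ) P v = φ v := by
  rw [dual_apply_eq_sum]
  simp [D1, linearForm, pderiv_X, Pi.single_apply]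

theorem D1_mul (g h : MvPolynomial (Fin 4) K) (P w : Fin 4 → K) :
    D1 (g * h) P w = eval P g * D1 h P w + eval P h * D1 g P w := by
  simp only [D1, Derivation.leibniz, smul_eq_mul, ← aeval_eq_eval, map_add, map_mul, Finset.mul_sum,
    ← Finset.sum_add_distrib]
  exact Finset.sum_congr rfl fun i _ => by ring

/-- Differentiation at `P` along `w`, as a functional. -/
noncomputable def derivativeFunctional (P w : Fin 4 → K) :
    Module.Dual K (MvPolynomial (Fin 4) K) where
  toFun g := D1 g P w
  map_add' g h := by simp [D1, add_mul, Finset.sum_add_distrib]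
  map_smul' c g := by simp [D1, Finset.mul_sum, mul_assoc]

theorem derivativeFunctional_apply (P w : Fin 4 → K) (g : MvPolynomial (Fin 4) K) :
    derivativeFunctional P w g = D1 g P w := rfl

theorem exists_dual_of_notMem {U : Submodule K (Fin 4 → K)} {v : Fin 4 → K} (hv : v ∉ U) :
    ∃ φ : Module.Dual K (Fin 4 → K), φ v ≠ 0 ∧ ∀ u ∈ U, φ u = 0 := by
  obtain ⟨φ, h, hU⟩ := Submodule.exists_le_ker_of_notMem hv
  exact ⟨φ, h, fun u hu => hU hu⟩

variable {ι : Type*} [Fintype ι] {n : ℕ} {W : ι → Submodule K (Fin 4 → K)}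
  {p : ι → Fin n → Fin 4 → K}

theorem exists_test_form (hp : ∀ i t, p i t ∈ W i) (hpW : ∀ i j t, i ≠ j → p i t ∉ W j)
    (hpp : ∀ i s t, s ≠ t → p i t ∉ Submodule.span K {p i s}) (hp0 : ∀ i t, p i t ≠ 0)
    (i : ι) (t : Fin n) :
    ∃ g : MvPolynomial (Fin 4) K, g.IsHomogeneous (2 * Fintype.card ι + n) ∧
      eval (p i t) g ≠ 0 ∧ (∀ s, s ≠ t → eval (p i s) g = 0) ∧
      ∀ j, j ≠ i → ∀ s, eval (p j s) g = 0 ∧ ∀ w, D1 g (p j s) w = 0 := by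
  have hu : ∀ j, ∃ φ : Module.Dual K (Fin 4 → K), φ (p i t) ≠ 0 ∧
      (j ≠ i → ∀ u ∈ W j, φ u = 0) := by
    intro j
    rcases eq_or_ne j i with rfl | hj
    · obtain ⟨φ, h, -⟩ := exists_dual_of_notMem (U := ⊥) (v := p j t) (by simpa using hp0 j t)
      exact ⟨φ, h, fun h => absurd rfl h⟩
    · obtain ⟨φ, h, h'⟩ := exists_dual_of_notMem (hpW i j t hj.symm)
      exact ⟨φ, h, fun _ => h'⟩
  have hv : ∀ s, ∃ φ : Module.Dual K (Fin 4 → K), φ (p i t) ≠ 0 ∧ (s ≠ t → φ (p i s) = 0) := by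
    intro s
    rcases eq_or_ne s t with rfl | hs
    · obtain ⟨φ, h, -⟩ := exists_dual_of_notMem (U := ⊥) (v := p i s) (by simpa using hp0 i s)
      exact ⟨φ, h, fun h => absurd rfl h⟩
    · obtain ⟨φ, h, h'⟩ := exists_dual_of_notMem (hpp i s t hs)
      exact ⟨φ, h, fun _ => h' _ (Submodule.mem_span_singleton_self _)⟩
  choose φ hφ hφ' using hu
  choose ψ hψ hψ' using hv
  set A := ∏ j, linearForm (φ j)
  set B := ∏ s, linearForm (ψ s)
  have hA : A.IsHomogeneous (Fintype.card ι) := by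
    simpa using IsHomogeneous.prod Finset.univ _ _ fun j _ => linearForm_isHomogeneous (φ j)
  have hB : B.IsHomogeneous n := by
    simpa using IsHomogeneous.prod Finset.univ _ _ fun s _ => linearForm_isHomogeneous (ψ s)
  refine ⟨A * (A * B), ?_, ?_, ?_, ?_⟩
  · convert hA.mul (hA.mul hB) using 1
    ring
  · simp [A, B, map_prod, eval_linearForm, Finset.prod_eq_zero_iff, hφ, hψ]
  · intro s hs
    have : eval (p i s) B = 0 := by
      rw [map_prod]
      exact Finset.prod_eq_zero (Finset.mem_univ s) (by rw [eval_linearForm, hψ' s hs])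
    simp [this]
  · intro j hj s
    have : eval (p j s) A = 0 := by
      rw [map_prod]
      exact Finset.prod_eq_zero (Finset.mem_univ j)
        (by rw [eval_linearForm, hφ' j hj _ (hp j s)])
    exact ⟨by simp [this], fun w => by rw [D1_mul, map_mul, this]; ring⟩

/-- The conditions imposed on forms of degree `x + d + e` by `n` points on each line, doubled on
the lines of `S`, are independent, and they are satisfied by the multiples of `f` and `F`. -/
theorem card_conditions_le {f F : MvPolynomial (Fin 4) K} {d e x : ℕ} (hf : Prime f)
    (hfh : f.IsHomogeneous d) (hFh : F.IsHomogeneous e) (hF : ¬ f ∣ F) (S : Finset ι)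
    {w : ι → Fin n → Fin 4 → K}
    (hp : ∀ i t, p i t ∈ W i) (hpW : ∀ i j t, i ≠ j → p i t ∉ W j)
    (hpp : ∀ i s t, s ≠ t → p i t ∉ Submodule.span K {p i s}) (hp0 : ∀ i t, p i t ≠ 0)
    (hw : ∀ i ∈ S, ∀ t, w i t ∉ W i)
    (hfp : ∀ i t, eval (p i t) f = 0) (hFp : ∀ i t, eval (p i t) F = 0)
    (hfw : ∀ i ∈ S, ∀ t, D1 f (p i t) (w i t) = 0)
    (hFw : ∀ i ∈ S, ∀ t, D1 F (p i t) (w i t) = 0)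
    (hx : x + d + e = 2 * Fintype.card ι + n + 1) :
    (Fintype.card ι + S.card) * n + (x + e + 3).choose 3 + (x + d + 3).choose 3 ≤
      (x + d + e + 3).choose 3 + (x + 3).choose 3 := by
  classical
  let Λ : (ι × Fin n) ⊕ (S × Fin n) → Module.Dual K (MvPolynomial (Fin 4) K) :=
    Sum.elim (fun a => (aeval (p a.1 a.2)).toLinearMap)
      fun a => derivativeFunctional (p a.1 a.2) (w a.1 a.2)
  have hUW : multiples f (x + e) ⊔ multiples F (x + d) ≤
      homogeneousSubmodule (Fin 4) K (x + d + e) := by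
    refine sup_le ?_ ?_
    · rintro _ ⟨q, hq, rfl⟩
      have := hfh.mul ((mem_homogeneousSubmodule _ _).mp hq)
      rwa [show d + (x + e) = x + d + e by ring] at this
    · rintro _ ⟨q, hq, rfl⟩
      have := hFh.mul ((mem_homogeneousSubmodule _ _).mp hq)
      rwa [show e + (x + d) = x + d + e by ring] at this
  have hU : ∀ a, ∀ g ∈ multiples f (x + e) ⊔ multiples F (x + d), Λ a g = 0 := by
    intro a
    suffices multiples f (x + e) ⊔ multiples F (x + d) ≤ LinearMap.ker (Λ a) from
      fun g hg => this hg
    refine sup_le ?_ ?_ <;> rintro _ ⟨q, -, rfl⟩ <;> rcases a with ⟨i, t⟩ | ⟨⟨i, hi⟩, t⟩ <;>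
      simp [Λ, derivativeFunctional_apply, D1_mul, hfw i, hFw i, *]
  have key := card_add_finrank_le hUW Λ hU ?_
  · rw [finrank_homogeneousSubmodule] at key
    have := le_finrank_sup (e := e) (n := x) hf hfh hF
    simp only [Fintype.card_sum, Fintype.card_prod, Fintype.card_fin, Fintype.card_coe] at key
    rw [add_mul]
    omega
  intro c hc
  simp only [Fintype.sum_sum_type] at hc
  have hr : ∀ a, c (Sum.inr a) = 0 := by
    rintro ⟨⟨i, hi⟩, t⟩
    obtain ⟨g, hg, hg0, hgs, hgj⟩ := exists_test_form hp hpW hpp hp0 i t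
    obtain ⟨z, hz, hzW⟩ := exists_dual_of_notMem (hw i hi t)
    have h1 : ∀ j s, eval (p j s) (g * linearForm z) = 0 := by
      intro j s
      rw [map_mul, eval_linearForm]
      rcases eq_or_ne j i with rfl | hj
      · rw [hzW _ (hp j s), mul_zero]
      · rw [(hgj j hj s).1, zero_mul]
    have h := hc (g * linearForm z) (by
      have := hg.mul (linearForm_isHomogeneous z)
      rwa [← hx] at this)
    rw [Finset.sum_eq_zero (fun a _ => by simp [Λ, -map_mul, h1]), zero_add,
      Finset.sum_eq_single (⟨⟨i, hi⟩, t⟩ : S × Fin n)] at h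
    · simpa [Λ, derivativeFunctional_apply, D1_mul, D1_linearForm, eval_linearForm, hzW _ (hp i t),
        hg0, hz] using h
    · rintro ⟨⟨j, hj⟩, s⟩ - hjs
      rcases eq_or_ne j i with rfl | hji
      · have hs : s ≠ t := by rintro rfl; exact hjs rfl
        simp [Λ, derivativeFunctional_apply, D1_mul, eval_linearForm, hzW _ (hp j s), hgs s hs]
      · simp [Λ, derivativeFunctional_apply, D1_mul, (hgj j hji s).1, (hgj j hji s).2]
    · simp
  ext a
  rcases a with ⟨i, t⟩ | a
  · obtain ⟨g, hg, hg0, hgs, hgj⟩ := exists_test_form hp hpW hpp hp0 i t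
    obtain ⟨z, hz, -⟩ := exists_dual_of_notMem (U := ⊥) (v := p i t) (by simpa using hp0 i t)
    have h := hc (g * linearForm z) (by
      have := hg.mul (linearForm_isHomogeneous z)
      rwa [← hx] at this)
    simp only [hr, zero_mul, Finset.sum_const_zero, add_zero] at h
    rw [Finset.sum_eq_single (⟨i, t⟩ : ι × Fin n)] at h
    · simpa [Λ, eval_linearForm, hg0, hz] using h
    · rintro ⟨j, s⟩ - hjs
      rcases eq_or_ne j i with rfl | hji
      · have hs : s ≠ t := by rintro rfl; exact hjs rfl
        simp [Λ, hgs s hs]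
      · simp [Λ, (hgj j hji s).1]
    · simp
  · exact hr a

end Conditions

/-! ### Counting lines -/

section Count

theorem six_mul_choose_three (n : ℕ) : 6 * (n + 3).choose 3 = (n + 3) * (n + 2) * (n + 1) := by
  have := Nat.descFactorial_eq_factorial_mul_choose (n + 3) 3
  simp [Nat.descFactorial, Nat.factorial] at this
  rw [← this]
  ring

theorem le_mul_of_forall_choose {d e r D : ℕ}
    (h : ∀ n x, x + d + e = 2 * r + n + 1 →
      D * n + (x + e + 3).choose 3 + (x + d + 3).choose 3 ≤
        (x + d + e + 3).choose 3 + (x + 3).choose 3) :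
    D ≤ d * e := by
  by_contra! hD
  obtain ⟨y, hy⟩ : ∃ y, y = d * e * (4 * r + d + e + 6) + 1 := ⟨_, rfl⟩
  have h1 := h (d + e + y) (2 * r + 1 + y) (by ring)
  obtain ⟨x, hx⟩ : ∃ x, x = 2 * r + 1 + y := ⟨_, rfl⟩
  rw [← hx] at h1
  have h2 := six_mul_choose_three x
  have h3 := six_mul_choose_three (x + d)
  have h4 := six_mul_choose_three (x + e)
  have h5 := six_mul_choose_three (x + d + e)
  have h6 : 6 * (D * (d + e + y)) + (x + e + 3) * (x + e + 2) * (x + e + 1) +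
      (x + d + 3) * (x + d + 2) * (x + d + 1) ≤
      (x + d + e + 3) * (x + d + e + 2) * (x + d + e + 1) + (x + 3) * (x + 2) * (x + 1) := by
    omega
  have h7 : 2 * (D * (d + e + y)) ≤ 2 * (d * e) * x + d * e * (d + e + 4) := by linarith
  have h8 : (d * e + 1) * (d + e + y) ≤ D * (d + e + y) := Nat.mul_le_mul_right _ hD
  subst hx
  nlinarith [Nat.zero_le (d * e * (d + e))]

variable {K : Type*} [Field K]

theorem exists_basis_pair {W : Submodule K (Fin 4 → K)} (hW : Module.finrank K W = 2) :
    ∃ a b : Fin 4 → K, LinearIndependent K ![a, b] ∧ a ∈ W ∧ b ∈ W ∧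
      ∀ v ∈ W, ∃ x y : K, v = x • a + y • b := by
  let B := Module.finBasisOfFinrankEq K W hW
  refine ⟨B 0, B 1, ?_, (B 0).2, (B 1).2, ?_⟩
  · have := B.linearIndependent.map' W.subtype W.ker_subtype
    rwa [show (W.subtype ∘ B : Fin 2 → Fin 4 → K) = ![(B 0 : Fin 4 → K), B 1] by
      ext i; fin_cases i <;> rfl] at this
  · intro v hv
    refine ⟨B.repr ⟨v, hv⟩ 0, B.repr ⟨v, hv⟩ 1, ?_⟩
    have := congrArg Subtype.val (B.sum_repr ⟨v, hv⟩)
    rw [Fin.sum_univ_two] at this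
    exact this.symm

theorem eventually_notMem {W W' : Submodule K (Fin 4 → K)} (hW : Module.finrank K W = 2)
    (hW' : Module.finrank K W' = 2) (hne : W ≠ W') {a b : Fin 4 → K}
    (hspan : ∀ v ∈ W, ∃ x y : K, v = x • a + y • b) :
    ∀ᶠ τ : K in Filter.cofinite, a + τ • b ∉ W' := by
  rw [Filter.eventually_cofinite]
  refine Set.Subsingleton.finite fun σ hσ τ hτ => ?_
  simp only [not_not, Set.mem_ofPred_eq] at hσ hτ
  by_contra hστ
  have hb : b ∈ W' := by
    have := W'.sub_mem hσ hτ
    rw [show a + σ • b - (a + τ • b) = (σ - τ) • b by module] at this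
    exact (W'.smul_mem_iff (sub_ne_zero.mpr hστ)).mp this
  have ha : a ∈ W' := (W'.add_mem_iff_left (W'.smul_mem σ hb)).mp hσ
  refine hne (Submodule.eq_of_le_of_finrank_eq (fun v hv => ?_) (hW.trans hW'.symm))
  obtain ⟨x, y, rfl⟩ := hspan v hv
  exact W'.add_mem (W'.smul_mem _ ha) (W'.smul_mem _ hb)

theorem exists_embedding_of_eventually {α : Type*} [Infinite α] {q : α → Prop}
    (h : ∀ᶠ τ in Filter.cofinite, q τ) (n : ℕ) :
    ∃ σ : Fin n → α, Function.Injective σ ∧ ∀ t, q (σ t) := by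
  have : Infinite {τ // q τ} := Set.infinite_coe_iff.mpr
    (Filter.frequently_cofinite_iff_infinite.mp h.frequently)
  exact ⟨fun t => Infinite.natEmbedding {τ // q τ} t, fun s t hst => Fin.ext
    ((Infinite.natEmbedding _).injective (Subtype.ext hst)),
    fun t => (Infinite.natEmbedding {τ // q τ} t).2⟩

variable [IsAlgClosed K]

theorem card_add_card_le {d : ℕ} (hd : 3 ≤ d) (hchar : ringChar K = 0 ∨ d < ringChar K)
    {f : MvPolynomial (Fin 4) K} (hf : IsSmoothSurfaceOfDegree f d) {ι : Type*} [Fintype ι]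
    {W : ι → Submodule K (Fin 4 → K)} (hW : Function.Injective W)
    (hline : ∀ i, IsLineInSurface f (W i)) (S : Finset ι) (hS : ∀ i ∈ S, SecondKindCond f d (W i)) :
    Fintype.card ι + S.card ≤ d * (11 * d - 24) := by
  obtain ⟨m, rfl⟩ : ∃ m, d = m + 3 := ⟨d - 3, by omega⟩
  obtain ⟨F, hFh, hF⟩ := exists_flecnodal_form hf
  rw [show 11 * (m + 3) - 24 = 11 * m + 9 by omega]
  choose a b hab haW hbW hspan using fun i => exists_basis_pair (hline i).1
  refine le_mul_of_forall_choose (r := Fintype.card ι) fun n x hx => ?_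
  have hev : ∀ i, ∀ᶠ τ : K in Filter.cofinite, (∀ j, i ≠ j → a i + τ • b i ∉ W j) ∧
      (i ∈ S → ∃ w ∉ W i, D1 f (a i + τ • b i) w = 0 ∧ D1 F (a i + τ • b i) w = 0) := by
    intro i
    refine Filter.Eventually.and (Filter.eventually_all.mpr fun j => ?_) ?_
    · by_cases hij : i = j
      · simp [hij]
      · filter_upwards [eventually_notMem (hline i).1 (hline j).1 (hW.ne hij) (hspan i)]
          with τ hτ _ using hτ
    · by_cases hi : i ∈ S
      · filter_upwards [eventually_exists_transverse hf hF hd hchar (hab i) (haW i) (hbW i)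
          (hline i).2 (hspan i) (hS i hi)] with τ hτ _ using hτ
      · simp [hi]
  choose σ hσ hσW hσS using fun i => exists_embedding_of_eventually (hev i) n
  choose! w hw hfw hFw using hσS
  have hpair : ∀ i (x y : K), x • a i + y • b i = 0 → x = 0 ∧ y = 0 :=
    fun i => LinearIndependent.pair_iff.mp (hab i)
  have hzero : ∀ i (x y : K), eval (x • a i + y • b i) f = 0 := fun i x y =>
    (hline i).2 _ ((W i).add_mem ((W i).smul_mem _ (haW i)) ((W i).smul_mem _ (hbW i)))
  have hp : ∀ i t, a i + σ i t • b i ∈ W i := fun i t =>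
    (W i).add_mem (haW i) ((W i).smul_mem _ (hbW i))
  refine card_conditions_le (p := fun i t => a i + σ i t • b i) (w := fun i t => w i t)
    (smooth_prime hf hd) hf.1 hFh (not_dvd_flecnodal hf hd hchar hF) S hp
    (fun i j t hij => hσW i t j hij) ?_ ?_ (fun i hi t => hw i t hi)
      (fun i t => (hline i).2 _ (hp i t))
    ?_ (fun i hi t => hfw i t hi) (fun i hi t => hFw i t hi) hx
  · intro i s t hst hmem
    obtain ⟨c, hc⟩ := Submodule.mem_span_singleton.mp hmem
    obtain ⟨h1, h2⟩ := hpair i (c - 1) (c * σ i s - σ i t) (by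
      rw [← sub_eq_zero] at hc
      rw [← hc]
      module)
    rw [sub_eq_zero.mp h1, one_mul, sub_eq_zero] at h2
    exact hst (hσ i h2)
  · intro i t h
    exact one_ne_zero (hpair i 1 (σ i t) (by simpa using h)).1
  · intro i t
    have := flecnodal_eq_zero_of_line hf hF (hab i) (hzero i) (σ i t)
    simpa using this

end Count

end FlecnodalBound

theorem first_plus_twice_second_kind_bound
    {K : Type*} [Field K] [IsAlgClosed K] (d : ℕ) (hd : 3 ≤ d)
    (hchar : ringChar K = 0 ∨ d < ringChar K)
    (f : MvPolynomial (Fin 4) K) (hf : IsSmoothSurfaceOfDegree f d) :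
    {W : Submodule K (Fin 4 → K) | IsLineOfFirstKind f d W}.Finite ∧
      {W : Submodule K (Fin 4 → K) | IsLineOfSecondKind f d W}.Finite ∧
      {W : Submodule K (Fin 4 → K) | IsLineOfFirstKind f d W}.ncard +
          2 * {W : Submodule K (Fin 4 → K) | IsLineOfSecondKind f d W}.ncard ≤
        d * (11 * d - 24) := by
  have hfin : {W : Submodule K (Fin 4 → K) | IsLineInSurface f W}.Finite := by
    by_contra hinf
    obtain ⟨T, hT, hcard⟩ := Set.Infinite.exists_subset_card_eq hinf (d * (11 * d - 24) + 1)
    have := FlecnodalBound.card_add_card_le hd hchar hf (W := fun i : T => i.1)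
      Subtype.val_injective (fun i => hT i.2) ∅ (by simp)
    simp [hcard] at this
  have h1 : {W : Submodule K (Fin 4 → K) | IsLineOfFirstKind f d W}.Finite :=
    hfin.subset fun W hW => hW.1
  have h2 : {W : Submodule K (Fin 4 → K) | IsLineOfSecondKind f d W}.Finite :=
    hfin.subset fun W hW => hW.1
  refine ⟨h1, h2, ?_⟩
  classical
  have := h1.fintype
  have := h2.fintype
  have key := FlecnodalBound.card_add_card_le hd hchar hf
    (ι := {W | IsLineOfFirstKind f d W} ⊕ {W | IsLineOfSecondKind f d W})
    (W := Sum.elim Subtype.val Subtype.val)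
    (Subtype.val_injective.sumElim Subtype.val_injective fun V W h => V.2.2 (h ▸ W.2.2))
    (by rintro (V | W); exacts [V.2.1, W.2.1]) (Finset.univ.map Function.Embedding.inr)
    (fun V hV => by
      obtain ⟨V, -, rfl⟩ := Finset.mem_map.mp hV
      exact V.2.2)
  rw [Fintype.card_sum, Finset.card_map, Finset.card_univ, ← Nat.card_eq_fintype_card,
    ← Nat.card_eq_fintype_card, Nat.card_coe_set_eq, Nat.card_coe_set_eq] at key
  omega
end

section
/- Let X = {f = 0} ⊂ P³(K) be a smooth surface of degree d ≥ 3 over an algebraically closed field K of characteristic 0 or of characteristic p > d, and let L ⊆ X be a line. Then the set of points P ∈ L such that the intersection of the projective tangent plane T_P X and the Hessian quadric V_P does not consist of two distinct lines is finite. Equivalently, for all but finitely many P ∈ L, the restriction of t_P^(2) to the plane T_P X is a product of two non-proportional linear forms. -/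
open MvPolynomial

/-- The form `t_P^{(j)}(z) = ∑_{0 ≤ i₁,…,i_j ≤ 3} (∂^j f/∂w_{i₁}⋯∂w_{i_j})(P) · z_{i₁}⋯z_{i_j}`. -/
noncomputable def tForm {K : Type*} [CommSemiring K]
    (f : MvPolynomial (Fin 4) K) (j : ℕ) (P : Fin 4 → K) : MvPolynomial (Fin 4) K :=
  ∑ s : Fin j → Fin 4,
    MvPolynomial.C
        (MvPolynomial.eval P ((List.ofFn s).foldr (fun i g => MvPolynomial.pderiv i g) f)) *
      ∏ a : Fin j, MvPolynomial.X (s a)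

/-- The derivation `g ↦ ∑ i, v i • ∂g/∂wᵢ`, as a linear function of the direction `v`. -/
noncomputable def dirDeriv {K : Type*} [Field K] :
    (Fin 4 → K) →ₗ[K] Derivation K (MvPolynomial (Fin 4) K) (MvPolynomial (Fin 4) K) :=
  ∑ i, LinearMap.smulRight (LinearMap.proj i) (pderiv i)

section DirDeriv

variable {K : Type*} [Field K]

theorem dirDeriv_apply (v : Fin 4 → K) (g : MvPolynomial (Fin 4) K) :
    dirDeriv v g = ∑ i, v i • pderiv i g := by
  simp [dirDeriv, Fin.sum_univ_four]

theorem dirDeriv_X (v : Fin 4 → K) (i : Fin 4) : dirDeriv v (X i) = C (v i) := by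
  rw [dirDeriv_apply, Finset.sum_eq_single i]
  · simp [smul_eq_C_mul]
  · intro j _ hj
    simp [pderiv_X_of_ne hj.symm]
  · simp

theorem dirDeriv_comm (v w : Fin 4 → K) (g : MvPolynomial (Fin 4) K) :
    dirDeriv v (dirDeriv w g) = dirDeriv w (dirDeriv v g) := by
  have h : ⁅dirDeriv v, dirDeriv w⁆ = (0 : Derivation K _ (MvPolynomial (Fin 4) K)) := by
    apply MvPolynomial.derivation_ext
    intro i
    simp [Derivation.commutator_apply, dirDeriv_X]
  have := DFunLike.congr_fun h g
  rwa [Derivation.commutator_apply, Derivation.zero_apply, sub_eq_zero] at this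

theorem MvPolynomial.IsHomogeneous.dirDeriv {g : MvPolynomial (Fin 4) K} {n : ℕ}
    (hg : g.IsHomogeneous n) (v : Fin 4 → K) : (dirDeriv v g).IsHomogeneous (n - 1) := by
  rw [dirDeriv_apply]
  exact (homogeneousSubmodule (Fin 4) K (n - 1)).sum_mem fun i _ =>
    (homogeneousSubmodule (Fin 4) K (n - 1)).smul_mem _ hg.pderiv

theorem eval_dirDeriv_self {g : MvPolynomial (Fin 4) K} {n : ℕ}
    (hg : g.IsHomogeneous n) (u : Fin 4 → K) :
    eval u (dirDeriv u g) = n * eval u g := by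
  have := congrArg (eval u) hg.sum_X_mul_pderiv
  simpa [dirDeriv_apply, smul_eval] using this

theorem MvPolynomial.IsHomogeneous.eval_smul_point {g : MvPolynomial (Fin 4) K} {n : ℕ}
    (hg : g.IsHomogeneous n) (c : K) (u : Fin 4 → K) :
    eval (c • u) g = c ^ n * eval u g := by
  rw [eval_eq, eval_eq, Finset.mul_sum]
  refine Finset.sum_congr rfl fun m hm => ?_
  have hdeg : m.degree = n := by
    rw [← hg (mem_support_iff.1 hm), Finsupp.degree_eq_weight_one]
    rfl
  rw [← hdeg, Finsupp.degree_eq_sum]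
  simp only [Pi.smul_apply, smul_eq_mul, mul_pow, Finset.prod_mul_distrib,
    Finset.prod_pow_eq_pow_sum]
  have : ∑ i ∈ m.support, m i = ∑ i, m i :=
    Finset.sum_subset (Finset.subset_univ _) (by simp)
  rw [this]
  ring

theorem eval_restrictLine (g : MvPolynomial (Fin 4) K) (u v : Fin 4 → K) (x : K) :
    (restrictLine g u v).eval x = eval (u + x • v) g := by
  unfold restrictLine
  induction g using MvPolynomial.induction_on with
  | C a => simp
  | add p q hp hq => simp only [map_add, Polynomial.eval_add, hp, hq]
  | mul_X p i hp => simp only [map_mul, aeval_X, Polynomial.eval_mul, hp]; simp [-Polynomial.X_mul_C]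

theorem derivative_restrictLine (g : MvPolynomial (Fin 4) K) (u v : Fin 4 → K) :
    Polynomial.derivative (restrictLine g u v) = restrictLine (dirDeriv v g) u v := by
  unfold restrictLine
  induction g using MvPolynomial.induction_on with
  | C a =>
    rw [show dirDeriv v (C a) = 0 from (dirDeriv v).map_algebraMap a]
    simp
  | add p q hp hq => simp only [map_add, hp, hq]
  | mul_X p i hp =>
    simp [-Polynomial.X_mul_C, hp, dirDeriv_X, Derivation.leibniz]
    ring

theorem natDegree_restrictLine_le {g : MvPolynomial (Fin 4) K} {n : ℕ}
    (hg : g.IsHomogeneous n) (u v : Fin 4 → K) : (restrictLine g u v).natDegree ≤ n := by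
  have := MvPolynomial.aeval_natDegree_le (m := n) (n := 1) g hg.totalDegree_le
    (fun i => Polynomial.C (u i) + Polynomial.X * Polynomial.C (v i)) fun i => by
      compute_degree
  simpa [restrictLine] using this

/-- If `g` vanishes on a linear subspace then so do its derivatives along that subspace. -/
theorem eval_dirDeriv_eq_zero [Infinite K] {g : MvPolynomial (Fin 4) K}
    {W : Submodule K (Fin 4 → K)} (hg : ∀ u ∈ W, eval u g = 0) {u v : Fin 4 → K}
    (hu : u ∈ W) (hv : v ∈ W) : eval u (dirDeriv v g) = 0 := by
  have h : restrictLine g u v = 0 := Polynomial.funext fun x => by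
    rw [eval_restrictLine, Polynomial.eval_zero]
    exact hg _ (W.add_mem hu (W.smul_mem _ hv))
  have hz := eval_restrictLine (dirDeriv v g) u v 0
  rw [← derivative_restrictLine, h] at hz
  simpa using hz.symm

/-- A homogeneous form of positive degree whose restriction to the affine chart `u + t • v`
of a line is constant vanishes at the point at infinity `v`. -/
theorem eval_eq_zero_of_restrictLine_eq_C [Infinite K] {g : MvPolynomial (Fin 4) K} {n : ℕ}
    (hg : g.IsHomogeneous n) (hn : n ≠ 0) {u v : Fin 4 → K} {c : K}
    (h : restrictLine g u v = Polynomial.C c) : eval v g = 0 := by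
  have key : restrictLine g v u = Polynomial.C c * Polynomial.X ^ n := by
    refine Polynomial.eq_of_infinite_eval_eq _ _ ((Set.finite_singleton (0 : K)).infinite_compl.mono
      fun y hy => ?_)
    have hy : y ≠ 0 := hy
    have h1 := eval_restrictLine g u v y⁻¹
    rw [h, Polynomial.eval_C] at h1
    have h2 : v + y • u = y • (u + y⁻¹ • v) := by
      rw [smul_add, smul_inv_smul₀ hy, add_comm]
    change Polynomial.eval y _ = Polynomial.eval y _
    rw [eval_restrictLine, h2, hg.eval_smul_point, ← h1, mul_comm]
    simp
  have := eval_restrictLine g v u 0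
  rw [key] at this
  simpa [hn] using this.symm

theorem eval_tForm_one (f : MvPolynomial (Fin 4) K) (u z : Fin 4 → K) :
    eval z (tForm f 1 u) = eval u (dirDeriv z f) := by
  rw [tForm, ← (Equiv.funUnique (Fin 1) (Fin 4)).symm.sum_comp, dirDeriv_apply, map_sum, map_sum]
  refine Finset.sum_congr rfl fun i _ => ?_
  rw [Fin.prod_univ_one]
  change eval z (C (eval u (pderiv i f)) * X i) = _
  rw [map_mul, eval_C, eval_X, smul_eval, mul_comm]

theorem eval_tForm_two (f : MvPolynomial (Fin 4) K) (u z : Fin 4 → K) :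
    eval z (tForm f 2 u) = eval u (dirDeriv z (dirDeriv z f)) := by
  rw [tForm, ← (finTwoArrowEquiv (Fin 4)).symm.sum_comp, Fintype.sum_prod_type]
  simp [dirDeriv_apply, Finset.mul_sum, List.ofFn_succ, Derivation.map_smul]
  rw [Finset.sum_comm]
  refine Finset.sum_congr rfl fun i _ => Finset.sum_congr rfl fun j _ => ?_
  ring

theorem zeroLocus_tForm_smul {d : ℕ} {f : MvPolynomial (Fin 4) K}
    (hf : f.IsHomogeneous d) {c : K} (hc : c ≠ 0) (u : Fin 4 → K) :
    {z : Fin 4 → K | eval z (tForm f 1 (c • u)) = 0 ∧ eval z (tForm f 2 (c • u)) = 0} =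
      {z : Fin 4 → K | eval z (tForm f 1 u) = 0 ∧ eval z (tForm f 2 u) = 0} := by
  ext z
  simp [eval_tForm_one, eval_tForm_two, (hf.dirDeriv z).eval_smul_point,
    ((hf.dirDeriv z).dirDeriv z).eval_smul_point, hc]

end DirDeriv

/-- A symmetric bilinear form vanishing on a plane `W` restricts to the hyperplane `ℓ = 0`
containing `W`, with `u ∈ W` in its radical, as a product of two non-proportional linear forms
as soon as `v ∈ W` is not in its radical. -/
theorem exists_union_of_bilin {K V : Type*} [Field K] [AddCommGroup V] [Module K V]
    (h2 : (2 : K) ≠ 0) {W : Submodule K V} {u v e₂ e₃ : V}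
    (hu : u ∈ W) (hv : v ∈ W) (hu0 : u ≠ 0) (hW : ∀ y ∈ W, ∃ s t : K, y = s • u + t • v)
    (htop : ∀ z : V, ∃ y ∈ W, ∃ p q : K, z = y + p • e₂ + q • e₃)
    (hindep : ∀ p q : K, p • e₂ + q • e₃ ∈ W → p = 0 ∧ q = 0)
    (ℓ : V →ₗ[K] K) (H : V →ₗ[K] V →ₗ[K] K) (hsymm : ∀ x y, H x y = H y x)
    (hℓ : ∀ y ∈ W, ℓ y = 0) (hH : ∀ x ∈ W, ∀ y ∈ W, H x y = 0)
    (hrad : ∀ z, ℓ z = 0 → H u z = 0)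
    (hne : H v (ℓ e₃ • e₂ - ℓ e₂ • e₃) ≠ 0) :
    ∃ W₂ : Submodule K V, Module.finrank K W₂ = 2 ∧ W ≠ W₂ ∧
      {z : V | ℓ z = 0 ∧ H z z = 0} = (W : Set V) ∪ (W₂ : Set V) := by
  set n := ℓ e₃ • e₂ - ℓ e₂ • e₃ with hn
  set w := H v n with hw
  have hℓn : ℓ n = 0 := by simp [hn]; ring
  have hun : H u n = 0 := hrad n hℓn
  have hnW : n ∉ W := fun h => by
    obtain ⟨h3, h4⟩ := hindep (ℓ e₃) (-ℓ e₂) (by simpa [hn, sub_eq_add_neg] using h)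
    exact hne (by simp [hw, hn, h3, neg_eq_zero.mp h4])
  set m := (2 * w) • n - H n n • v with hm
  have hmW : m ∉ W := fun h => hnW <| by
    have : (2 * w) • n ∈ W := by
      simpa [hm] using W.add_mem h (W.smul_mem (H n n) hv)
    exact (W.smul_mem_iff (mul_ne_zero h2 hne)).1 this
  have hℓm : ℓ m = 0 := by simp [hm, hℓn, hℓ v hv]
  have hum : H u m = 0 := hrad m hℓm
  have hmm : H m m = 0 := by
    simp [hm, hsymm n v, hH v hv v hv, ← hw]; ring
  have hform : ∀ s t r : K, H (s • u + t • v + r • n) (s • u + t • v + r • n)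
      = r * (2 * t * w + r * H n n) := fun s t r => by
    simp [hsymm n v, hsymm n u, hH v hv v hv, hH u hu u hu, hH u hu v hv, hH v hv u hu, ← hw, hun]
    ring
  refine ⟨Submodule.span K {u, m}, ?_, ?_, ?_⟩
  · have hli : LinearIndependent K ![u, m] := by
      rw [LinearIndependent.pair_iff]
      intro s t hst
      have ht : t = 0 := by
        by_contra ht
        refine hmW ((W.smul_mem_iff ht).1 ?_)
        rw [eq_neg_of_add_eq_zero_right hst]
        exact W.neg_mem (W.smul_mem _ hu)
      exact ⟨by simpa [ht, hu0] using hst, ht⟩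
    have := finrank_span_eq_card hli
    rwa [Matrix.range_cons_cons_empty, Fintype.card_fin] at this
  · rintro h
    exact hmW (h ▸ Submodule.subset_span (by simp))
  · ext z
    simp only [Set.mem_ofPred_eq, Set.mem_union, SetLike.mem_coe, Submodule.mem_span_pair]
    constructor
    · rintro ⟨hz, hzz⟩
      obtain ⟨y, hy, p, q, rfl⟩ := htop z
      obtain ⟨s, t, rfl⟩ := hW y hy
      have hpq : p * ℓ e₂ + q * ℓ e₃ = 0 := by simpa [hℓ u hu, hℓ v hv] using hz
      obtain ⟨r, hp, hq⟩ : ∃ r, p = r * ℓ e₃ ∧ q = -(r * ℓ e₂) := by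
        by_cases h3 : ℓ e₃ = 0
        · have h4 : ℓ e₂ ≠ 0 := fun h4 => hne (by simp [hw, hn, h3, h4])
          refine ⟨-q / ℓ e₂, ?_, by field_simp⟩
          simpa [h3, h4] using hpq
        · exact ⟨p / ℓ e₃, by field_simp, by field_simp; linear_combination hpq⟩
      have hzn : s • u + t • v + p • e₂ + q • e₃ = s • u + t • v + r • n := by
        rw [hp, hq, hn]; module
      rw [hzn, hform] at hzz
      rw [hzn]
      rcases mul_eq_zero.1 hzz with hr | hr
      · left
        rw [hr, zero_smul, add_zero]
        exact hy
      · right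
        have ht : t = -(r / (2 * w)) * H n n := by
          field_simp; linear_combination hr
        refine ⟨s, r / (2 * w), ?_⟩
        rw [hm, ht, smul_sub, smul_smul, div_mul_cancel₀ _ (mul_ne_zero h2 hne)]
        module
    · rintro (hz | ⟨s, t, rfl⟩)
      · exact ⟨hℓ z hz, hH z hz z hz⟩
      · simp [hℓ u hu, hℓm, hH u hu u hu, hsymm m u, hum, hmm]

theorem exists_adapted_basis {K V : Type*} [Field K] [AddCommGroup V] [Module K V]
    [FiniteDimensional K V] (hV : Module.finrank K V = 4) {W : Submodule K V}
    (hW : Module.finrank K W = 2) :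
    ∃ e₀ ∈ W, ∃ e₁ ∈ W, ∃ e₂ e₃ : V, LinearIndependent K ![e₀, e₁] ∧
      (∀ y ∈ W, ∃ s t : K, y = s • e₀ + t • e₁) ∧
      (∀ z : V, ∃ y ∈ W, ∃ p q : K, z = y + p • e₂ + q • e₃) ∧
      ∀ p q : K, p • e₂ + q • e₃ ∈ W → p = 0 ∧ q = 0 := by
  obtain ⟨W', hC⟩ := W.exists_isCompl
  have hW' : Module.finrank K W' = 2 := by
    have := Submodule.finrank_add_eq_of_isCompl hC
    omega
  let b := Module.finBasisOfFinrankEq K W hW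
  let b' := Module.finBasisOfFinrankEq K W' hW'
  have hb (y : W) : (y : V) = b.repr y 0 • (b 0 : V) + b.repr y 1 • (b 1 : V) := by
    have := congrArg Subtype.val (b.sum_repr y)
    rw [Fin.sum_univ_two] at this
    exact this.symm
  have hb' (y : W') : (y : V) = b'.repr y 0 • (b' 0 : V) + b'.repr y 1 • (b' 1 : V) := by
    have := congrArg Subtype.val (b'.sum_repr y)
    rw [Fin.sum_univ_two] at this
    exact this.symm
  refine ⟨b 0, (b 0).2, b 1, (b 1).2, b' 0, b' 1, ?_, fun y hy => ⟨_, _, hb ⟨y, hy⟩⟩, ?_, ?_⟩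
  · have := b.linearIndependent.map' W.subtype W.ker_subtype
    convert! this using 1
    ext i
    fin_cases i <;> rfl
  · intro z
    obtain ⟨y, hy, y', hy', rfl⟩ := Submodule.mem_sup.1
      (hC.sup_eq_top ▸ Submodule.mem_top : z ∈ W ⊔ W')
    exact ⟨y, hy, _, _, by rw [add_assoc, ← hb' ⟨y', hy'⟩]⟩
  · intro p q h
    have h0 : p • (b' 0 : V) + q • (b' 1 : V) = 0 :=
      Submodule.disjoint_def.1 hC.disjoint _ h
        (W'.add_mem (W'.smul_mem _ (b' 0).2) (W'.smul_mem _ (b' 1).2))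
    have hli := b'.linearIndependent.map' W'.subtype W'.ker_subtype
    have hli' : LinearIndependent K ![(b' 0 : V), (b' 1 : V)] := by
      convert! hli using 1
      ext i
      fin_cases i <;> rfl
    exact LinearIndependent.pair_iff.1 hli' p q h0

theorem natCast_ne_zero_of_le {K : Type*} [Field K] {d n : ℕ}
    (hchar : ringChar K = 0 ∨ d < ringChar K) (hn : n ≠ 0) (hnd : n ≤ d) : (n : K) ≠ 0 := by
  rw [Ne, ringChar.spec]
  rcases hchar with h | h
  · simpa [h] using hn
  · exact fun hdvd => absurd (Nat.le_of_dvd (Nat.pos_of_ne_zero hn) hdvd) (by omega)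

theorem eq_C_of_derivative_eq_zero_of_natDegree_le {K : Type*} [Field K] {d : ℕ}
    (hchar : ringChar K = 0 ∨ d < ringChar K) {a : Polynomial K} (ha : a.natDegree ≤ d)
    (h : Polynomial.derivative a = 0) : a = Polynomial.C (a.coeff 0) := by
  refine Polynomial.eq_C_of_natDegree_eq_zero ?_
  by_contra h0
  have hc := congrArg (fun p => p.coeff (a.natDegree - 1)) h
  simp only [Polynomial.coeff_derivative, Polynomial.coeff_zero] at hc
  rw [← Nat.cast_succ, Nat.succ_eq_add_one, Nat.sub_add_cancel (Nat.one_le_iff_ne_zero.2 h0)] at hc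
  rcases mul_eq_zero.1 hc with hc | hc
  · exact h0 (by simp [Polynomial.leadingCoeff_eq_zero.1 hc])
  · exact natCast_ne_zero_of_le hchar h0 ha hc

section Surface

variable {K : Type*} [Field K] [IsAlgClosed K] {d : ℕ} {f : MvPolynomial (Fin 4) K}
  {W : Submodule K (Fin 4 → K)} {e₀ e₁ e₂ e₃ : Fin 4 → K}

theorem eval_dirDeriv_ne_zero_of_smooth (hf : IsSmoothSurfaceOfDegree f d)
    (hW : IsLineInSurface f W)
    (htop : ∀ z : Fin 4 → K, ∃ y ∈ W, ∃ p q : K, z = y + p • e₂ + q • e₃)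
    {u : Fin 4 → K} (hu : u ∈ W) (hu0 : u ≠ 0) :
    eval u (dirDeriv e₂ f) ≠ 0 ∨ eval u (dirDeriv e₃ f) ≠ 0 := by
  have : Infinite K := IsAlgClosed.instInfinite
  by_contra! h
  obtain ⟨i, hi⟩ := hf.2 u hu0
  obtain ⟨y, hy, p, q, hz⟩ := htop (Pi.single i 1)
  have hsingle : dirDeriv (Pi.single i 1) f = pderiv i f := by
    rw [dirDeriv_apply, Finset.sum_eq_single i] <;> simp +contextual
  rw [← hsingle, hz] at hi
  simp [h, smul_eval, eval_dirDeriv_eq_zero hW.2 hu hy] at hi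

/-- The two normal derivatives of `f` along a line in a smooth surface have non-zero
Wronskian. -/
theorem wronskian_dirDeriv_ne_zero (hd : 3 ≤ d)
    (hchar : ringChar K = 0 ∨ d < ringChar K) (hf : IsSmoothSurfaceOfDegree f d)
    (hW : IsLineInSurface f W) (h₀ : e₀ ∈ W) (h₁ : e₁ ∈ W)
    (hli : LinearIndependent K ![e₀, e₁])
    (htop : ∀ z : Fin 4 → K, ∃ y ∈ W, ∃ p q : K, z = y + p • e₂ + q • e₃) :
    Polynomial.wronskian (restrictLine (dirDeriv e₂ f) e₀ e₁)
      (restrictLine (dirDeriv e₃ f) e₀ e₁) ≠ 0 := by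
  have : Infinite K := IsAlgClosed.instInfinite
  rw [LinearIndependent.pair_iff] at hli
  have hcop : IsCoprime (restrictLine (dirDeriv e₂ f) e₀ e₁)
      (restrictLine (dirDeriv e₃ f) e₀ e₁) := by
    rw [Polynomial.isCoprime_iff_aeval_ne_zero_of_isAlgClosed K K]
    intro x
    simp only [Polynomial.coe_aeval_eq_eval, eval_restrictLine]
    refine eval_dirDeriv_ne_zero_of_smooth hf hW htop (W.add_mem h₀ (W.smul_mem _ h₁)) ?_
    intro h
    exact one_ne_zero (hli 1 x (by rwa [one_smul])).1
  have hconst : ∀ e, Polynomial.derivative (restrictLine (dirDeriv e f) e₀ e₁) = 0 →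
      eval e₁ (dirDeriv e f) = 0 := fun e he =>
    eval_eq_zero_of_restrictLine_eq_C (hf.1.dirDeriv e) (by omega)
      (eq_C_of_derivative_eq_zero_of_natDegree_le hchar
        ((natDegree_restrictLine_le (hf.1.dirDeriv e) _ _).trans (by omega)) he)
  rw [Ne, hcop.wronskian_eq_zero_iff]
  rintro ⟨ha, hb⟩
  have he₁ : e₁ ≠ 0 := by
    rintro rfl
    exact one_ne_zero (hli 0 1 (by simp)).2
  exact (eval_dirDeriv_ne_zero_of_smooth hf hW htop h₁ he₁).elim
    (fun h => h (hconst _ ha)) fun h => h (hconst _ hb)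

theorem exists_two_lines_of_wronskian_ne_zero (hd : 3 ≤ d)
    (hchar : ringChar K = 0 ∨ d < ringChar K) (hf : IsSmoothSurfaceOfDegree f d)
    (hW : IsLineInSurface f W) (h₀ : e₀ ∈ W) (h₁ : e₁ ∈ W)
    (hli : LinearIndependent K ![e₀, e₁])
    (hspan : ∀ y ∈ W, ∃ s t : K, y = s • e₀ + t • e₁)
    (htop : ∀ z : Fin 4 → K, ∃ y ∈ W, ∃ p q : K, z = y + p • e₂ + q • e₃)
    (hindep : ∀ p q : K, p • e₂ + q • e₃ ∈ W → p = 0 ∧ q = 0) {x : K}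
    (hx : (Polynomial.wronskian (restrictLine (dirDeriv e₂ f) e₀ e₁)
      (restrictLine (dirDeriv e₃ f) e₀ e₁)).eval x ≠ 0) :
    ∃ W₂ : Submodule K (Fin 4 → K), Module.finrank K W₂ = 2 ∧ W ≠ W₂ ∧
      {z : Fin 4 → K | eval z (tForm f 1 (e₀ + x • e₁)) = 0 ∧
        eval z (tForm f 2 (e₀ + x • e₁)) = 0} = (W : Set (Fin 4 → K)) ∪ W₂ := by
  have : Infinite K := IsAlgClosed.instInfinite
  rw [LinearIndependent.pair_iff] at hli
  set u := e₀ + x • e₁ with hu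
  have huW : u ∈ W := W.add_mem h₀ (W.smul_mem _ h₁)
  let ℓ : (Fin 4 → K) →ₗ[K] K :=
    { toFun := fun z => eval u (dirDeriv z f)
      map_add' := by simp
      map_smul' := by simp [smul_eval] }
  let H : (Fin 4 → K) →ₗ[K] (Fin 4 → K) →ₗ[K] K :=
    LinearMap.mk₂ K (fun y z => eval u (dirDeriv y (dirDeriv z f)))
      (by simp) (by simp [smul_eval]) (by simp) (by simp [smul_eval])
  have h2 : (2 : K) ≠ 0 := by
    exact_mod_cast natCast_ne_zero_of_le (n := 2) hchar two_ne_zero (by omega)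
  simp only [eval_tForm_one, eval_tForm_two]
  refine exists_union_of_bilin h2 huW h₁ ?_ ?_ htop hindep ℓ H ?_ ?_ ?_ ?_ ?_
  · intro h
    exact one_ne_zero (hli 1 x (by rwa [one_smul])).1
  · intro y hy
    obtain ⟨s, t, rfl⟩ := hspan y hy
    exact ⟨s, t - s * x, by rw [hu]; module⟩
  · intro y z
    simp [H, dirDeriv_comm y z]
  · exact fun y hy => eval_dirDeriv_eq_zero hW.2 huW hy
  · exact fun y hy z hz => eval_dirDeriv_eq_zero
      (fun w hw => eval_dirDeriv_eq_zero hW.2 hw hz) huW hy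
  · intro z hz
    exact (eval_dirDeriv_self (hf.1.dirDeriv z) u).trans (by rw [show eval u _ = 0 from hz, mul_zero])
  · convert! neg_ne_zero.2 hx using 1
    simp only [Polynomial.wronskian, Polynomial.eval_sub, Polynomial.eval_mul,
      derivative_restrictLine, eval_restrictLine, ← hu]
    simp [ℓ, H]
    ring

end Surface

theorem degenerate_hessian_points_finite
    {K : Type*} [Field K] [IsAlgClosed K] (d : ℕ) (hd : 3 ≤ d)
    (hchar : ringChar K = 0 ∨ d < ringChar K)
    (f : MvPolynomial (Fin 4) K) (hf : IsSmoothSurfaceOfDegree f d)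
    (W : Submodule K (Fin 4 → K)) (hW : IsLineInSurface f W) :
    {P : Submodule K (Fin 4 → K) | ∃ u : Fin 4 → K, u ≠ 0 ∧ u ∈ W ∧
      P = Submodule.span K {u} ∧
      ¬ ∃ W₁ W₂ : Submodule K (Fin 4 → K), Module.finrank K W₁ = 2 ∧
          Module.finrank K W₂ = 2 ∧ W₁ ≠ W₂ ∧
          {z : Fin 4 → K | MvPolynomial.eval z (tForm f 1 u) = 0 ∧
              MvPolynomial.eval z (tForm f 2 u) = 0} =
            (W₁ : Set (Fin 4 → K)) ∪ (W₂ : Set (Fin 4 → K))}.Finite := by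
  obtain ⟨e₀, h₀, e₁, h₁, e₂, e₃, hli, hspan, htop, hindep⟩ :=
    exists_adapted_basis (by simp) hW.1
  have hw := wronskian_dirDeriv_ne_zero hd hchar hf hW h₀ h₁ hli htop
  refine (((Polynomial.rootSet_finite _ K).image
    fun x => Submodule.span K {e₀ + x • e₁}).insert (Submodule.span K {e₁})).subset
    (s := insert _ (Set.image (fun x : K => Submodule.span K {e₀ + x • e₁})
      ((Polynomial.wronskian (restrictLine (dirDeriv e₂ f) e₀ e₁)
        (restrictLine (dirDeriv e₃ f) e₀ e₁)).rootSet K))) ?_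
  rintro P ⟨u, hu0, hu, rfl, hbad⟩
  obtain ⟨s, t, rfl⟩ := hspan u hu
  by_cases hs : s = 0
  · subst hs
    have ht : t ≠ 0 := by
      rintro rfl
      simp at hu0
    left
    rw [zero_smul, zero_add, Submodule.span_singleton_smul_eq (IsUnit.mk0 t ht)]
  · right
    have hst : s • e₀ + t • e₁ = s • (e₀ + (t / s) • e₁) := by
      rw [smul_add, smul_smul, mul_div_cancel₀ _ hs]
    rw [hst, zeroLocus_tForm_smul hf.1 hs] at hbad
    refine ⟨t / s, ?_, by rw [hst, Submodule.span_singleton_smul_eq (IsUnit.mk0 s hs)]⟩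
    rw [Polynomial.mem_rootSet]
    refine ⟨hw, ?_⟩
    by_contra hx
    obtain ⟨W₂, hW₂, hne, heq⟩ := exists_two_lines_of_wronskian_ne_zero hd hchar hf hW h₀ h₁
      hli hspan htop hindep hx
    exact hbad ⟨W, W₂, hW.1, hW₂, hne, heq⟩
end
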